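/- Fix an integer d ≥ 2, δ ∈ (0,1), K > 0, p ∈ (2,∞), and T ∈ (0,∞). Let a^{jk}, b^j, c : ℝ^{d+1} → ℝ be measurable with a^{jk} = a^{kj}, |b^j| ≤ K, |c| ≤ K, and δ|θ|² ≤ Σ_{j,k=1}^d a^{jk}(t,x) θ^j θ^k ≤ δ⁻¹|θ|² for all (t,x) and θ ∈ ℝ^d; suppose there is a continuous function ω on [0,∞) with ω(0) = 0 and a_R^# ≤ ω(R) for all R ∈ [0,∞). Set Lu = u_t + Σ_{j,k} a^{jk} u_{x^j x^k} + Σ_j b^j u_{x^j} + c u. Then there exists N = N(d,δ,K,p,ω,T) such that for every smooth compactly supported u : ℝ^{d+1} → ℝ with u(t,x) = 0 whenever t ≥ T: ‖u‖_{L_p(Ω_T)} + ‖u_t‖_{L_p(Ω_T)} + ‖u_x‖_{L_p(Ω_T)} + ‖u_{xx}‖_{L_p(Ω_T)} ≤ N ‖Lu‖_{L_p(Ω_T)}. (This is the a priori estimate of the paper's main Theorem on unique solvability in W_p^{1,2}(Ω_T) for coefficients measurable in x¹ and VMO in (t,x').) -/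

import Mathlib

open MeasureTheory

/-- Partial derivative in `t`. -/
noncomputable def pdt {d : ℕ} (u : ℝ × (Fin d → ℝ) → ℝ) : ℝ × (Fin d → ℝ) → ℝ :=
  fun p => fderiv ℝ u p (1, 0)

/-- Partial derivative in `x^j`. -/
noncomputable def pdx {d : ℕ} (j : Fin d) (u : ℝ × (Fin d → ℝ) → ℝ) :
    ℝ × (Fin d → ℝ) → ℝ :=
  fun p => fderiv ℝ u p (0, Pi.single j 1)

/-- Second partial derivative in `x^j, x^k`. -/
noncomputable def pdxx {d : ℕ} (j k : Fin d) (u : ℝ × (Fin d → ℝ) → ℝ) :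
    ℝ × (Fin d → ℝ) → ℝ :=
  pdx j (pdx k u)

/-- Open Euclidean ball of radius `r` about `x` in `ℝ^d`. -/
def ballC {d : ℕ} (r : ℝ) (x : Fin d → ℝ) : Set (Fin d → ℝ) :=
  {y | ∑ j, (y j - x j) ^ 2 < r ^ 2}

/-- `Γ_r(t,x') = (t,t+r²) × B'_r(x') ⊂ ℝ × ℝ^{d-1}` (here `d-1 = n`). -/
def GammaC {n : ℕ} (r : ℝ) (t : ℝ) (x' : Fin n → ℝ) : Set (ℝ × (Fin n → ℝ)) :=
  Set.Ioo t (t + r ^ 2) ×ˢ ballC r x'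

/-- `osc_{(t,x')}(a, Λ_r(t,x))`. -/
noncomputable def oscA {n : ℕ}
    (a : ℝ × (Fin (n + 1) → ℝ) → Fin (n + 1) → Fin (n + 1) → ℝ)
    (r : ℝ) (t : ℝ) (x : Fin (n + 1) → ℝ) : ℝ :=
  (r ^ 5)⁻¹ * (((volume (ballC r (0 : Fin n → ℝ))).toReal) ^ 2)⁻¹ *
    ∫ τ in Set.Ioo (x 0 - r) (x 0 + r),
      ∫ s₁ in GammaC r t (fun j : Fin n => x j.succ),
        ∫ s₂ in GammaC r t (fun j : Fin n => x j.succ),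
          ⨆ j, ⨆ k,
            |a (s₁.1, Fin.cons τ s₁.2) j k - a (s₂.1, Fin.cons τ s₂.2) j k|

/-- `a_R^# = sup_{(t,x)} sup_{0 < r ≤ R} osc_{(t,x')}(a, Λ_r(t,x))`. -/
noncomputable def aSharp {n : ℕ}
    (a : ℝ × (Fin (n + 1) → ℝ) → Fin (n + 1) → Fin (n + 1) → ℝ) (R : ℝ) : ℝ :=
  ⨆ z : ℝ × (Fin (n + 1) → ℝ), ⨆ r : {r : ℝ // 0 < r ∧ r ≤ R},
    oscA a r.val z.1 z.2

/-- `Ω_T = (0,T) × ℝ^d`. -/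
def OmegaT (d : ℕ) (T : ℝ) : Set (ℝ × (Fin d → ℝ)) := Set.Ioo 0 T ×ˢ Set.univ

/-- `L_p(Ω)` norm on a set `Ω` (real exponent `p`). -/
noncomputable def LpNormOn {d : ℕ} (p : ℝ) (s : Set (ℝ × (Fin d → ℝ)))
    (f : ℝ × (Fin d → ℝ) → ℝ) : ℝ :=
  (∫ q in s, |f q| ^ p) ^ (1 / p)


section
open scoped ContDiff Topology ENNReal
open Metric (ball mem_ball closedBall ball_subset_ball ball_mem_nhds)
open ENNReal (ofReal ofReal_ne_top ofReal_mul toReal_ofReal ofReal_le_ofReal ofReal_add mul_ne_top)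
open Set (Ioo Ioi indicator_of_mem indicator_of_notMem mem_ofPred_eq inter_subset_left inter_subset_right Ioc Ici)
open Finset (sum_le_sum mul_sum sum_congr sum_nonneg mem_univ single_le_sum sum_add_distrib sum_eq_zero)
open Real (rpow_le_rpow norm_eq_abs sqrt mul_rpow zero_rpow iSup_nonneg dist_eq rpow_nonneg rpow_mul)
open MeasureTheory.Measure (volume_eq_prod integrableOn_of_bounded)
lemma mll {a b c : ℝ} (h : b ≤ c) (ha : 0 ≤ a) : a * b ≤ a * c := mul_le_mul_of_nonneg_left h ha
lemma mlr {a b c : ℝ} (h : b ≤ c) (ha : 0 ≤ a) : b * a ≤ c * a := mul_le_mul_of_nonneg_right h ha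
lemma evf {α : Type*} {p : α → Prop} {f : Filter α} (h : ∀ x, p x) : ∀ᶠ x in f, p x := Filter.Eventually.of_forall h

abbrev En (n : ℕ) := ℝ × (Fin (n + 1) → ℝ)
notation "Fu" n:max => En n → ℝ
notation "Ix" n:max => Fin (n+1)
notation "Fm" n:max => En n → Fin (n+1) → Fin (n+1) → ℝ
notation "Fa" n:max => Fin (n+1) → Fin (n+1) → En n → ℝ
instance instHaarEn (m : ℕ) : Measure.IsAddHaarMeasure (volume : Measure (ℝ × (Fin m → ℝ))) :=
  Measure.prod.instIsAddHaarMeasure _ _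
noncomputable def dd {n : ℕ} (e : En n) (u : Fu n) : En n → ℝ := fun z => fderiv ℝ u z e
def et {n : ℕ} : En n := (1, 0)
def ex {n : ℕ} (j : Ix n) : En n := (0, Pi.single j 1)
notation:max "dx" j:max => dd (ex j)
variable {n : ℕ} {ν δ r s R p q : ℝ} {β u w f g v : Fu n} {A : Fa n} {a : Fm n} {z : En n}
def CT (u : Fu n) : Prop := ContDiff ℝ ∞ u ∧ HasCompactSupport u
@[fun_prop] def Bdd {n : ℕ} (f : Fu n) : Prop := Measurable f ∧ ∃ M, ∀ z, |f z| ≤ M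
namespace Bdd
@[fun_prop] lemma const (c : ℝ) : Bdd (fun _ : En n => c) := ⟨measurable_const, |c|, fun _ => le_rfl⟩
@[fun_prop] lemma add (hf : Bdd f) (hg : Bdd g) : Bdd (fun z => f z + g z) := by
  obtain ⟨m1, M, h1⟩ := hf
  obtain ⟨m2, N, h2⟩ := hg
  exact ⟨m1.add m2, M + N, fun z => (abs_add_le _ _).trans (add_le_add (h1 z) (h2 z))⟩
@[fun_prop] lemma neg (hf : Bdd f) : Bdd (fun z => - f z) := by
  obtain ⟨m1, M, h1⟩ := hf
  exact ⟨m1.neg, M, fun z => by rw [abs_neg]; exact h1 z⟩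
@[fun_prop] lemma sub (hf : Bdd f) (hg : Bdd g) : Bdd (fun z => f z - g z) := by
  simpa [sub_eq_add_neg] using hf.add hg.neg
@[fun_prop] lemma mul (hf : Bdd f) (hg : Bdd g) : Bdd (fun z => f z * g z) := by
  obtain ⟨m1, M, h1⟩ := hf
  obtain ⟨m2, N, h2⟩ := hg
  refine ⟨m1.mul m2, M * N, fun z => ?_⟩
  rw [abs_mul]
  exact mul_le_mul (h1 z) (h2 z) (abs_nonneg _) ((abs_nonneg _).trans (h1 z))
@[fun_prop] lemma pow (hf : Bdd f) (k : ℕ) : Bdd (fun z => f z ^ k) := by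
  induction k with
  | zero => simpa using const 1
  | succ k ih => simpa [pow_succ] using ih.mul hf
@[fun_prop] lemma sum {ι : Type*} (s : Finset ι) {F : ι → Fu n} (h : ∀ i, Bdd (F i)) :
    Bdd (fun z => ∑ i ∈ s, F i z) := by
  classical
  induction s using Finset.induction_on with
  | empty => simpa using const 0
  | insert a s ha ih => simpa [Finset.sum_insert ha] using (h a).add ih
lemma shift (hf : Bdd f) (y : En n) : Bdd (fun z => f (z + y)) := by
  obtain ⟨m1, M, h1⟩ := hf
  exact ⟨m1.comp (measurable_id.add_const y), M, fun z => h1 _⟩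
end Bdd
namespace CT
lemma dd (h : CT u) (e : En n) : CT (dd e u) := by
  refine ⟨?_, ?_⟩
  · exact (h.1.fderiv_right (m := ∞) (by simp)).clm_apply contDiff_const
  · exact (h.2.fderiv ℝ).comp_left (g := fun L : En n →L[ℝ] ℝ => L e) (by simp)
lemma diff (h : CT u) : Differentiable ℝ u := h.1.differentiable (by simp)
lemma cont (h : CT u) : Continuous u := h.1.continuous
@[fun_prop] lemma bdd (h : CT u) : Bdd u :=
  ⟨h.cont.measurable, by
    obtain ⟨C, hC⟩ := h.2.exists_bound_of_continuous h.cont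
    exact ⟨C, fun z => by simpa using hC z⟩⟩
lemma add (h : CT u) (k : CT v) : CT (fun z => u z + v z) := ⟨h.1.add k.1, h.2.add k.2⟩
lemma mul (h : CT u) (k : CT v) : CT (fun z => u z * v z) := ⟨h.1.mul k.1, h.2.mul_right⟩
lemma const_mul (h : CT u) (c : ℝ) : CT (fun z => c * u z) := ⟨contDiff_const.mul h.1, h.2.mul_left⟩
lemma sub (h : CT u) (k : CT v) : CT (fun z => u z - v z) := by
  simpa [sub_eq_add_neg] using h.add (k.const_mul (-1))
lemma sq (h : CT u) : CT (fun z => u z ^ 2) := by simpa [pow_two] using h.mul h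
end CT
section calc1
lemma dd_mul (hu : CT u) (hv : CT v) (e : En n) :
    dd e (fun z => u z * v z) = fun z => dd e u z * v z + u z * dd e v z := by
  funext z
  simp only [dd]
  rw [fderiv_fun_mul (hu.diff z) (hv.diff z)]
  simp; ring
lemma dd_add (hu : CT u) (hv : CT v) (e : En n) :
    dd e (fun z => u z + v z) = fun z => dd e u z + dd e v z := by
  funext z
  simp only [dd]
  rw [fderiv_fun_add (hu.diff z) (hv.diff z)]; simp
lemma dd_sub (hu : CT u) (hv : CT v) (e : En n) :
    dd e (fun z => u z - v z) = fun z => dd e u z - dd e v z := by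
  funext z
  simp only [dd]
  rw [fderiv_fun_sub (hu.diff z) (hv.diff z)]; simp
lemma dd_sq (hu : CT u) (e : En n) :
    dd e (fun z => u z ^ 2) = fun z => 2 * u z * dd e u z := by
  simp only [pow_two, dd_mul hu hu]; funext z; ring
lemma dd_comm (hu : CT u) (e e' : En n) : dd e (dd e' u) = dd e' (dd e u) := by
  funext z
  have hd : DifferentiableAt ℝ (fderiv ℝ u) z :=
    ((hu.1.fderiv_right (m := ∞) (by simp)).differentiable (by simp)) z
  have key : ∀ a b : En n, dd a (dd b u) z = fderiv ℝ (fderiv ℝ u) z a b := by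
    intro a b
    have : dd a (dd b u) z = fderiv ℝ (fun y => fderiv ℝ u y b) z a := rfl
    rw [this, fderiv_clm_apply hd (differentiableAt_const b)]
    simp
  rw [key, key]
  exact (hu.1.contDiffAt.isSymmSndFDerivAt (by simp; exact WithTop.coe_le_coe.2 le_top)) e e'
def Hs (n : ℕ) (s : ℝ) : Set (En n) := {z | s < z.1}
lemma Hs_meas (s : ℝ) : MeasurableSet (Hs n s) := measurableSet_lt measurable_const measurable_fst
lemma Bdd.integ {ζ : Fu n} (hf : Bdd f) (hζ : CT ζ) (h : ∀ z, ζ z = 0 → f z = 0) :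
    Integrable f := by
  obtain ⟨m, M, hM⟩ := hf
  have hK : IsCompact (tsupport ζ) := hζ.2
  have : IntegrableOn f (tsupport ζ) :=
    integrableOn_of_bounded (M := M) hK.measure_lt_top.ne m.aestronglyMeasurable
      (evf fun z => by simpa using hM z)
  rw [← integrableOn_univ]
  refine this.of_forall_sdiff_eq_zero MeasurableSet.univ fun z hz => h z ?_
  exact image_eq_zero_of_notMem_tsupport hz.2
lemma hasDeriv_shift {α F : Fu n} (hα : Bdd α) (hF : CT F) (e : En n) (S : Set (En n)) :
    HasDerivAt (fun h : ℝ => ∫ z in S, α z * F (z + h • e)) (∫ z in S, α z * dd e F z) 0 := by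
  obtain ⟨mα, M, hM⟩ := hα
  have hFe := hF.dd e
  obtain ⟨_, N, hN⟩ := hFe.bdd
  let K : Set (En n) := (fun q : En n × ℝ => q.1 - q.2 • e) '' (tsupport F ×ˢ Set.Icc (-1) 1)
  have hK : IsCompact K := (IsCompact.prod hF.2 isCompact_Icc).image (by fun_prop)
  have hz : ∀ z, ∀ h ∈ ball (0:ℝ) 1, z ∉ K → z + h • e ∉ tsupport F := by
    intro z h hh hzK hc
    apply hzK
    refine ⟨(z + h • e, h), ⟨hc, ?_⟩, by simp⟩
    rw [mem_ball, dist_zero_right, norm_eq_abs, abs_lt] at hh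
    exact ⟨hh.1.le, hh.2.le⟩
  have hd : ∀ z (h : ℝ), HasDerivAt (fun h : ℝ => F (z + h • e)) (dd e F (z + h • e)) h := by
    intro z h
    have h1 : HasDerivAt (fun h : ℝ => z + h • e) e h := by
      simpa using ((hasDerivAt_id h).smul_const e).const_add z
    exact (hF.diff (z + h • e)).hasFDerivAt.comp_hasDerivAt h h1
  have hm : ∀ h : ℝ, Measurable (fun z => α z * F (z + h • e)) := fun h =>
    mα.mul (hF.cont.measurable.comp (measurable_id.add_const _))
  have := hasDerivAt_integral_of_dominated_loc_of_deriv_le (μ := volume.restrict S) (𝕜 := ℝ)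
    (F := fun h z => α z * F (z + h • e)) (F' := fun h z => α z * dd e F (z + h • e)) (x₀ := 0)
    (s := ball 0 1) (bound := K.indicator fun _ => |M| * |N|)
    (ball_mem_nhds _ one_pos)
    (evf fun h => (hm h).aestronglyMeasurable) ?_ ?_ ?_ ?_ ?_
  · simpa using this.2
  · have : Bdd (fun z => α z * F z) := Bdd.mul ⟨mα, M, hM⟩ hF.bdd
    simpa using (this.integ hF (fun z h => by simp [h])).restrict (s := S)
  · exact (mα.mul (hFe.cont.measurable.comp (measurable_id.add_const _))).aestronglyMeasurable
  · refine evf fun z h hh => ?_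
    by_cases hzK : z ∈ K
    · rw [indicator_of_mem hzK, norm_mul]
      exact mul_le_mul ((hM z).trans (le_abs_self _)) ((hN _).trans (le_abs_self _))
        (abs_nonneg _) (abs_nonneg _)
    · rw [indicator_of_notMem hzK]
      have : dd e F (z + h • e) = 0 := by
        have h0 := hz z h hh hzK
        have : z + h • e ∉ tsupport (fderiv ℝ F) := fun hc => h0 (tsupport_fderiv_subset ℝ hc)
        simp [dd, image_eq_zero_of_notMem_tsupport this]
      simp [this]
  · exact ((integrable_indicator_iff hK.measurableSet).2 (integrableOn_const hK.measure_lt_top.ne)).restrict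
  · exact evf fun z h _ => (hd z h).const_mul _
lemma shift_int (S : Set (En n)) (hS : MeasurableSet S) (f : Fu n) (y : En n) :
    ∫ z in S, f (z + y) = ∫ z in {z | z - y ∈ S}, f z := by
  have h2 : MeasurableSet {z : En n | z - y ∈ S} := (measurable_id.sub_const y) hS
  rw [← integral_indicator hS, ← integral_indicator h2]
  rw [← integral_add_right_eq_self (μ := (volume : Measure (En n))) ({z | z - y ∈ S}.indicator f) y]
  congr 1; funext z
  have e : z + y ∈ {z | z - y ∈ S} ↔ z ∈ S := by
    rw [mem_ofPred_eq, add_sub_cancel_right]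
  by_cases h : z ∈ S
  · rw [indicator_of_mem h, indicator_of_mem (e.2 h)]
  · rw [indicator_of_notMem h, indicator_of_notMem (fun h' => h (e.1 h'))]
lemma ibp_inv {α F : Fu n} (hα : Bdd α) (hF : CT F) (e : En n) (s : ℝ) (he : e.1 = 0)
    (hi : ∀ z (h : ℝ), α (z + h • e) = α z) : ∫ z in Hs n s, α z * dd e F z = 0 := by
  have h1 := hasDeriv_shift hα hF e (Hs n s)
  have h2 : (fun h : ℝ => ∫ z in Hs n s, α z * F (z + h • e)) = fun _ => ∫ z in Hs n s, α z * F z := by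
    funext h
    have := shift_int (Hs n s) (Hs_meas s) (fun z => α z * F z) (h • e)
    simp only [hi] at this
    rw [this]; congr 2; ext z; simp [Hs, he]
  rw [h2] at h1
  exact h1.unique (hasDerivAt_const _ _)
lemma ibp_t {α F : Fu n} (hα : Bdd α) (hF : CT F) (s : ℝ) (hα0 : ∀ z, 0 ≤ α z)
    (hF0 : ∀ z, 0 ≤ F z) (hi : ∀ z (h : ℝ), α (z + h • et) = α z) :
    ∫ z in Hs n s, α z * dd et F z ≤ 0 := by
  have h1 := hasDeriv_shift hα hF et (Hs n s)
  have h2 : Antitone (fun h : ℝ => ∫ z in Hs n s, α z * F (z + h • et)) := by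
    intro h k hk
    have e1 : ∀ h : ℝ, (∫ z in Hs n s, α z * F (z + h • et)) = ∫ z in Hs n (s + h), α z * F z := by
      intro h
      have := shift_int (Hs n s) (Hs_meas s) (fun z => α z * F z) (h • et)
      simp only [hi] at this
      rw [this]; congr 2; ext z; simp [Hs, et, lt_sub_iff_add_lt]
    simp only [e1]
    refine setIntegral_mono_set ?_ (evf fun z => mul_nonneg (hα0 z) (hF0 z))
      (LE.le.eventuallyLE fun z hz => ?_)
    · exact ((hα.mul hF.bdd).integ hF (fun z h => by simp [h])).integrableOn
    · simp only [Hs, mem_ofPred_eq] at *; linarith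
  rw [← h1.deriv]
  exact h2.deriv_nonpos
end calc1
structure Co {n : ℕ} (ν : ℝ) (β : Fu n) (A : Fa n) : Prop where
  ν0 : 0 < ν
  mβ : Measurable β
  mA : ∀ j k, Measurable (A j k)
  iβ : ∀ z y : En n, y.2 0 = 0 → β (z + y) = β z
  iA : ∀ j k (z y : En n), y.2 0 = 0 → A j k (z + y) = A j k z
  βl : ∀ z, ν ≤ β z
  βu : ∀ z, β z ≤ ν⁻¹
  A00 : ∀ z, A 0 0 z = 1
  A0k : ∀ k z, k ≠ 0 → A 0 k z = 0
  ell : ∀ z (θ : Ix n → ℝ), ν * ∑ j, θ j ^ 2 ≤ ∑ j, ∑ k, A j k z * (θ j * θ k)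
  Au : ∀ j k z, |A j k z| ≤ ν⁻¹
noncomputable def Lt (β : Fu n) (A : Fa n) (w : Fu n) :
    En n → ℝ :=
  fun z => β z * dd et w z + ∑ j, ∑ k, A j k z * dx j (dx k w) z
section cacc
lemma Co.bβ (h : Co ν β A) : Bdd β :=
  ⟨h.mβ, ν⁻¹, fun z => by rw [abs_of_nonneg (h.ν0.le.trans (h.βl z))]; exact h.βu z⟩
lemma Co.bA (h : Co ν β A) (j k) : Bdd (A j k) := ⟨h.mA j k, ν⁻¹, h.Au j k⟩
lemma Co.βpos (h : Co ν β A) (z) : 0 < β z := h.ν0.trans_le (h.βl z)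
lemma CT.d2 (h : CT u) (e e' : En n) : Bdd (_root_.dd e (_root_.dd e' u)) := ((h.dd e').dd e).bdd
lemma Bdd.integ' (hf : Bdd f) {S : Set (En n)} (hS : volume S ≠ ⊤)
    (h : ∀ z ∉ S, f z = 0) : Integrable f := by
  obtain ⟨m, M, hM⟩ := hf
  have : IntegrableOn f S :=
    integrableOn_of_bounded (M := M) hS m.aestronglyMeasurable
      (evf fun z => by simpa using hM z)
  rw [← integrableOn_univ]
  exact this.of_forall_sdiff_eq_zero MeasurableSet.univ fun z hz => h z hz.2
lemma Bdd.integOn (hf : Bdd f) {S : Set (En n)} (hS : volume S ≠ ⊤) :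
    IntegrableOn f S := by
  obtain ⟨m, M, hM⟩ := hf
  exact integrableOn_of_bounded (M := M) hS m.aestronglyMeasurable
      (evf fun z => by simpa using hM z)
lemma ball_fin (R : ℝ) : volume (ball (0 : En n) R) ≠ ⊤ := measure_ball_lt_top.ne
lemma Hball_fin (s R : ℝ) : volume (Hs n s ∩ ball (0 : En n) R) ≠ ⊤ :=
  measure_ne_top_of_subset inter_subset_right (ball_fin R)
lemma cutoff (n : ℕ) (r R : ℝ) (hr : 0 < r) (hR : r < R) : ∃ (ζ : Fu n) (M : ℝ), CT ζ ∧ 0 ≤ M ∧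
    (∀ z, 0 ≤ ζ z ∧ ζ z ≤ 1) ∧ (∀ z ∈ ball 0 r, ζ z = 1) ∧
    (∀ z ∉ ball 0 R, ζ z = 0 ∧ ∀ e, dd e ζ z = 0) ∧ (∀ z, |dd et ζ z| ≤ M) ∧
    ∀ j z, |dx j ζ z| ≤ M := by
  let f : ContDiffBump (0 : En n) := ⟨r, (r + R) / 2, hr, by linarith⟩
  have hf : CT (f : Fu n) := ⟨f.contDiff, f.hasCompactSupport⟩
  have hts : ∀ z ∉ ball (0 : En n) R, z ∉ tsupport (f : Fu n) := by
    intro z hz hc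
    rw [f.tsupport_eq] at hc
    apply hz
    simp only [Metric.mem_closedBall, mem_ball] at *
    have : f.rOut = (r + R) / 2 := rfl
    linarith
  have hb : ∀ e : En n, ∃ M, ∀ z, |dd e f z| ≤ M := fun e => (hf.dd e).bdd.2
  choose M hM using hb
  refine ⟨f, |M et| + ∑ j, |M (ex j)|, hf, by positivity, fun z => ⟨f.nonneg, f.le_one⟩, ?_, ?_, ?_, ?_⟩
  · intro z hz; exact f.one_of_mem_closedBall (Metric.ball_subset_closedBall hz)
  · intro z hz
    refine ⟨image_eq_zero_of_notMem_tsupport (hts z hz), fun e => ?_⟩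
    have : z ∉ tsupport (fderiv ℝ f) := fun hc => hts z hz (tsupport_fderiv_subset ℝ hc)
    simp [dd, image_eq_zero_of_notMem_tsupport this]
  · intro z
    exact ((hM et z).trans (le_abs_self _)).trans (le_add_of_nonneg_right (by positivity))
  · intro j z
    refine ((hM (ex j) z).trans (le_abs_self _)).trans (le_trans ?_ (le_add_of_nonneg_left (by positivity)))
    exact single_le_sum (f := fun j => |M (ex j)|) (fun _ _ => abs_nonneg _) (mem_univ j)
lemma int_le_loc {f1 : Fu n} (hf : Bdd f) (hf1 : Bdd f1) (hg : Bdd g)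
    (h1 : ∫ z in Hs n s, f1 z ≤ 0) (hz : ∀ z ∉ ball (0 : En n) R, f z = 0 ∧ f1 z = 0)
    (h : ∀ z ∈ ball (0 : En n) R, f z - f1 z ≤ g z) :
    ∫ z in Hs n s, f z ≤ ∫ z in Hs n s ∩ ball 0 R, g z := by
  have i1 := (hf.integ' (ball_fin R) fun z h => (hz z h).1).restrict (s := Hs n s)
  have i2 := (hf1.integ' (ball_fin R) fun z h => (hz z h).2).restrict (s := Hs n s)
  have e : ∫ z in Hs n s, (f z - f1 z) = ∫ z in Hs n s ∩ ball 0 R, (f z - f1 z) := by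
    refine setIntegral_eq_of_subset_of_forall_sdiff_eq_zero (Hs_meas s) inter_subset_left ?_
    intro z hz'
    have : z ∉ ball (0 : En n) R := fun h => hz'.2 ⟨hz'.1, h⟩
    simp [hz z this]
  have h2 : ∫ z in Hs n s, (f z - f1 z) ≤ ∫ z in Hs n s ∩ ball 0 R, g z := by
    rw [e]
    refine setIntegral_mono_on ((hf.sub hf1).integOn (Hball_fin s R)) (hg.integOn (Hball_fin s R))
      ((Hs_meas s).inter measurableSet_ball) fun z hz => h z hz.2
  rw [integral_sub i1 i2] at h2
  linarith
lemma loc_le_int {ζ : Fu n} (hζ : Bdd ζ) (hg : Bdd g)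
    (h0 : ∀ z, 0 ≤ g z) (h1 : ∀ z ∈ ball (0 : En n) r, ζ z = 1)
    (h2 : ∀ z ∉ ball (0 : En n) R, ζ z = 0) :
    ∫ z in Hs n s ∩ ball 0 r, g z ≤ ∫ z in Hs n s, ζ z ^ 2 * g z := by
  have i1 := (((hζ.pow 2).mul hg).integ' (ball_fin R) fun z h => by simp [h2 z h]).integrableOn
    (s := Hs n s)
  calc ∫ z in Hs n s ∩ ball 0 r, g z = ∫ z in Hs n s ∩ ball 0 r, ζ z ^ 2 * g z :=
        setIntegral_congr_fun ((Hs_meas s).inter measurableSet_ball) fun z hz => by simp [h1 z hz.2]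
    _ ≤ _ := setIntegral_mono_set i1 (evf fun z => by have := h0 z; positivity)
        (LE.le.eventuallyLE inter_subset_left)
lemma ibp_A (hc : Co ν β A) {G : Fu n} (hG : CT G) (hw : CT w) (s : ℝ) :
    ∫ z in Hs n s, ∑ j, ∑ k, A j k z * (dx j G z * dx k w z + G z * dx j (dx k w) z) = 0 := by
  have key : ∀ j k, IntegrableOn (fun z => A j k z * (dx j G z * dx k w z + G z * dx j (dx k w) z)) (Hs n s) ∧
      ∫ z in Hs n s, A j k z * (dx j G z * dx k w z + G z * dx j (dx k w) z) = 0 := by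
    intro j k
    have e := dd_mul hG (hw.dd (ex k)) (ex j)
    have hF := hG.mul (hw.dd (ex k))
    have e' : (fun z => A j k z * (dx j G z * dx k w z + G z * dx j (dx k w) z))
        = fun z => A j k z * dx j (fun z => G z * dx k w z) z := by rw [e]
    rw [e']
    refine ⟨(((hc.bA j k).mul (hF.dd (ex j)).bdd).integ (hF.dd (ex j)) fun z h => by simp [h]).integrableOn, ?_⟩
    refine ibp_inv (hc.bA j k) hF (ex j) s rfl fun z h => ?_
    by_cases hj : j = 0
    · subst hj
      by_cases hk : k = 0
      · subst hk; simp [hc.A00]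
      · simp [hc.A0k k _ hk]
    · exact hc.iA j k _ _ (by simp [ex, Pi.single_apply, Ne.symm hj])
  rw [integral_finsetSum]
  · refine sum_eq_zero fun j _ => ?_
    rw [integral_finsetSum _ fun k _ => (key j k).1]
    exact sum_eq_zero fun k _ => (key j k).2
  · exact fun j _ => integrable_finsetSum _ fun k _ => (key j k).1
lemma Lt_bdd (hc : Co ν β A) (hw : CT w) : Bdd (Lt β A w) := by
  have := hc.bβ
  have := hc.bA
  have := (hw.dd et).bdd
  have := fun j k => hw.d2 (ex j) (ex k)
  unfold Lt
  fun_prop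
lemma Lt_eq0 (z) (hz : z ∉ tsupport w) : Lt β A w z = 0 := by
  have h : ∀ u : Fu n, z ∉ tsupport u → ∀ e, z ∉ tsupport (dd e u) := by
    intro u hu e hc
    refine hu (tsupport_fderiv_subset ℝ (closure_mono ?_ hc))
    intro y hy hc
    exact hy (by simp [dd, hc])
  have h0 := fun e => image_eq_zero_of_notMem_tsupport (h w hz e)
  have h1 := fun e e' => image_eq_zero_of_notMem_tsupport (h _ (h w hz e) e')
  simp [Lt, h0, h1]
lemma ibp_L (hc : Co ν β A) {G : Fu n} (hG : CT G) (hw : CT w) (s : ℝ) (e : En n)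
    (he : e.1 = 0) (he' : e.2 0 = 0) :
    ∫ z in Hs n s, (G z * Lt β A (dd e w) z + dd e G z * Lt β A w z) = 0 := by
  have hi : ∀ h : ℝ, (h • e).2 0 = 0 := fun h => by simp [he']
  have k1 : ∀ (α v : Fu n), Bdd α → CT v → (∀ z (h : ℝ), α (z + h • e) = α z) →
      IntegrableOn (fun z => α z * (G z * dd e v z + dd e G z * v z)) (Hs n s) ∧
      ∫ z in Hs n s, α z * (G z * dd e v z + dd e G z * v z) = 0 := by
    intro α v hα hv hi
    have hF := hG.mul hv
    have e' : (fun z => α z * (G z * dd e v z + dd e G z * v z)) =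
        fun z => α z * dd e (fun z => G z * v z) z := by
      rw [dd_mul hG hv]; funext z; ring
    rw [e']
    exact ⟨((hα.mul (hF.dd e).bdd).integ (hF.dd e) fun z h => by simp [h]).integrableOn,
      ibp_inv hα hF e s he hi⟩
  have a1 := k1 β (dd et w) hc.bβ (hw.dd et) fun z h => hc.iβ z _ (hi h)
  have a2 := fun j k => k1 (A j k) (dx j (dx k w)) (hc.bA j k) ((hw.dd _).dd _)
    fun z h => hc.iA j k z _ (hi h)
  have e2 : (fun z => G z * Lt β A (dd e w) z + dd e G z * Lt β A w z) = fun z =>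
      β z * (G z * dd e (dd et w) z + dd e G z * dd et w z) + ∑ j, ∑ k, A j k z *
        (G z * dd e (dx j (dx k w)) z + dd e G z * dx j (dx k w) z) := by
    funext z
    simp only [Lt, mul_add, sum_add_distrib, mul_sum]
    rw [dd_comm hw et e]
    simp only [fun k => dd_comm hw (ex k) e, fun j k => dd_comm (hw.dd (ex k)) (ex j) e]
    have : ∀ a b c d a' b' c' d': ℝ, a = a' → b = b' → c = c' → d = d' → a + b + (c + d) = a' + c' + (b' + d') := by
      intros; subst_vars; ring
    apply this
    · ring
    · exact sum_congr rfl fun j _ => sum_congr rfl fun k _ => by ring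
    · ring
    · exact sum_congr rfl fun j _ => sum_congr rfl fun k _ => by ring
  rw [e2, integral_add a1.1, a1.2, integral_finsetSum]
  · rw [zero_add]
    refine sum_eq_zero fun j _ => ?_
    rw [integral_finsetSum _ fun k _ => (a2 j k).1]
    exact sum_eq_zero fun k _ => (a2 j k).2
  · exact fun j _ => integrable_finsetSum _ fun k _ => (a2 j k).1
  · exact integrable_finsetSum _ fun j _ => integrable_finsetSum _ fun k _ => (a2 j k).1
end cacc
section cacc2
noncomputable def D1 (w : Fu n) : En n → ℝ := fun z => ∑ j, dx j w z ^ 2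
lemma D1_nonneg (w : Fu n) (z) : 0 ≤ D1 w z := sum_nonneg fun _ _ => sq_nonneg _
lemma D1_bdd (hw : CT w) : Bdd (D1 w) := by
  have := fun j => (hw.dd (ex j)).bdd
  unfold D1; fun_prop
lemma young (a b η : ℝ) (h : 0 < η) : a * b ≤ η * a ^ 2 + η⁻¹ * b ^ 2 := by
  have h1 : 0 ≤ η⁻¹ * (η * a - b) ^ 2 := by positivity
  have h2 : η⁻¹ * (η * a - b) ^ 2 = η * a ^ 2 - 2 * (a * b) + η⁻¹ * b ^ 2 := by
    field_simp; ring
  have h3 : 0 ≤ η * a ^ 2 + η⁻¹ * b ^ 2 := by positivity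
  linarith
lemma cross (a : Ix n → Ix n → ℝ) (p q : Ix n → ℝ) (η M B t : ℝ) (hη : 0 < η)
    (ha : ∀ j k, |a j k| ≤ B) (hp : ∀ j, |p j| ≤ M) :
    |∑ j, ∑ k, a j k * (p j * t * q k)| ≤ η * ∑ k, q k ^ 2 + (n + 1) ^ 3 * (B * M) ^ 2 * η⁻¹ * t ^ 2 := by
  have hn : (0:ℝ) < n + 1 := by positivity
  have hB : 0 ≤ B := (abs_nonneg _).trans (ha 0 0)
  have hM : 0 ≤ M := (abs_nonneg _).trans (hp 0)
  have h1 : ∀ j k, |a j k * (p j * t * q k)| ≤ η / (n+1) * q k ^ 2 + (η / (n+1))⁻¹ * (B * M * |t|) ^ 2 := by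
    intro j k
    have := young (|q k|) (|a j k| * |p j| * |t|) (η / (n+1)) (by positivity)
    rw [abs_mul, abs_mul, abs_mul]
    rw [sq_abs] at this
    calc _ = |q k| * (|a j k| * |p j| * |t|) := by ring
      _ ≤ _ := this
      _ ≤ _ := by
        gcongr
        · exact ha j k
        · exact hp j
  calc _ ≤ ∑ j, |∑ k, a j k * (p j * t * q k)| := Finset.abs_sum_le_sum_abs _ _
    _ ≤ ∑ j, ∑ k, |a j k * (p j * t * q k)| := sum_le_sum fun j _ => Finset.abs_sum_le_sum_abs _ _
    _ ≤ ∑ j : Ix n, ∑ k, (η / (n+1) * q k ^ 2 + (η / (n+1))⁻¹ * (B * M * |t|) ^ 2) :=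
        sum_le_sum fun j _ => sum_le_sum fun k _ => h1 j k
    _ = _ := by
      simp only [sum_add_distrib, ← mul_sum, Finset.sum_const, Finset.card_univ,
        Fintype.card_fin, nsmul_eq_mul, mul_pow, sq_abs]
      push_cast
      field_simp
lemma energy (n : ℕ) (ν M : ℝ) (hM : 0 ≤ M) (hν : 0 < ν) :
    ∃ C, 0 ≤ C ∧ ∀ (β : Fu n) (A : Fa n),
    Co ν β A → ∀ (R s : ℝ) (w ζ g : Fu n), CT w → CT ζ → Bdd g → (∀ z, 0 ≤ ζ z ∧ ζ z ≤ 1) →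
    (∀ z ∉ ball 0 R, ζ z = 0 ∧ ∀ e, dd e ζ z = 0) → (∀ z, |dd et ζ z| ≤ M) →
    (∀ j z, |dx j ζ z| ≤ M) →
    ∀ f1 : Fu n, Bdd f1 → (∫ z in Hs n s, f1 z ≤ 0) → (∀ z ∉ ball 0 R, f1 z = 0) →
    (∀ z ∈ ball 0 R, - (ζ z ^ 2 * w z * Lt β A w z) - f1 z ≤ ν / 4 * (ζ z ^ 2 * D1 w z) + g z) →
    ∫ z in Hs n s, ν / 4 * (ζ z ^ 2 * D1 w z) ≤ ∫ z in Hs n s ∩ ball 0 R, (g z + C * w z ^ 2) := by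
  refine ⟨ν⁻¹ * M + (n + 1) ^ 3 * (2 * ν⁻¹ * M) ^ 2 * (ν / 2)⁻¹ , by positivity, ?_⟩
  intro β A hc R s w ζ g hw hζ hg h01 hz hMt hMx f1 bf1 i1 z1 hp
  have hF := (hζ.mul hw).sq
  have hG := hζ.sq.mul hw
  have eF : dd et (fun z => (ζ z * w z) ^ 2) =
      fun z => 2 * (ζ z * w z) * (dd et ζ z * w z + ζ z * dd et w z) := by
    rw [dd_sq (hζ.mul hw), dd_mul hζ hw]
  have eG : ∀ j, dx j (fun z => ζ z ^ 2 * w z) =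
      fun z => 2 * ζ z * dx j ζ z * w z + ζ z ^ 2 * dx j w z := by
    intro j; rw [dd_mul hζ.sq hw, dd_sq hζ]
  have b1 := hw.bdd
  have b2 := hζ.bdd
  have b3 := (hw.dd et).bdd
  have b4 := fun j => (hw.dd (ex j)).bdd
  have b5 := (hζ.dd et).bdd
  have b6 := fun j => (hζ.dd (ex j)).bdd
  have b7 := hc.bβ
  have b8 := hc.bA
  have b9 := fun j k => hw.d2 (ex j) (ex k)
  have b10 := D1_bdd hw
  have I1 := ibp_t hc.bβ hF s (fun z => (hc.βpos z).le) (fun z => sq_nonneg _)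
    (fun z h => hc.iβ z _ (by simp [et]))
  have I2 := ibp_A hc hG hw s
  rw [eF] at I1
  simp only [eG] at I2
  set T : En n → ℝ := fun z => β z * (2 * (ζ z * w z) * (dd et ζ z * w z + ζ z * dd et w z)) with hT
  set U : En n → ℝ := fun z => ∑ j, ∑ k, A j k z * ((2 * ζ z * dx j ζ z * w z + ζ z ^ 2 * dx j w z) * dx k w z +
      ζ z ^ 2 * w z * dx j (dx k w) z) with hU
  have bT : Bdd T := by fun_prop
  have bU : Bdd U := by fun_prop
  have zT : ∀ z ∉ ball (0:En n) R, T z = 0 := fun z h => by simp [hT, hz z h]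
  have zU : ∀ z ∉ ball (0:En n) R, U z = 0 := fun z h => by simp [hU, hz z h]
  refine int_le_loc (f1 := fun z => f1 z + (1 / 2 * T z + U z)) (by fun_prop) (by fun_prop)
    (by fun_prop) ?_ ?_ ?_
  · have j1 := (bf1.integ' (ball_fin R) z1).restrict (s := Hs n s)
    have j2 := (bT.integ' (ball_fin R) zT).restrict (s := Hs n s)
    have j3 := (bU.integ' (ball_fin R) zU).restrict (s := Hs n s)
    have j4 := j2.const_mul (1/2)
    have j5 : Integrable (fun z => 1 / 2 * T z + U z) (volume.restrict (Hs n s)) := j4.add j3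
    rw [integral_add j1 j5, integral_add j4 j3, integral_const_mul, I2]
    linarith
  · intro z h
    simp [hz z h, zT z h, zU z h, z1 z h]
  · intro z hzR
    have h1 := hp z hzR
    have h2 := cross (fun j k => 2 * A j k z) (fun j => dx j ζ z) (fun k => ζ z * dx k w z) (ν/2) M
      (2 * ν⁻¹) (w z) (by positivity) (fun j k => by rw [abs_mul, abs_two]; linarith [hc.Au j k z]) (fun j => hMx j z)
    have h3 := hc.ell z (fun j => dx j w z)
    have h4 : -(β z * ζ z * dd et ζ z * w z ^ 2) ≤ ν⁻¹ * M * w z ^ 2 := by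
      have : |β z * ζ z * dd et ζ z| ≤ ν⁻¹ * 1 * M := by
        rw [abs_mul, abs_mul, abs_of_pos (hc.βpos z), abs_of_nonneg (h01 z).1]
        have := hc.βu z
        have := (h01 z).2
        have := (h01 z).1
        gcongr
        exact hMt z
      have h5 := neg_abs_le (β z * ζ z * dd et ζ z)
      have : -(β z * ζ z * dd et ζ z) ≤ ν⁻¹ * M := by linarith
      nlinarith [mlr this (sq_nonneg (w z))]
    have h5 : U z = ∑ j, ∑ k, 2 * A j k z * (dx j ζ z * w z * (ζ z * dx k w z)) +
        ζ z ^ 2 * (∑ j, ∑ k, A j k z * (dx j w z * dx k w z)) +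
        ζ z ^ 2 * w z * ∑ j, ∑ k, A j k z * dx j (dx k w) z := by
      simp only [hU, mul_sum, ← sum_add_distrib]
      exact sum_congr rfl fun j _ => sum_congr rfl fun k _ => by ring
    have h6 : ∑ k, (ζ z * dx k w z) ^ 2 = ζ z ^ 2 * D1 w z := by
      simp only [D1, mul_sum, mul_pow]
    have h7 := (abs_le.1 h2).1
    simp only [h6] at h7
    have h8 : ζ z ^ 2 * (ν * D1 w z) ≤ ζ z ^ 2 * (∑ j, ∑ k, A j k z * (dx j w z * dx k w z)) :=
      mll h3 (sq_nonneg _)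
    have h9 : ζ z ^ 2 * w z * Lt β A w z = ζ z ^ 2 * w z * (β z * dd et w z) +
      ζ z ^ 2 * w z * ∑ j, ∑ k, A j k z * dx j (dx k w) z := by simp only [Lt]; ring
    rw [h5]
    simp only [hT]
    linarith
lemma cacc1 (n : ℕ) (ν r R : ℝ) (hν : 0 < ν) (hr : 0 < r) (hR : r < R) : ∃ C, 0 ≤ C ∧
    ∀ (β : Fu n) (A : Fa n), Co ν β A → ∀ (s : ℝ) (w : Fu n), CT w →
    ∫ z in Hs n s ∩ ball 0 r, D1 w z ≤
      C * ∫ z in Hs n s ∩ ball 0 R, (Lt β A w z ^ 2 + w z ^ 2) := by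
  obtain ⟨ζ, M, hζ, hM, h01, h1, hz, hMt, hMx⟩ := cutoff n r R hr hR
  obtain ⟨C, hC, H⟩ := energy n ν M hM hν
  refine ⟨(ν / 4)⁻¹ * (1 + C), by positivity, fun β A hc s w hw => ?_⟩
  have bL := Lt_bdd hc hw
  have bw := hw.bdd
  have bD := D1_bdd hw
  have h := H β A hc R s w ζ (fun z => Lt β A w z ^ 2 + w z ^ 2) hw hζ (by fun_prop) h01 hz hMt hMx
    (fun _ => 0) (by fun_prop) (by simp) (by simp) (fun z _ => ?_)
  · rw [integral_const_mul] at h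
    have h2 := loc_le_int (s := s) hζ.bdd bD (D1_nonneg w) h1 fun z h => (hz z h).1
    have h3 : ∫ z in Hs n s ∩ ball 0 R, (Lt β A w z ^ 2 + w z ^ 2 + C * w z ^ 2) ≤
       ∫ z in Hs n s ∩ ball 0 R, (1 + C) * (Lt β A w z ^ 2 + w z ^ 2) := by
      refine integral_mono (Bdd.integOn (by fun_prop) (Hball_fin s R)) (Bdd.integOn (by fun_prop) (Hball_fin s R)) fun z => ?_
      have := mul_nonneg hC (sq_nonneg (Lt β A w z))
      dsimp only
      linarith
    rw [integral_const_mul] at h3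
    rw [mul_assoc, ← div_eq_inv_mul, le_div_iff₀' (by positivity)]
    calc _ ≤ _ := mll h2 (by positivity)
      _ ≤ _ := h.trans h3
  · have a1 : ζ z ^ 2 ≤ 1 := by have := h01 z; nlinarith
    have a2 := D1_nonneg w z
    have a3 : 0 ≤ ν / 4 * (ζ z ^ 2 * D1 w z) := by positivity
    have a4 : -(w z * Lt β A w z) ≤ (Lt β A w z ^ 2 + w z ^ 2) := by nlinarith [sq_nonneg (w z + Lt β A w z), sq_nonneg (w z), sq_nonneg (Lt β A w z)]
    have a5 : ζ z ^ 2 * -(w z * Lt β A w z) ≤ 1 * (Lt β A w z ^ 2 + w z ^ 2) := by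
      refine (mll a4 (sq_nonneg _)).trans ?_
      gcongr
    linarith
end cacc2
section cacc3
noncomputable def D2' (w : Fu n) : En n → ℝ := fun z => ∑ l : Fin n, D1 (dx l.succ w) z
noncomputable def D2 (w : Fu n) : En n → ℝ := fun z => ∑ j, ∑ k, dx j (dx k w) z ^ 2
lemma D2'_nonneg (w : Fu n) (z) : 0 ≤ D2' w z := sum_nonneg fun _ _ => D1_nonneg _ _
lemma D2_nonneg (w : Fu n) (z) : 0 ≤ D2 w z :=
  sum_nonneg fun _ _ => sum_nonneg fun _ _ => sq_nonneg _
lemma D2'_bdd (hw : CT w) : Bdd (D2' w) := by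
  have := fun l : Fin n => D1_bdd (hw.dd (ex l.succ))
  unfold D2'; fun_prop
lemma D2_bdd (hw : CT w) : Bdd (D2 w) := by
  have := fun j k => (hw.d2 (ex j) (ex k))
  unfold D2; fun_prop
lemma sq_sum2 {ι κ : Type*} [Fintype ι] [Fintype κ] (a x : ι → κ → ℝ) (B : ℝ) (ha : ∀ j k, |a j k| ≤ B) :
    (∑ j, ∑ k, a j k * x j k) ^ 2 ≤ Fintype.card ι * Fintype.card κ * B ^ 2 * ∑ j, ∑ k, x j k ^ 2 := by
  calc _ ≤ Fintype.card ι * ∑ j, (∑ k, a j k * x j k) ^ 2 := sq_sum_le_card_mul_sum_sq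
    _ ≤ Fintype.card ι * ∑ j, (Fintype.card κ * ∑ k, (a j k * x j k) ^ 2) := by
      gcongr with j; exact sq_sum_le_card_mul_sum_sq
    _ ≤ Fintype.card ι * ∑ j, (Fintype.card κ * ∑ k, (B ^ 2 * x j k ^ 2)) := by
      gcongr with j _ k
      rw [mul_pow]
      exact mlr (sq_le_sq' (abs_le.1 (ha j k)).1 (abs_le.1 (ha j k)).2) (sq_nonneg _)
    _ = _ := by simp only [← mul_sum]; ring
lemma Lt_split (hc : Co ν β A) (hw : CT w) (z) :
    (Lt β A w z - β z * dd et w z - dx 0 (dx 0 w) z) ^ 2 ≤ n * (n + 1) * ν⁻¹ ^ 2 * D2' w z := by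
  have e : Lt β A w z - β z * dd et w z - dx 0 (dx 0 w) z =
      ∑ l : Fin n, ∑ k, A l.succ k z * dx k (dx l.succ w) z := by
    simp only [Lt, Fin.sum_univ_succ (f := fun j => ∑ k, A j k z * dx j (dx k w) z)]
    have : ∑ k, A 0 k z * dx 0 (dx k w) z = dx 0 (dx 0 w) z := by
      rw [Finset.sum_eq_single 0]
      · rw [hc.A00, one_mul]
      · intro k _ hk; rw [hc.A0k k z hk, zero_mul]
      · simp
    rw [this]
    simp only [fun l k => dd_comm hw (ex k) (ex l)]
    ring
  rw [e]
  refine (sq_sum2 (fun (l : Fin n) k => A l.succ k z) (fun (l : Fin n) k => dx k (dx l.succ w) z) ν⁻¹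
    fun l k => hc.Au _ _ _).trans_eq ?_
  simp [D2', D1]
lemma D2_le (hw : CT w) (z) :
    D2 w z ≤ dx 0 (dx 0 w) z ^ 2 + 2 * D2' w z := by
  simp only [D2, D2', D1]
  rw [Fin.sum_univ_succ]
  rw [Fin.sum_univ_succ (f := fun k => dx 0 (dx k w) z ^ 2)]
  have h1 : ∑ l : Fin n, ∑ k, dx l.succ (dx k w) z ^ 2 =
     ∑ l : Fin n, ∑ k, dx k (dx l.succ w) z ^ 2 := by
    simp only [fun l k => dd_comm hw (ex k) (ex l)]
  have h2 : ∑ l : Fin n, dx 0 (dx l.succ w) z ^ 2 ≤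
     ∑ l : Fin n, ∑ k, dx k (dx l.succ w) z ^ 2 :=
    sum_le_sum fun l _ => single_le_sum
      (f := fun k => dx k (dx l.succ w) z ^ 2) (fun _ _ => sq_nonneg _) (mem_univ 0)
  rw [h1]; linarith
lemma D2_le' (hc : Co ν β A) (hw : CT w) (z) :
    D2 w z ≤ 3 * Lt β A w z ^ 2 + 3 * ν⁻¹ ^ 2 * dd et w z ^ 2 + (3 * (n * (n+1) * ν⁻¹ ^ 2) + 2) * D2' w z := by
  have h1 := D2_le hw z
  have h2 := Lt_split hc hw z
  have h3 : (β z * dd et w z) ^ 2 ≤ ν⁻¹ ^ 2 * dd et w z ^ 2 := by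
    rw [mul_pow]
    have := hc.βu z
    have := (hc.βpos z).le
    gcongr
  nlinarith [sq_nonneg (Lt β A w z - β z * dd et w z - dx 0 (dx 0 w) z + β z * dd et w z),
    sq_nonneg (2 * Lt β A w z - (Lt β A w z - dx 0 (dx 0 w) z)  ),
    sq_nonneg (Lt β A w z + β z * dd et w z),
    sq_nonneg (β z * dd et w z - (Lt β A w z - β z * dd et w z - dx 0 (dx 0 w) z)),
    sq_nonneg (Lt β A w z + (Lt β A w z - β z * dd et w z - dx 0 (dx 0 w) z))]
lemma sq_le_D1 (w : Fu n) (j) (z) : dx j w z ^ 2 ≤ D1 w z :=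
  single_le_sum (f := fun j => dx j w z ^ 2) (fun _ _ => sq_nonneg _) (mem_univ j)
lemma cacc2a (n : ℕ) (ν r R : ℝ) (hν : 0 < ν) (hr : 0 < r) (hR : r < R) : ∃ C, 0 ≤ C ∧
    ∀ (β : Fu n) (A : Fa n), Co ν β A → ∀ (s : ℝ) (w : Fu n), CT w →
    ∀ l : Fin n, ∫ z in Hs n s ∩ ball 0 r, D1 (dx l.succ w) z ≤
      C * ∫ z in Hs n s ∩ ball 0 R, (Lt β A w z ^ 2 + D1 w z) := by
  obtain ⟨ζ, M, hζ, hM, h01, h1, hz, hMt, hMx⟩ := cutoff n r R hr hR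
  obtain ⟨C, hC, H⟩ := energy n ν M hM hν
  refine ⟨(ν / 4)⁻¹ * (1 + (ν / 4)⁻¹ + M ^ 2 + C), by positivity, fun β A hc s w hw l => ?_⟩
  set v := dx l.succ w with hv'
  have hv : CT v := hw.dd _
  have bL := Lt_bdd hc hw
  have bLv := Lt_bdd hc hv
  have bw := hw.bdd
  have bv := hv.bdd
  have bζ := hζ.bdd
  have bvl := (hv.dd (ex l.succ)).bdd
  have bζl := (hζ.dd (ex l.succ)).bdd
  have bD := D1_bdd hv
  have bD' := D1_bdd hw
  have hG := hζ.sq.mul hv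
  have eG : dx l.succ (fun z => ζ z ^ 2 * v z) =
      fun z => 2 * ζ z * dx l.succ ζ z * v z + ζ z ^ 2 * dx l.succ v z := by
    rw [dd_mul hζ.sq hv, dd_sq hζ]
  have I := ibp_L hc hG hw s (ex l.succ) rfl (by simp [ex])
  rw [eG] at I
  have h := H β A hc R s v ζ (fun z => (1 + (ν / 4)⁻¹) * Lt β A w z ^ 2 + M ^ 2 * v z ^ 2) hv hζ (by fun_prop) h01 hz hMt hMx
    (fun z => -(ζ z ^ 2 * v z * Lt β A v z + (2 * ζ z * dx l.succ ζ z * v z + ζ z ^ 2 * dx l.succ v z) * Lt β A w z))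
     (by fun_prop) (by rw [integral_neg, I, neg_zero]) (fun z h => by simp [hz z h]) (fun z _ => ?_)
  · rw [integral_const_mul] at h
    have h2 := loc_le_int (s := s) hζ.bdd bD (D1_nonneg v) h1 fun z h => (hz z h).1
    have h3 : ∫ z in Hs n s ∩ ball 0 R, ((1 + (ν / 4)⁻¹) * Lt β A w z ^ 2 + M ^ 2 * v z ^ 2 + C * v z ^ 2) ≤
       ∫ z in Hs n s ∩ ball 0 R, (1 + (ν / 4)⁻¹ + M ^ 2 + C) * (Lt β A w z ^ 2 + D1 w z) := by
      refine integral_mono (Bdd.integOn (by fun_prop) (Hball_fin s R)) (Bdd.integOn (by fun_prop) (Hball_fin s R)) fun z => ?_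
      have a1 := sq_le_D1 w l.succ z
      have a2 : 0 ≤ (M ^ 2 + C) * Lt β A w z ^ 2 := by positivity
      have a3 : (M ^ 2 + C) * v z ^ 2 ≤ (M ^ 2 + C) * D1 w z := by gcongr
      have a4 : 0 ≤ (1 + (ν / 4)⁻¹) * D1 w z := mul_nonneg (by positivity) (D1_nonneg w z)
      dsimp only
      linarith
    rw [integral_const_mul] at h3
    rw [mul_assoc, ← div_eq_inv_mul, le_div_iff₀' (by positivity)]
    calc _ ≤ _ := mll h2 (by positivity)
      _ ≤ _ := h.trans h3
  · have a1 : ζ z ^ 2 ≤ 1 := by have := h01 z; nlinarith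
    have a2 := sq_le_D1 v l.succ z
    have a3 := young (dx l.succ v z) (Lt β A w z) (ν / 4) (by positivity)
    have a4 : ζ z ^ 2 * (dx l.succ v z * Lt β A w z) ≤ ν / 4 * (ζ z ^ 2 * D1 v z) + (ν / 4)⁻¹ * Lt β A w z ^ 2 := by
      calc _ ≤ ζ z ^ 2 * (ν / 4 * dx l.succ v z ^ 2 + (ν / 4)⁻¹ * Lt β A w z ^ 2) := by gcongr
        _ = ν / 4 * (ζ z ^ 2 * dx l.succ v z ^ 2) + ζ z ^ 2 * ((ν / 4)⁻¹ * Lt β A w z ^ 2) := by ring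
        _ ≤ ν / 4 * (ζ z ^ 2 * D1 v z) + 1 * ((ν / 4)⁻¹ * Lt β A w z ^ 2) := by gcongr
        _ = _ := by ring
    have a5 : 2 * (ζ z * dx l.succ ζ z * v z) * Lt β A w z ≤ M ^ 2 * v z ^ 2 + Lt β A w z ^ 2 := by
      have b1 : (ζ z * dx l.succ ζ z * v z) ^ 2 ≤ M ^ 2 * v z ^ 2 := by
        rw [mul_pow, mul_pow]
        have : dx l.succ ζ z ^ 2 ≤ M ^ 2 := sq_le_sq' (abs_le.1 (hMx _ z)).1 (abs_le.1 (hMx _ z)).2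
        calc _ ≤ 1 * M ^ 2 * v z ^ 2 := by gcongr
          _ = _ := by ring
      nlinarith [sq_nonneg (ζ z * dx l.succ ζ z * v z - Lt β A w z)]
    linarith
noncomputable def II (s r : ℝ) (f : Fu n) : ℝ := ∫ z in Hs n s ∩ ball 0 r, f z
lemma II_mono (hr : r ≤ R) (hf : Bdd f) (hg : Bdd g)
    (hg0 : ∀ z, 0 ≤ g z) (h : ∀ z, f z ≤ g z) : II s r f ≤ II s R g :=
  (integral_mono (hf.integOn (Hball_fin s r)) (hg.integOn (Hball_fin s r)) h).trans
    (setIntegral_mono_set (hg.integOn (Hball_fin s R)) (evf hg0)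
      (LE.le.eventuallyLE (Set.inter_subset_inter_right _ (ball_subset_ball hr))))
lemma II_add (hf : Bdd f) (hg : Bdd g) :
    II s r (fun z => f z + g z) = II s r f + II s r g :=
  integral_add (hf.integOn (Hball_fin s r)) (hg.integOn (Hball_fin s r))
lemma II_cmul (c : ℝ) (f : Fu n) : II s r (fun z => c * f z) = c * II s r f :=
  integral_const_mul _ _
lemma II_sum {ι : Type*} (S : Finset ι) {f : ι → Fu n} (hf : ∀ i, Bdd (f i)) :
    II s r (fun z => ∑ i ∈ S, f i z) = ∑ i ∈ S, II s r (f i) :=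
  integral_finsetSum _ fun i _ => (hf i).integOn (Hball_fin s r)
lemma II_nonneg (h : ∀ z, 0 ≤ f z) : 0 ≤ II s r f := integral_nonneg h
lemma pt_wt (ν M N ζ ζt ζ0 wt w0 wt0 w00 L b d1 d2 : ℝ) (hν : 0 < ν) (hM : 0 ≤ M) (h0 : 0 ≤ ζ) (h1 : ζ ≤ 1)
    (hMt : |ζt| ≤ M) (hM0 : |ζ0| ≤ M) (hb : ν ≤ b) (k3 : w0 ^ 2 ≤ d1)
    (k1 : (L - b * wt - w00) ^ 2 ≤ N * d2) :
    ν / 2 * (ζ ^ 2 * wt ^ 2) - (1 / 2 * (2 * (ζ * w0) * (ζt * w0 + ζ * wt0)) +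
      (-1) * ((2 * ζ * ζ0 * wt + ζ ^ 2 * wt0) * w0 + ζ ^ 2 * wt * w00)) ≤
    (M + (ν/8)⁻¹ * (2 * M) ^ 2) * d1 + ((ν/8)⁻¹ * 2 * L ^ 2 + (ν/8)⁻¹ * 2 * N * d2) := by
  obtain ⟨G, hG⟩ : ∃ G, G = L - b * wt - w00 := ⟨_, rfl⟩
  rw [← hG] at k1
  have k2 : w00 = L - b * wt - G := by rw [hG]; ring
  have a1 : ζ ^ 2 ≤ 1 := by nlinarith
  have k4 : -(ζ * ζt * w0 ^ 2) ≤ M * d1 := by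
    have : |ζ * ζt| ≤ 1 * M := by
      rw [abs_mul, abs_of_nonneg h0]
      exact mul_le_mul h1 hMt (abs_nonneg _) zero_le_one
    have q : -(ζ * ζt) ≤ M := by linarith [neg_abs_le (ζ * ζt)]
    calc _ = -(ζ * ζt) * w0 ^ 2 := by ring
      _ ≤ M * w0 ^ 2 := by gcongr
      _ ≤ _ := by gcongr
  have k5 : 2 * ζ * ζ0 * wt * w0 ≤ ν / 8 * (ζ ^ 2 * wt ^ 2) + (ν/8)⁻¹ * (2 * M) ^ 2 * d1 := by
    have q := young (ζ * wt) (2 * ζ0 * w0) (ν/8) (by positivity)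
    have q2 : ζ0 ^ 2 ≤ M ^ 2 := sq_le_sq' (abs_le.1 hM0).1 (abs_le.1 hM0).2
    have q3 : (2 * ζ0 * w0) ^ 2 ≤ (2 * M) ^ 2 * d1 := by
      rw [mul_pow, mul_pow, mul_pow]; gcongr
    have q4 := mll q3 (show 0 ≤ (ν/8)⁻¹ by positivity)
    rw [mul_pow ζ] at q
    linarith
  have k6 : ζ ^ 2 * (wt * (L - G)) ≤ ν / 8 * (ζ ^ 2 * wt ^ 2) + ((ν/8)⁻¹ * 2 * L ^ 2 + (ν/8)⁻¹ * 2 * N * d2) := by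
    have q := young wt (L - G) (ν/8) (by positivity)
    have q2 : (L - G) ^ 2 ≤ 2 * L ^ 2 + 2 * (N * d2) := by nlinarith [sq_nonneg (L + G)]
    have q0 : 0 ≤ N * d2 := (sq_nonneg _).trans k1
    have q4 := mll q2 (show 0 ≤ (ν/8)⁻¹ by positivity)
    have q5 : wt * (L - G) ≤ ν / 8 * wt ^ 2 + ((ν/8)⁻¹ * (2 * L ^ 2 + 2 * (N * d2))) := by linarith
    have q6 : 0 ≤ (ν/8)⁻¹ * (2 * L ^ 2 + 2 * (N * d2)) := by positivity
    have q7 := mll q5 (sq_nonneg ζ)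
    have q8 := mlr a1 q6
    linarith
  have k7 : ν * (ζ ^ 2 * wt ^ 2) ≤ b * (ζ ^ 2 * wt ^ 2) := by gcongr
  have k8 : 0 ≤ ν * (ζ ^ 2 * wt ^ 2) := by positivity
  rw [k2]
  linarith
lemma cacc2 (n : ℕ) (ν r R : ℝ) (hν : 0 < ν) (hr : 0 < r) (hR : r < R) : ∃ C, 0 ≤ C ∧
    ∀ (β : Fu n) (A : Fa n), Co ν β A → ∀ (s : ℝ) (w : Fu n), CT w →
    II s r (fun z => dd et w z ^ 2 + D2 w z) ≤
      C * II s R (fun z => Lt β A w z ^ 2 + D1 w z) := by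
  obtain ⟨ζ, M, hζ, hM, h01, h1, hz, hMt, hMx⟩ := cutoff n r ((r+R)/2) hr (by linarith)
  obtain ⟨C1, hC1, H1⟩ := cacc2a n ν ((r+R)/2) R hν (by linarith) (by linarith)
  set ρ := (r+R)/2
  set c0 := M + (ν/8)⁻¹ * (2 * M) ^ 2 with hc0
  set c1 := (ν/8)⁻¹ * 2 with hc1
  set N : ℝ := n * (n + 1) * ν⁻¹ ^ 2 with hN
  set c2 := (ν/2)⁻¹ * (c0 + c1 + c1 * N * (n * C1)) with hc2
  refine ⟨3 + (1 + 3 * ν⁻¹ ^ 2) * c2 + (3 * N + 2) * (n * C1), by positivity, fun β A hc s w hw => ?_⟩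
  have bL := Lt_bdd hc hw
  have bD := D1_bdd hw
  have bD' := D2'_bdd hw
  have bD2 := D2_bdd hw
  have bt := (hw.dd et).bdd
  set Y := II s R (fun z => Lt β A w z ^ 2 + D1 w z) with hY
  have nY : 0 ≤ Y := II_nonneg fun z => add_nonneg (sq_nonneg _) (D1_nonneg w z)
  have A1 : II s ρ (D2' w) ≤ n * C1 * Y := by
    have : II s ρ (D2' w) = ∑ l : Fin n, II s ρ (D1 (dx l.succ w)) :=
      II_sum _ fun l => D1_bdd (hw.dd _)
    rw [this]
    refine (sum_le_sum fun l _ => H1 β A hc s w hw l).trans_eq ?_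
    simp [hY, II]; ring
  have A2 : ∀ r ≤ R, II s r (fun z => Lt β A w z ^ 2) ≤ Y := fun r hr =>
    II_mono hr (by fun_prop) (by fun_prop) (fun z => add_nonneg (sq_nonneg _) (D1_nonneg w z))
      fun z => by have := D1_nonneg w z; linarith
  have A3 : ∀ r ≤ R, II s r (D1 w) ≤ Y := fun r hr =>
    II_mono hr (by fun_prop) (by fun_prop) (fun z => add_nonneg (sq_nonneg _) (D1_nonneg w z))
      fun z => by have := sq_nonneg (Lt β A w z); linarith
  have A4 : II s r (D2' w) ≤ n * C1 * Y :=
    (II_mono (by simp only [ρ]; linarith) bD' bD' (D2'_nonneg w) fun z => le_rfl).trans A1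
  have A5 : II s r (fun z => dd et w z ^ 2) ≤ c2 * Y := by
    have hwt := hw.dd et
    have hw0 := hw.dd (ex 0)
    have b1 := hζ.bdd
    have b2 := (hζ.dd et).bdd
    have b3 := (hζ.dd (ex 0)).bdd
    have b4 := hw0.bdd
    have b5 := hw.d2 et (ex 0)
    have b6 := hw.d2 (ex 0) (ex 0)
    have I1 := ibp_t (α := fun _ => 1) (Bdd.const 1) (hζ.mul hw0).sq s (fun z => zero_le_one) (fun z => sq_nonneg _)
      (fun z h => rfl)
    have I2 := ibp_inv (α := fun _ => 1) (Bdd.const 1) ((hζ.sq.mul hwt).mul hw0) (ex 0) s rfl (fun z h => rfl)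
    rw [dd_sq (hζ.mul hw0), dd_mul hζ hw0] at I1
    rw [dd_mul (hζ.sq.mul hwt) hw0, dd_mul hζ.sq hwt, dd_sq hζ, dd_comm hw (ex 0) et] at I2
    simp only [one_mul] at I1 I2
    set T : En n → ℝ := fun z => 2 * (ζ z * dx 0 w z) * (dd et ζ z * dx 0 w z + ζ z * dd et (dx 0 w) z) with hT
    set U : En n → ℝ := fun z => (2 * ζ z * dx 0 ζ z * dd et w z + ζ z ^ 2 * dd et (dx 0 w) z) * dx 0 w z +
       ζ z ^ 2 * dd et w z * dx 0 (dx 0 w) z with hU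
    have bT : Bdd T := by fun_prop
    have bU : Bdd U := by fun_prop
    have zT : ∀ z ∉ ball (0:En n) ρ, T z = 0 := fun z h => by simp [hT, hz z h]
    have zU : ∀ z ∉ ball (0:En n) ρ, U z = 0 := fun z h => by simp [hU, hz z h]
    have P := int_le_loc (s := s) (R := ρ) (f := fun z => ν / 2 * (ζ z ^ 2 * dd et w z ^ 2)) (f1 := fun z => 1 / 2 * T z + (-1) * U z)
      (g := fun z => c0 * D1 w z + (c1 * Lt β A w z ^ 2 + c1 * N * D2' w z)) (by fun_prop) (by fun_prop) (by fun_prop) ?_ ?_ ?_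
    · have Q := loc_le_int (s := s) b1 (bt.pow 2) (fun z => sq_nonneg _) h1 fun z h => (hz z h).1
      rw [integral_const_mul] at P
      have P' : ν / 2 * ∫ z in Hs n s, ζ z ^ 2 * dd et w z ^ 2 ≤ (c0 + c1 + c1 * N * (n * C1)) * Y := by
        refine P.trans ?_
        change II s ρ _ ≤ _
        rw [II_add (by fun_prop) (by fun_prop), II_add (by fun_prop) (by fun_prop), II_cmul, II_cmul, II_cmul]
        have hρ : ρ ≤ R := by simp only [ρ]; linarith
        have q1 : c0 * II s ρ (D1 w) ≤ c0 * Y := mll (A3 ρ hρ) (by positivity)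
        have q2 := mll (A2 ρ hρ) (show 0 ≤ c1 by positivity)
        have q3 := mll A1 (show 0 ≤ c1 * N by positivity)
        linarith
      rw [hc2, mul_assoc, ← div_eq_inv_mul, le_div_iff₀' (by positivity)]
      exact (mll Q (by positivity)).trans P'
    · have j2 := ((bT.integ' (ball_fin ρ) zT).restrict (s := Hs n s)).const_mul (1/2)
      have j3 := ((bU.integ' (ball_fin ρ) zU).restrict (s := Hs n s)).const_mul (-1)
      rw [integral_add j2 j3, integral_const_mul, integral_const_mul, I2]
      linarith
    · intro z h
      simp [hz z h, zT z h, zU z h]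
    · intro z _
      exact pt_wt ν M N (ζ z) (dd et ζ z) (dx 0 ζ z) (dd et w z) (dx 0 w z) _ _ (Lt β A w z) (β z) _ _ hν hM
        (h01 z).1 (h01 z).2 (hMt z) (hMx 0 z) (hc.βl z) (sq_le_D1 w 0 z) (Lt_split hc hw z)
  have F : II s r (fun z => dd et w z ^ 2 + D2 w z) ≤
      II s r (fun z => 3 * Lt β A w z ^ 2 + ((1 + 3 * ν⁻¹ ^ 2) * dd et w z ^ 2 + (3 * N + 2) * D2' w z)) := by
    refine II_mono le_rfl (by fun_prop) (by fun_prop) (fun z => ?_) fun z => ?_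
    · have := D2'_nonneg w z
      positivity
    · have := D2_le' hc hw z
      linarith
  refine F.trans ?_
  rw [II_add (by fun_prop) (by fun_prop), II_add (by fun_prop) (by fun_prop), II_cmul, II_cmul, II_cmul]
  have f1 := A2 r hR.le
  have f2 := mll A5 (show 0 ≤ 1 + 3 * ν⁻¹ ^ 2 by positivity)
  have f3 := mll A4 (show 0 ≤ 3 * N + 2 by positivity)
  linarith
end cacc3
section chain
noncomputable def PN (b : (Fu n) → Fu n) : List (En n) → (Fu n) → En n → ℝ
  | [], w => b w
  | e :: l, w => fun z => PN b l w z + PN b l (dd e w) z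
lemma PN_nonneg {b : (Fu n) → Fu n} (hb : ∀ w z, 0 ≤ b w z) (l) (w) (z) : 0 ≤ PN b l w z := by
  induction l generalizing w with
  | nil => exact hb w z
  | cons e l ih => exact add_nonneg (ih _) (ih _)
lemma PN_bdd {b : (Fu n) → Fu n} (hb : ∀ w, CT w → Bdd (b w)) (l) {w} (hw : CT w) : Bdd (PN b l w) := by
  induction l generalizing w with
  | nil => exact hb w hw
  | cons e l ih => exact (ih hw).add (ih (hw.dd e))
lemma PN_ge {b : (Fu n) → Fu n} (hb : ∀ w z, 0 ≤ b w z) (l) (w) (z) : b w z ≤ PN b l w z := by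
  induction l generalizing w with
  | nil => exact le_rfl
  | cons e l ih => exact (ih w).trans (le_add_of_nonneg_right (PN_nonneg hb _ _ _))
lemma PN_append (b : (Fu n) → Fu n) (l e w) : PN b (l ++ [e]) w = PN (PN b [e]) l w := by
  induction l generalizing w with
  | nil => rfl
  | cons e' l ih => simp only [List.cons_append, PN, ih]
def Tg (e : En n) : Prop := e = et ∨ ∃ l : Fin n, e = ex l.succ
structure Seed (n : ℕ) (ν : ℝ) (X b : (Fu n) → Fu n) : Prop where
  X0 : ∀ w z, 0 ≤ X w z
  b0 : ∀ w z, 0 ≤ b w z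
  bX : ∀ w, CT w → Bdd (X w)
  bb : ∀ w, CT w → Bdd (b w)
  ha : ∀ r R : ℝ, 0 < r → r < R → ∃ C, 0 ≤ C ∧ ∀ β A, Co ν β A → ∀ s w, CT w →
    II s r (b w) ≤ C * II s R (fun z => Lt β A w z ^ 2 + X w z)
  hb : ∀ e, Tg e → ∀ r R : ℝ, 0 < r → r < R → ∃ C, 0 ≤ C ∧ ∀ β A, Co ν β A → ∀ s w, CT w →
    II s r (X (dd e w)) ≤ C * II s R (fun z => Lt β A w z ^ 2 + Lt β A (dd e w) z ^ 2 + X w z)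
noncomputable def LB (β : Fu n) (A : Fa n) (w : Fu n) : En n → ℝ :=
  fun z => Lt β A w z ^ 2
lemma LB0 (w : Fu n) (z) : 0 ≤ LB β A w z := sq_nonneg _
lemma LBb (hc : Co ν β A) (w) (hw : CT w) : Bdd (LB β A w) := (Lt_bdd hc hw).pow 2
lemma Seed.chain {X b} (h : Seed n ν X b) (l : List (En n)) (hl : ∀ e ∈ l, Tg e) (r R : ℝ) (hr : 0 < r) (hR : r < R) :
    ∃ C, 0 ≤ C ∧ ∀ β A, Co ν β A → ∀ s w, CT w →
    II s r (PN b l w) ≤ C * II s R (fun z => PN (LB β A) l w z + X w z) := by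
  induction l generalizing r R with
  | nil => exact h.ha r R hr hR
  | cons e l ih =>
    obtain ⟨C1, hC1, H1⟩ := ih (fun e he => hl e (List.mem_cons_of_mem _ he)) r ((r+R)/2) hr (by linarith)
    obtain ⟨C2, hC2, H2⟩ := h.hb e (hl e List.mem_cons_self) ((r+R)/2) R (by linarith) (by linarith)
    refine ⟨C1 + C1 * (1 + C2), by positivity, fun β A hc s w hw => ?_⟩
    have hρ : (r+R)/2 ≤ R := by linarith
    have b1 := PN_bdd (LBb hc) l hw
    have b2 := PN_bdd (LBb hc) l (hw.dd e)
    have b3 := h.bX w hw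
    have b4 := h.bX _ (hw.dd e)
    have b5 := PN_bdd h.bb l hw
    have b6 := PN_bdd h.bb l (hw.dd e)
    have b7 := Lt_bdd hc hw
    have b8 := Lt_bdd hc (hw.dd e)
    have p1 := PN_nonneg (LB0 (β := β) (A := A)) l w
    have p2 := PN_nonneg (LB0 (β := β) (A := A)) l (dd e w)
    have q1 := PN_ge (LB0 (β := β) (A := A)) l w
    have q2 := PN_ge (LB0 (β := β) (A := A)) l (dd e w)
    have p3 := h.X0 w
    simp only [LB] at q1 q2
    set Y := II s R (fun z => PN (LB β A) (e :: l) w z + X w z) with hY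
    have B : Bdd (fun z => PN (LB β A) (e :: l) w z + X w z) := by simp only [PN]; fun_prop
    have P : ∀ z, 0 ≤ PN (LB β A) (e :: l) w z + X w z := fun z => by
      simp only [PN]; linarith [p1 z, p2 z, p3 z]
    have a1 := H1 β A hc s w hw
    have a2 := H1 β A hc s _ (hw.dd e)
    have a3 := H2 β A hc s w hw
    have e1 : II s ((r+R)/2) (fun z => PN (LB β A) l w z + X w z) ≤ Y :=
      II_mono hρ (by fun_prop) B P fun z => by simp only [PN]; linarith [p2 z]
    have e2 : II s ((r+R)/2) (PN (LB β A) l (dd e w)) ≤ Y :=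
      II_mono hρ (by fun_prop) B P fun z => by simp only [PN]; linarith [p1 z, p3 z]
    have e3 : II s R (fun z => Lt β A w z ^ 2 + Lt β A (dd e w) z ^ 2 + X w z) ≤ Y :=
      II_mono le_rfl (by fun_prop) B P fun z => by simp only [PN]; linarith [q1 z, q2 z]
    rw [II_add b2 b4] at a2
    have : II s r (PN b (e :: l) w) = II s r (PN b l w) + II s r (PN b l (dd e w)) := II_add b5 b6
    rw [this]
    have f1 := mll e1 hC1
    have f2 := mll e3 hC2
    have f3 := mll (add_le_add e2 (a3.trans f2)) hC1
    linarith
lemma seed0 (hν : 0 < ν) : Seed n ν (fun w z => w z ^ 2) (fun w z => w z ^ 2 + dx 0 w z ^ 2) where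
  X0 w z := sq_nonneg _
  b0 w z := by positivity
  bX w hw := hw.bdd.pow 2
  bb w hw := (hw.bdd.pow 2).add ((hw.dd _).bdd.pow 2)
  ha r R hr hR := by
    obtain ⟨C, hC, H⟩ := cacc1 n ν r R hν hr hR
    refine ⟨1 + C, by positivity, fun β A hc s w hw => ?_⟩
    have b1 := hw.bdd
    have b2 := (hw.dd (ex 0)).bdd
    have b3 := Lt_bdd hc hw
    have h1 := H β A hc s w hw
    rw [II_add (by fun_prop) (by fun_prop)]
    have h2 : II s r (fun z => w z ^ 2) ≤ II s R (fun z => Lt β A w z ^ 2 + w z ^ 2) :=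
      II_mono hR.le (by fun_prop) (by fun_prop) (fun z => by positivity) fun z => by nlinarith [sq_nonneg (Lt β A w z)]
    have h3 : II s r (fun z => dx 0 w z ^ 2) ≤ II s r (D1 w) :=
      II_mono le_rfl (by fun_prop) (D1_bdd hw) (D1_nonneg w) (sq_le_D1 w 0)
    change II s r (D1 w) ≤ C * II s R _ at h1
    linarith
  hb e he r R hr hR := by
    obtain ⟨C, hC, H⟩ := cacc1 n ν ((r+R)/2) R hν (by linarith) (by linarith)
    obtain ⟨C', hC', H'⟩ := cacc2 n ν r ((r+R)/2) hν hr (by linarith)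
    refine ⟨C + C' * (1 + C), by positivity, fun β A hc s w hw => ?_⟩
    have b1 := hw.bdd
    have b2 := (hw.dd et).bdd
    have b3 := Lt_bdd hc hw
    have b4 := Lt_bdd hc (hw.dd e)
    have b5 := D1_bdd hw
    have b6 := D2_bdd hw
    have b7 := (hw.dd e).bdd
    set Y := II s R (fun z => Lt β A w z ^ 2 + Lt β A (dd e w) z ^ 2 + w z ^ 2) with hY
    have h1 : II s ((r+R)/2) (D1 w) ≤ C * Y := by
      refine (H β A hc s w hw).trans (mll ?_ hC)
      exact II_mono le_rfl (by fun_prop) (by fun_prop) (fun z => by positivity) fun z => by nlinarith [sq_nonneg (Lt β A (dd e w) z)]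
    have nY : 0 ≤ Y := II_nonneg fun z => by positivity
    rcases he with rfl | ⟨l, rfl⟩
    · have h2 := H' β A hc s w hw
      rw [II_add (by fun_prop) (by fun_prop), II_add (by fun_prop) (by fun_prop)] at h2
      have h3 : II s ((r+R)/2) (fun z => Lt β A w z ^ 2) ≤ Y :=
        II_mono (by linarith) (by fun_prop) (by fun_prop) (fun z => by positivity) fun z => by
          nlinarith [sq_nonneg (Lt β A (dd et w) z), sq_nonneg (w z)]
      have h4 : 0 ≤ II s r (D2 w) := II_nonneg (D2_nonneg w)
      have h5 := mll (add_le_add h3 h1) hC'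
      have h6 : 0 ≤ C * Y := by positivity
      linarith
    · have h3 : II s r (fun z => dx l.succ w z ^ 2) ≤ II s ((r+R)/2) (D1 w) :=
        II_mono (by linarith) (by fun_prop) (D1_bdd hw) (D1_nonneg w) (sq_le_D1 w _)
      have h6 : 0 ≤ C' * (1 + C) * Y := by positivity
      linarith
lemma seed1 (hν : 0 < ν) (k : Ix n) :
    Seed n ν D1 (fun w z => dx k w z ^ 2 + dx 0 (dx k w) z ^ 2) where
  X0 w z := D1_nonneg w z
  b0 w z := by positivity
  bX w hw := D1_bdd hw
  bb w hw := ((hw.dd _).bdd.pow 2).add ((hw.d2 _ _).pow 2)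
  ha r R hr hR := by
    obtain ⟨C, hC, H⟩ := cacc2 n ν r R hν hr hR
    refine ⟨1 + C, by positivity, fun β A hc s w hw => ?_⟩
    have b1 := D1_bdd hw
    have b2 := (hw.dd (ex k)).bdd
    have b3 := Lt_bdd hc hw
    have b4 := hw.d2 (ex 0) (ex k)
    have b5 := D2_bdd hw
    have b6 := (hw.dd et).bdd
    have h1 := H β A hc s w hw
    rw [II_add (by fun_prop) (by fun_prop)]
    have h2 : II s r (fun z => dx k w z ^ 2) ≤ II s R (fun z => Lt β A w z ^ 2 + D1 w z) :=
      II_mono hR.le (by fun_prop) (by fun_prop) (fun z => add_nonneg (sq_nonneg _) (D1_nonneg w z)) fun z => by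
        nlinarith [sq_nonneg (Lt β A w z), sq_le_D1 w k z]
    have h3 : II s r (fun z => dx 0 (dx k w) z ^ 2) ≤ II s r (fun z => dd et w z ^ 2 + D2 w z) := by
      refine II_mono le_rfl (by fun_prop) (by fun_prop) (fun z => add_nonneg (sq_nonneg _) (D2_nonneg w z)) fun z => ?_
      have : dx 0 (dx k w) z ^ 2 ≤ D2 w z :=
        (single_le_sum (f := fun k => dx 0 (dx k w) z ^ 2) (fun _ _ => sq_nonneg _) (mem_univ k)).trans
        (single_le_sum (f := fun j => ∑ k, dx j (dx k w) z ^ 2)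
          (fun _ _ => sum_nonneg fun _ _ => sq_nonneg _) (mem_univ 0))
      nlinarith [sq_nonneg (dd et w z)]
    linarith
  hb e he r R hr hR := by
    obtain ⟨C, hC, H⟩ := cacc1 n ν r ((r+R)/2) hν hr (by linarith)
    obtain ⟨C', hC', H'⟩ := cacc2 n ν ((r+R)/2) R hν (by linarith) (by linarith)
    refine ⟨C' + C * (1 + C'), by positivity, fun β A hc s w hw => ?_⟩
    have b2 := (hw.dd et).bdd
    have b3 := Lt_bdd hc hw
    have b4 := Lt_bdd hc (hw.dd e)
    have b5 := D1_bdd hw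
    have b6 := D2_bdd hw
    have b7 := D1_bdd (hw.dd e)
    set Y := II s R (fun z => Lt β A w z ^ 2 + Lt β A (dd e w) z ^ 2 + D1 w z) with hY
    have P : ∀ z, 0 ≤ Lt β A w z ^ 2 + Lt β A (dd e w) z ^ 2 + D1 w z := fun z => by
      have := D1_nonneg w z; positivity
    have nY : 0 ≤ Y := II_nonneg P
    have h1 : II s ((r+R)/2) (fun z => dd et w z ^ 2 + D2 w z) ≤ C' * Y := by
      refine (H' β A hc s w hw).trans (mll ?_ hC')
      exact II_mono le_rfl (by fun_prop) (by fun_prop) P fun z => by nlinarith [sq_nonneg (Lt β A (dd e w) z)]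
    rcases he with rfl | ⟨l, rfl⟩
    · have h2 := H β A hc s _ (hw.dd et)
      change II s r (D1 (dd et w)) ≤ C * II s ((r+R)/2) _ at h2
      rw [II_add (by fun_prop) (by fun_prop)] at h2
      have h3 : II s ((r+R)/2) (fun z => Lt β A (dd et w) z ^ 2) ≤ Y :=
        II_mono (by linarith) (by fun_prop) (by fun_prop) P fun z => by
          nlinarith [sq_nonneg (Lt β A w z), D1_nonneg w z]
      have h4 : II s ((r+R)/2) (fun z => dd et w z ^ 2) ≤ II s ((r+R)/2) (fun z => dd et w z ^ 2 + D2 w z) :=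
        II_mono le_rfl (by fun_prop) (by fun_prop) (fun z => add_nonneg (sq_nonneg _) (D2_nonneg w z)) fun z => by
          linarith [D2_nonneg w z]
      have h5 := mll (add_le_add h3 (h4.trans h1)) hC
      have h6 : 0 ≤ C' * Y := by positivity
      linarith
    · have h3 : II s r (D1 (dx l.succ w)) ≤ II s ((r+R)/2) (fun z => dd et w z ^ 2 + D2 w z) := by
        refine II_mono (by linarith) (by fun_prop) (by fun_prop) (fun z => add_nonneg (sq_nonneg _) (D2_nonneg w z)) fun z => ?_
        have : D1 (dx l.succ w) z ≤ D2 w z :=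
          sum_le_sum fun j _ => single_le_sum (f := fun k => dx j (dx k w) z ^ 2) (fun _ _ => sq_nonneg _) (mem_univ l.succ)
        nlinarith [sq_nonneg (dd et w z)]
      have h6 : 0 ≤ C * (1 + C') * Y := by positivity
      linarith
end chain
section sobolev
lemma sob1d (f f' : ℝ → ℝ) (hf : ∀ x, HasDerivAt f (f' x) x) (hf' : Continuous f') (a b x : ℝ) (hab : 1 ≤ b - a)
    (hx : x ∈ Ioo a b) : f x ^ 2 ≤ 2 * ∫ τ in Ioo a b, (f τ ^ 2 + f' τ ^ 2) := by
  have hfc : Continuous f := continuous_iff_continuousAt.2 fun x => (hf x).continuousAt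
  set J := ∫ τ in Ioo a b, (f τ ^ 2 + f' τ ^ 2) with hJ
  have int : ∀ g : ℝ → ℝ, Continuous g → IntegrableOn g (Ioo a b) := fun g hg =>
    (hg.integrableOn_Icc).mono_set Set.Ioo_subset_Icc_self
  have h1 : ∀ y ∈ Ioo a b, f x ^ 2 - J ≤ f y ^ 2 := by
    intro y hy
    have e : ∫ τ in y..x, (2 * f τ * f' τ) = f x ^ 2 - f y ^ 2 := by
      apply intervalIntegral.integral_eq_sub_of_hasDerivAt
      · intro τ _
        simpa using (hf τ).fun_pow 2
      · exact (by fun_prop : Continuous fun τ => 2 * f τ * f' τ).intervalIntegrable _ _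
    have e2 : |∫ τ in y..x, (2 * f τ * f' τ)| ≤ J := by
      rw [← norm_eq_abs]; refine (intervalIntegral.norm_integral_le_integral_norm_uIoc).trans ?_
      refine (setIntegral_mono_set (int _ (by fun_prop)) (evf fun _ => abs_nonneg _)
        (LE.le.eventuallyLE ?_)).trans (integral_mono (int _ (by fun_prop)) (int _ (by fun_prop)) fun τ => ?_)
      · intro τ hτ
        rcases Set.mem_uIoc.1 hτ with h | h
        · exact ⟨hy.1.trans h.1, h.2.trans_lt hx.2⟩
        · exact ⟨hx.1.trans h.1, h.2.trans_lt hy.2⟩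
      · dsimp only
        rw [abs_le]; constructor <;> nlinarith [sq_nonneg (f τ + f' τ), sq_nonneg (f τ - f' τ)]
    have := le_abs_self (∫ τ in y..x, (2 * f τ * f' τ))
    linarith
  have h2 : (b - a) * (f x ^ 2 - J) ≤ J := by
    calc _ = ∫ y in Ioo a b, (f x ^ 2 - J) := by
          rw [setIntegral_const, smul_eq_mul, Real.volume_real_Ioo_of_le (by linarith)]
      _ ≤ ∫ y in Ioo a b, (f y ^ 2 + f' y ^ 2) := by
          refine setIntegral_mono_on (int _ (by fun_prop)) (int _ (by fun_prop)) measurableSet_Ioo fun y hy => ?_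
          have := h1 y hy
          nlinarith [sq_nonneg (f' y)]
  rcases le_or_gt (f x ^ 2 - J) 0 with h | h
  · have : 0 ≤ J := integral_nonneg fun _ => by positivity
    linarith
  · nlinarith
def SQ (w : Fu n) : En n → ℝ := fun z => w z ^ 2
lemma PN_SQ_cont (l : List (En n)) {w} (hw : CT w) : Continuous (PN SQ l w) := by
  induction l generalizing w with
  | nil => exact hw.cont.pow 2
  | cons e l ih => exact (ih hw).add (ih (hw.dd e))
lemma sob_slice (l : List (En n)) (hw : CT w) (z e : En n) (a b : ℝ) (hab : 1 ≤ b - a)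
    (h0 : (0:ℝ) ∈ Ioo a b) :
    PN SQ l w z ≤ 2 * ∫ τ in Ioo a b, PN SQ (e :: l) w (z + τ • e) := by
  induction l generalizing w with
  | nil =>
    have hd : ∀ (h : ℝ), HasDerivAt (fun h : ℝ => w (z + h • e)) (dd e w (z + h • e)) h := by
      intro h
      have h1 : HasDerivAt (fun h : ℝ => z + h • e) e h := by
        simpa using ((hasDerivAt_id h).smul_const e).const_add z
      exact (hw.diff (z + h • e)).hasFDerivAt.comp_hasDerivAt h h1
    have := sob1d _ _ hd ((hw.dd e).cont.comp (by fun_prop)) a b 0 hab h0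
    simpa [PN, SQ] using this
  | cons e' l ih =>
    have i : ∀ v : Fu n, CT v → IntegrableOn (fun τ : ℝ => PN SQ (e :: l) v (z + τ • e)) (Ioo a b) := fun v hv =>
      (((PN_SQ_cont (e :: l) hv).comp (by fun_prop : Continuous fun τ : ℝ => z + τ • e)).integrableOn_Icc).mono_set Set.Ioo_subset_Icc_self
    have h1 := ih hw
    have h2 := ih (hw.dd e')
    have : (fun τ : ℝ => PN SQ (e :: e' :: l) w (z + τ • e)) =
        fun τ => PN SQ (e :: l) w (z + τ • e) + PN SQ (e :: l) (dd e' w) (z + τ • e) := by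
      funext τ
      simp only [PN]
      rw [dd_comm hw e e']; ring
    rw [this, integral_add (i w hw) (i _ (hw.dd e'))]
    simp only [PN] at *
    linarith
noncomputable def GG (s : ℝ) (l : List (En n)) (w : Fu n) : En n → ℝ≥0∞ :=
  (Hs n s ∩ ball 0 1).indicator fun z => ofReal (2 ^ l.length * PN SQ l w z)
lemma GG_meas (s : ℝ) (l : List (En n)) (hw : CT w) : Measurable (GG s l w) :=
  Measurable.indicator ((PN_SQ_cont l hw).measurable.const_mul _).ennreal_ofReal ((Hs_meas s).inter measurableSet_ball)
lemma SQ0 (w : Fu n) (z) : 0 ≤ SQ w z := sq_nonneg _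
lemma GG_step (s : ℝ) (l : List (En n)) (hw : CT w) (z e : En n) (a b : ℝ) (hab : 1 ≤ b - a)
    (hB : z ∈ Hs n s ∩ ball 0 1 → ∀ τ ∈ Ioo a b, z + τ • e ∈ Hs n s ∩ ball 0 1)
    (h0 : z ∈ Hs n s ∩ ball 0 1 → (0:ℝ) ∈ Ioo a b) :
    GG s l w z ≤ ∫⁻ τ : ℝ, GG s (e :: l) w (z + τ • e) := by
  by_cases hz : z ∈ Hs n s ∩ ball 0 1
  · rw [GG, indicator_of_mem hz]
    have h1 := sob_slice l hw z e a b hab (h0 hz)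
    have c : Continuous (fun τ : ℝ => (2:ℝ) ^ (e :: l).length * PN SQ (e :: l) w (z + τ • e)) :=
      continuous_const.mul ((PN_SQ_cont (e :: l) hw).comp (by fun_prop : Continuous fun τ : ℝ => z + τ • e))
    calc ofReal (2 ^ l.length * PN SQ l w z)
        ≤ ofReal (∫ τ in Ioo a b, 2 ^ (e :: l).length * PN SQ (e :: l) w (z + τ • e)) := by
          apply ofReal_le_ofReal
          rw [integral_const_mul, List.length_cons, pow_succ, mul_assoc]
          exact mll h1 (by positivity)
      _ = ∫⁻ τ in Ioo a b, ofReal (2 ^ (e :: l).length * PN SQ (e :: l) w (z + τ • e)) := by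
          apply ofReal_integral_eq_lintegral_ofReal
          · exact c.integrableOn_Icc.mono_set Set.Ioo_subset_Icc_self
          · exact evf fun τ => mul_nonneg (by positivity) (PN_nonneg SQ0 _ _ _)
      _ = ∫⁻ τ in Ioo a b, GG s (e :: l) w (z + τ • e) := by
          refine setLIntegral_congr_fun measurableSet_Ioo fun τ hτ => ?_
          simp only [GG]
          rw [indicator_of_mem (hB hz τ hτ)]
      _ ≤ _ := setLIntegral_le_lintegral _ _
  · rw [GG, indicator_of_notMem hz]; exact zero_le
lemma mem_B : z ∈ Hs n s ∩ ball 0 1 ↔ s < z.1 ∧ |z.1| < 1 ∧ ∀ j, |z.2 j| < 1 := by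
  simp [Hs, Prod.norm_def, pi_norm_lt_iff]
lemma GG_x (s : ℝ) (w : Fu n) (hw : CT w) (t : ℝ) (l : List (Ix n)) (hl : l.Nodup) (x : Ix n → ℝ) :
    GG s [] w (t, x) ≤ (∫⋯∫⁻_l.toFinset, fun x => GG s (l.map ex) w (t, x)) x := by
  induction l with
  | nil => simp
  | cons j l ih =>
    have hj := (List.nodup_cons.1 hl).1
    refine (ih (List.nodup_cons.1 hl).2).trans ?_
    have hm : Measurable (fun x => GG s ((j :: l).map ex) w (t, x)) := (GG_meas s _ hw).comp (by fun_prop)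
    rw [List.toFinset_cons, lmarginal_insert' _ hm (by simpa using hj)]
    refine lmarginal_mono (fun x => ?_) x
    refine (GG_step s (l.map ex) hw (t, x) (ex j) (-1 - x j) (1 - x j) (by linarith) ?_ ?_).trans_eq ?_
    · intro hz τ hτ
      rw [mem_B] at *
      refine ⟨by simpa [ex] using hz.1, by simpa [ex] using hz.2.1, fun k => ?_⟩
      by_cases hk : k = j
      · subst hk
        simp only [ex, Prod.snd_add, Prod.smul_snd, Pi.add_apply, Pi.smul_apply, Pi.single_eq_same, smul_eq_mul, mul_one]
        rw [abs_lt]; constructor <;> linarith [hτ.1, hτ.2]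
      · simpa [ex, hk] using hz.2.2 k
    · intro hz
      rw [mem_B] at hz
      have := abs_lt.1 (hz.2.2 j)
      exact ⟨by linarith [this.2], by linarith [this.1]⟩
    · rw [← lintegral_add_left_eq_self (μ := (volume : Measure ℝ)) (fun xi => GG s (List.map ex (j :: l)) w (t, Function.update x j xi)) (x j)]
      congr 1; funext τ
      have : ((t, x) : En n) + τ • ex j = (t, Function.update x j (x j + τ)) := by
        ext k
        · simp [ex]
        · by_cases hk : k = j
          · subst hk; simp [ex]
          · simp [ex, hk]
      rw [this]; rfl
def TL (n : ℕ) : List (En n) := et :: (List.finRange n).map fun l => ex l.succ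
lemma TL_Tg (e : En n) (h : e ∈ TL n) : Tg e := by
  simp only [TL, List.mem_cons, List.mem_map] at h
  rcases h with h | ⟨l, _, h⟩
  · exact Or.inl h
  · exact Or.inr ⟨l, h.symm⟩
lemma sobolev (hs : s < 0) (hw : CT w) (z : En n) (hz : z ∈ Hs n s ∩ ball 0 1) :
    w z ^ 2 ≤ 2 ^ (n + 2) * II s 1 (PN (fun w z => w z ^ 2 + dx 0 w z ^ 2) (TL n) w) := by
  let l : List (Ix n) := (List.finRange n).map Fin.succ ++ [0]
  have hl : l.Nodup := by
    refine List.Nodup.append ((List.nodup_finRange n).map (Fin.succ_injective n)) (by simp) ?_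
    simp [List.disjoint_singleton]
  have hu : l.toFinset = Finset.univ := by
    ext j
    simp only [l, List.mem_toFinset, List.mem_append, List.mem_map, List.mem_finRange, true_and, List.mem_singleton, mem_univ, iff_true]
    rcases Fin.eq_zero_or_eq_succ j with h | ⟨k, rfl⟩
    · exact Or.inr h
    · exact Or.inl ⟨k, rfl⟩
  have hL : et :: l.map ex = TL n ++ [ex 0] := by
    simp [l, TL]
  have h1 := GG_x s w hw z.1 l hl z.2
  rw [hu, lmarginal_univ] at h1
  have h2 : ∀ x, GG s (l.map ex) w (z.1, x) ≤ ∫⁻ τ : ℝ, GG s (TL n ++ [ex 0]) w (τ, x) := by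
    intro x
    rw [← hL]
    have hz' := mem_B.1 hz
    have hz'' := abs_lt.1 hz'.2.1
    refine (GG_step s (l.map ex) hw (z.1, x) et (max s (-1) - z.1) (1 - z.1) ?_ ?_ ?_).trans_eq ?_
    · have : max s (-1) ≤ 0 := max_le hs.le (by norm_num)
      linarith
    · intro hx τ hτ
      rw [mem_B] at *
      have h3 := le_max_left s (-1)
      have h4 := le_max_right s (-1)
      refine ⟨?_, ?_, by simpa [et] using hx.2.2⟩
      · simp only [et, Prod.fst_add, Prod.smul_fst, smul_eq_mul, mul_one]; linarith [hτ.1]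
      · simp only [et, Prod.fst_add, Prod.smul_fst, smul_eq_mul, mul_one]
        rw [abs_lt]; constructor <;> linarith [hτ.1, hτ.2]
    · intro _
      have : max s (-1) < z.1 := max_lt hz'.1 hz''.1
      exact ⟨by linarith, by linarith⟩
    · rw [← lintegral_add_left_eq_self (μ := (volume : Measure ℝ)) (fun τ => GG s (et :: List.map ex l) w (τ, x)) z.1]
      congr 1; funext τ
      have : ((z.1, x) : En n) + τ • et = (z.1 + τ, x) := by simp [et]
      rw [this]
  have h3 : GG s [] w z ≤ ∫⁻ z, GG s (TL n ++ [ex 0]) w z := by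
    refine (h1.trans (lintegral_mono h2)).trans_eq ?_
    rw [volume_eq_prod, lintegral_prod_symm _ (GG_meas s _ hw).aemeasurable]
    rfl
  have bd : Bdd (PN SQ (TL n ++ [ex 0]) w) := PN_bdd (fun w hw => hw.bdd.pow 2) _ hw
  have hlen : (TL n ++ [ex 0]).length = n + 2 := by simp [TL]
  rw [GG, indicator_of_mem hz] at h3
  simp only [GG] at h3
  rw [lintegral_indicator ((Hs_meas s).inter measurableSet_ball), ← ofReal_integral_eq_lintegral_ofReal,
    ENNReal.ofReal_le_ofReal_iff, integral_const_mul, hlen, PN_append] at h3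
  · simpa [II, PN, SQ] using h3
  · exact integral_nonneg fun z => mul_nonneg (by positivity) (PN_nonneg SQ0 _ _ _)
  · exact (bd.integOn (Hball_fin s 1)).const_mul _
  · exact evf fun z => mul_nonneg (by positivity) (PN_nonneg SQ0 _ _ _)
end sobolev
section moll
@[fun_prop] lemma Bdd.rpow {f : Fu n} (hf : Bdd f) (p : ℝ) (hp : 1 ≤ p) : Bdd (fun z => |f z| ^ p) := by
  obtain ⟨m, M, hM⟩ := hf
  refine ⟨by fun_prop, M ^ p, fun z => ?_⟩
  rw [abs_of_nonneg (by positivity)]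
  exact rpow_le_rpow (abs_nonneg _) (hM z) (by linarith)
lemma mink {Y : Type*} [MeasurableSpace Y] (μ : Measure Y) [IsProbabilityMeasure μ] (p : ℝ) (hp : 1 ≤ p)
    (F : Y → Fu n) (hm : Measurable (Function.uncurry F)) (M : ℝ) (hM : ∀ y z, |F y z| ≤ M) (s r B : ℝ)
    (h : ∀ᵐ y ∂μ, II s r (fun z => |F y z| ^ p) ≤ B) : II s r (fun z => |∫ y, F y z ∂μ| ^ p) ≤ B := by
  have p0 : 0 < p := by linarith
  have hM' : ∀ y z, |(|F y z| ^ p)| ≤ M ^ p := fun y z => by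
    rw [abs_of_nonneg (by positivity)]
    exact rpow_le_rpow (abs_nonneg _) (hM y z) p0.le
  have hFz : ∀ z, Measurable fun y => F y z := fun z => hm.comp (by fun_prop : Measurable fun y => (y, z))
  have hFy : ∀ y, Measurable fun z => F y z := fun y => hm.comp (by fun_prop : Measurable fun z => (y, z))
  have i1 : ∀ z, Integrable (fun y => |F y z|) μ := fun z =>
    Integrable.of_bound (by fun_prop) M (evf fun y => by simpa using hM y z)
  have i2 : ∀ z, Integrable (fun y => |F y z| ^ p) μ := fun z =>
    Integrable.of_bound ((hFz z).abs.pow_const p).aestronglyMeasurable (M ^ p) (evf fun y => by simpa using hM' y z)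
  have : IsFiniteMeasure (volume.restrict (Hs n s ∩ ball 0 r)) := ⟨by
    rw [Measure.restrict_apply_univ]; exact (Hball_fin s r).lt_top⟩
  have hmm : Measurable (Function.uncurry fun (z : En n) y => |F y z| ^ p) := by
    have : Measurable fun q : En n × Y => F q.2 q.1 := hm.comp (by fun_prop : Measurable fun q : En n × Y => (q.2, q.1))
    exact (this.abs.pow_const p)
  have i3 : Integrable (Function.uncurry fun (z : En n) y => |F y z| ^ p) ((volume.restrict (Hs n s ∩ ball 0 r)).prod μ) :=
    Integrable.of_bound hmm.aestronglyMeasurable (M ^ p) (evf fun q => hM' q.2 q.1)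
  calc II s r (fun z => |∫ y, F y z ∂μ| ^ p) ≤ II s r (fun z => ∫ y, |F y z| ^ p ∂μ) := by
        refine integral_mono_of_nonneg (evf fun z => by positivity) i3.integral_prod_left
          (evf fun z => ?_)
        calc |∫ y, F y z ∂μ| ^ p ≤ (∫ y, |F y z| ∂μ) ^ p :=
              rpow_le_rpow (abs_nonneg _) (abs_integral_le_integral_abs) p0.le
          _ ≤ ∫ y, |F y z| ^ p ∂μ := (convexOn_rpow hp).map_integral_le
              (Real.continuous_rpow_const p0.le).continuousOn isClosed_Ici
              (evf fun y => abs_nonneg (F y z)) (i1 z) (i2 z)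
    _ = ∫ y, II s r (fun z => |F y z| ^ p) ∂μ := integral_integral_swap i3
    _ ≤ ∫ y, B ∂μ := integral_mono_ae i3.integral_prod_right (integrable_const _) h
    _ = B := by simp
lemma II_shift (hf : Bdd f) (h0 : ∀ z, 0 ≤ f z) (y : En n) (hy : 0 ≤ y.1)
    (hR : r + ‖y‖ ≤ R) : II s r (fun z => f (z + y)) ≤ II s R f := by
  rw [II, shift_int _ ((Hs_meas s).inter measurableSet_ball)]
  refine setIntegral_mono_set (hf.integOn (Hball_fin s R)) (evf h0) (LE.le.eventuallyLE ?_)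
  intro z hz
  simp only [Hs, mem_ofPred_eq, Set.mem_inter_iff, mem_ball, dist_zero_right, Prod.fst_sub] at *
  refine ⟨by linarith, ?_⟩
  have : ‖z‖ ≤ ‖z - y‖ + ‖y‖ := by simpa using norm_add_le (z - y) y
  linarith
lemma diff_eq (hu : CT u) (y z : En n) : u (z + y) - u z = ∫ θ in (0:ℝ)..1, dd y u (z + θ • y) := by
  have hd : ∀ (h : ℝ), HasDerivAt (fun h : ℝ => u (z + h • y)) (dd y u (z + h • y)) h := by
    intro h
    have h1 : HasDerivAt (fun h : ℝ => z + h • y) y h := by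
      simpa using ((hasDerivAt_id h).smul_const y).const_add z
    exact (hu.diff (z + h • y)).hasFDerivAt.comp_hasDerivAt h h1
  rw [intervalIntegral.integral_eq_sub_of_hasDerivAt (fun h _ => hd h)]
  · simp
  · exact Continuous.intervalIntegrable ((hu.dd y).cont.comp (by fun_prop)) _ _
lemma diff_le (hu : CT u) (p : ℝ) (hp : 1 ≤ p) (y : En n) (hy : 0 ≤ y.1) (s r R : ℝ) (hR : r + ‖y‖ ≤ R) :
    II s r (fun z => |u (z + y) - u z| ^ p) ≤ II s R (fun z => |dd y u z| ^ p) := by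
  have : IsProbabilityMeasure (volume.restrict (Ioc (0:ℝ) 1)) := ⟨by simp⟩
  obtain ⟨m, M, hM⟩ := (hu.dd y).bdd
  have := mink (volume.restrict (Ioc (0:ℝ) 1)) p hp (fun θ z => dd y u (z + θ • y))
    (m.comp (by fun_prop)) M (fun θ z => hM _) s r (II s R (fun z => |dd y u z| ^ p)) (by
      refine (ae_restrict_mem measurableSet_Ioc).mono fun θ hθ => ?_
      refine II_shift (f := fun z => |dd y u z| ^ p) ((hu.dd y).bdd.rpow p hp) (fun z => by positivity) (θ • y) ?_ ?_
      · simpa using mul_nonneg hθ.1.le hy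
      · rw [norm_smul, Real.norm_of_nonneg hθ.1.le]
        have := mlr hθ.2 (norm_nonneg y)
        linarith)
  simp only [diff_eq hu, intervalIntegral.integral_of_le zero_le_one]
  exact this
abbrev Yn (n : ℕ) := ℝ × (Fin n → ℝ)
def io (n : ℕ) : Yn n →ₗ[ℝ] En n where
  toFun y := (y.1, Fin.cons 0 y.2)
  map_add' x y := by
    ext j
    · simp
    · refine Fin.cases ?_ (fun i => ?_) j <;> simp
  map_smul' c y := by
    ext j
    · simp
    · refine Fin.cases ?_ (fun i => ?_) j <;> simp
noncomputable def iota (n : ℕ) : Yn n →L[ℝ] En n := (io n).toContinuousLinearMap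
lemma iota_fst (y : Yn n) : (iota n y).1 = y.1 := rfl
lemma iota_zero (y : Yn n) : (iota n y).2 0 = 0 := rfl
lemma iota_succ (y : Yn n) (l : Fin n) : (iota n y).2 l.succ = y.2 l := rfl
lemma iota_norm (y : Yn n) : ‖iota n y‖ = ‖y‖ := by
  rw [Prod.norm_def, Prod.norm_def, iota_fst]
  congr 1
  refine le_antisymm ((pi_norm_le_iff_of_nonneg (norm_nonneg _)).2 fun j => ?_)
    ((pi_norm_le_iff_of_nonneg (norm_nonneg _)).2 fun l => ?_)
  · refine Fin.cases ?_ (fun i => ?_) j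
    · rw [iota_zero]; simp
    · rw [iota_succ]; exact norm_le_pi_norm y.2 i
  · rw [← iota_succ]; exact norm_le_pi_norm (iota n y).2 l.succ
def PS (ψ : Yn n → ℝ) : Prop := ContDiff ℝ ∞ ψ ∧ tsupport ψ ⊆ {y | 0 ≤ y.1 ∧ ‖y‖ ≤ 1 / 8}
lemma PS.cs {ψ : Yn n → ℝ} (h : PS ψ) : HasCompactSupport ψ :=
  (isCompact_closedBall (0 : Yn n) (1/8)).of_isClosed_subset (isClosed_tsupport _)
    fun y hy => by simpa using (h.2 hy).2
lemma PS.dv {ψ : Yn n → ℝ} (h : PS ψ) (e : Yn n) : PS (fun y => -fderiv ℝ ψ y e) := by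
  refine ⟨((h.1.fderiv_right (m := ∞) (by simp)).clm_apply contDiff_const).neg, ?_⟩
  refine subset_trans ?_ h.2
  refine subset_trans (closure_mono ?_) (tsupport_fderiv_subset ℝ (f := ψ))
  intro y hy hc
  exact hy (by simp [hc])
noncomputable def Tm (ψ : Yn n → ℝ) (u : Fu n) : En n → ℝ := fun z => ∫ y, ψ y * u (z + iota n y)
lemma Tm_integ {ψ : Yn n → ℝ} (h : PS ψ) (hf : Bdd f) (z) : Integrable fun y => ψ y * f (z + iota n y) := by
  obtain ⟨m, M, hM⟩ := hf
  refine (h.1.continuous.integrable_of_hasCompactSupport h.cs).mul_bdd (c := M) ?_ ?_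
  · exact (m.comp (by fun_prop : Measurable fun y => z + iota n y)).aestronglyMeasurable
  · exact evf fun y => by simpa using hM _
lemma Tm_CT {ψ : Yn n → ℝ} (h : PS ψ) (hu : CT u) : CT (Tm ψ u) := by
  constructor
  · rw [← contDiffOn_univ]
    intro z _
    have := contDiffOn_convolution_right_with_param (n := ⊤) (μ := volume) (f := ψ) (ContinuousLinearMap.mul ℝ ℝ)
      (g := fun (p : En n) (x : Yn n) => u (p - iota n x)) (s := ball z 1) (k := iota n ⁻¹' ((fun q : En n × En n => q.1 - q.2) '' (closedBall z 1 ×ˢ tsupport u)))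
      Metric.isOpen_ball ?_ ?_ ?_ ?_
    · have h2 : ContDiffOn ℝ ∞ (fun p : En n => (p, (0 : Yn n))) (ball z 1) := by fun_prop
      have h3 := this.comp h2 (fun p hp => ⟨hp, trivial⟩)
      have : ContDiffAt ℝ ∞ (Tm ψ u) z := by
        refine (h3.contDiffAt (ball_mem_nhds z one_pos)).congr_of_eventuallyEq (evf fun p => ?_)
        simp [Tm, convolution]
      exact this.contDiffWithinAt
    · have hc : IsCompact ((fun q : En n × En n => q.1 - q.2) '' (closedBall z 1 ×ˢ tsupport u)) :=
        ((isCompact_closedBall z 1).prod hu.2).image (by fun_prop)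
      refine Metric.isCompact_of_isClosed_isBounded (hc.isClosed.preimage (iota n).continuous) ?_
      obtain ⟨C, hC⟩ := hc.isBounded.exists_norm_le
      refine isBounded_iff_forall_norm_le.2 ⟨C, fun x hx => ?_⟩
      rw [← iota_norm]; exact hC _ hx
    · intro p x hp hx
      by_contra hne
      exact hx ⟨(p, p - iota n x), ⟨Metric.ball_subset_closedBall hp, subset_tsupport _ hne⟩, by simp⟩
    · exact (h.1.continuous.integrable_of_hasCompactSupport h.cs).locallyIntegrable
    · have := hu.1
      exact ContDiff.contDiffOn (by
        show ContDiff ℝ ∞ (fun q : En n × Yn n => u (q.1 - iota n q.2))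
        fun_prop)
  · have hc : IsCompact ((fun q : En n × Yn n => q.1 - iota n q.2) '' (tsupport u ×ˢ tsupport ψ)) :=
      (IsCompact.prod hu.2 h.cs).image (by fun_prop)
    refine HasCompactSupport.intro hc fun z hz => ?_
    simp only [Tm]
    rw [integral_eq_zero_of_ae]
    refine evf fun y => ?_
    by_contra hne
    simp only [Pi.zero_apply, mul_eq_zero, not_or] at hne
    exact hz ⟨(z + iota n y, y), ⟨subset_tsupport _ hne.2, subset_tsupport _ hne.1⟩, by simp⟩
lemma Tm_dd {ψ : Yn n → ℝ} (h : PS ψ) (hu : CT u) (e : En n) : dd e (Tm ψ u) = Tm ψ (dd e u) := by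
  funext z
  obtain ⟨m, N, hN⟩ := (hu.dd e).bdd
  have iψ := h.1.continuous.integrable_of_hasCompactSupport (μ := volume) h.cs
  have h1 : HasDerivAt (fun h : ℝ => Tm ψ u (z + h • e)) (dd e (Tm ψ u) z) 0 := by
    have h1 : HasDerivAt (fun h : ℝ => z + h • e) e 0 := by
      simpa using ((hasDerivAt_id (0:ℝ)).smul_const e).const_add z
    have h2 := ((Tm_CT h hu).diff (z + (0:ℝ) • e)).hasFDerivAt.comp_hasDerivAt 0 h1
    simpa [dd] using! h2
  have := hasDerivAt_integral_of_dominated_loc_of_deriv_le (μ := (volume : Measure (Yn n))) (𝕜 := ℝ)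
    (F := fun h y => ψ y * u (z + h • e + iota n y)) (F' := fun h y => ψ y * dd e u (z + h • e + iota n y)) (x₀ := 0)
    (s := ball 0 1) (bound := fun y => |ψ y| * N)
    (ball_mem_nhds _ one_pos)
    (evf fun k => (Tm_integ h hu.bdd _).aestronglyMeasurable)
    (Tm_integ h hu.bdd _) ((Tm_integ h (hu.dd e).bdd _).aestronglyMeasurable) ?_ (iψ.abs.mul_const N) ?_
  · have h2 := h1.unique this.2
    simpa [Tm] using h2
  · refine evf fun y k _ => ?_
    rw [norm_mul]
    exact mll (hN _) (abs_nonneg _)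
  · refine evf fun y k _ => ?_
    have h1 : HasDerivAt (fun h : ℝ => z + h • e + iota n y) e k := by
      simpa using (((hasDerivAt_id k).smul_const e).const_add z).add_const (iota n y)
    exact ((hu.diff (z + k • e + iota n y)).hasFDerivAt.comp_hasDerivAt k h1).const_mul _
lemma Tm_dv {ψ : Yn n → ℝ} (h : PS ψ) (hu : CT u) (e : Yn n) :
    dd (iota n e) (Tm ψ u) = Tm (fun y => -fderiv ℝ ψ y e) u := by
  rw [Tm_dd h hu]
  funext z
  have hd : ∀ y, HasFDerivAt (fun y => u (z + iota n y)) ((fderiv ℝ u (z + iota n y)).comp (iota n)) y := fun y =>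
    ((hu.diff _).hasFDerivAt).comp y ((iota n).hasFDerivAt.const_add z)
  have e1 : ∀ y, fderiv ℝ (fun y => u (z + iota n y)) y e = dd (iota n e) u (z + iota n y) := fun y => by
    rw [(hd y).fderiv]; rfl
  have := integral_mul_fderiv_eq_neg_fderiv_mul_of_integrable (μ := (volume : Measure (Yn n))) (𝕜 := ℝ) (f := ψ)
    (g := fun y => u (z + iota n y)) (v := e) ?_ ?_ (Tm_integ h hu.bdd z)
    (fun x _ => h.1.differentiable (by simp) x) (fun x _ => (hd x).differentiableAt)
  · simp only [e1] at this
    simp only [Tm, this, neg_mul, integral_neg]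
  · simpa using (Tm_integ (h.dv e) hu.bdd z).neg
  · simp only [e1]; exact Tm_integ h (hu.dd _).bdd z
lemma Tm_Lt (hc : Co ν β A) {ψ : Yn n → ℝ} (h : PS ψ) (hu : CT u) :
    Lt β A (Tm ψ u) = Tm ψ (Lt β A u) := by
  funext z
  have e2 : ∀ j k, dx j (dx k (Tm ψ u)) z = Tm ψ (dx j (dx k u)) z := fun j k => by
    rw [Tm_dd h hu, Tm_dd h (hu.dd _)]
  have e3 : Tm ψ (Lt β A u) z = ∫ y, ψ y * (β (z + iota n y) * dd et u (z + iota n y) +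
      ∑ j, ∑ k, A j k (z + iota n y) * dx j (dx k u) (z + iota n y)) := rfl
  rw [e3]
  simp only [Lt, e2]
  rw [Tm_dd h hu]
  have hi := fun y => hc.iβ z (iota n y) (iota_zero y)
  have hiA := fun j k y => hc.iA j k z (iota n y) (iota_zero y)
  simp only [Tm, hi, hiA, mul_add, mul_sum]
  have i1 := (Tm_integ h (hu.dd et).bdd z).const_mul (β z)
  have i2 := fun j k => (Tm_integ h (hu.d2 (ex j) (ex k)) z).const_mul (A j k z)
  have r1 : ∀ y, ψ y * (β z * dd et u (z + iota n y)) = β z * (ψ y * dd et u (z + iota n y)) := fun y => by ring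
  have r2 : ∀ j k y, ψ y * (A j k z * dx j (dx k u) (z + iota n y)) =
    A j k z * (ψ y * dx j (dx k u) (z + iota n y)) := fun j k y => by ring
  simp only [r1, r2]
  rw [integral_add i1 (integrable_finsetSum _ fun j _ => integrable_finsetSum _ fun k _ => i2 j k),
    integral_finsetSum _ fun j _ => integrable_finsetSum _ fun k _ => i2 j k, integral_const_mul]
  congr 1
  refine sum_congr rfl fun j _ => ?_
  rw [integral_finsetSum _ fun k _ => i2 j k]
  exact sum_congr rfl fun k _ => (integral_const_mul _ _).symm
end moll
section moll2
lemma mink2 {Y : Type*} [MeasurableSpace Y] (μ : Measure Y) [IsProbabilityMeasure μ]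
    (F : Y → Fu n) (hm : Measurable (Function.uncurry F)) (M : ℝ) (hM : ∀ y z, |F y z| ≤ M) (s r B : ℝ)
    (h : ∀ᵐ y ∂μ, II s r (fun z => F y z ^ 2) ≤ B) : II s r (fun z => (∫ y, F y z ∂μ) ^ 2) ≤ B := by
  have := mink μ 2 one_le_two F hm M hM s r B
  simp only [Real.rpow_two, sq_abs] at this
  exact this h
lemma Tm_L2 {ψ : Yn n → ℝ} (h : PS ψ) : ∃ C, 0 ≤ C ∧ ∀ s r R (f : Fu n), Bdd f → r + 1 / 8 ≤ R →
    II s r (fun z => Tm ψ f z ^ 2) ≤ C * II s R (fun z => f z ^ 2) := by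
  obtain ⟨M, hM⟩ := h.cs.exists_bound_of_continuous h.1.continuous
  let K := closedBall (0 : Yn n) (1/8)
  have hK0 : volume K ≠ 0 := (Metric.measure_closedBall_pos _ _ (by norm_num)).ne'
  have hK1 : volume K ≠ ⊤ := measure_closedBall_lt_top.ne
  let V := (volume K).toReal
  have V0 : 0 < V := ENNReal.toReal_pos hK0 hK1
  have M0 : 0 ≤ M := (norm_nonneg _).trans (hM 0)
  let μ : Measure (Yn n) := ProbabilityTheory.cond volume K
  have hμ : IsProbabilityMeasure μ := ProbabilityTheory.cond_isProbabilityMeasure_of_finite hK0 hK1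
  refine ⟨(V * M) ^ 2, by positivity, fun s r R f hf hR => ?_⟩
  obtain ⟨m, N, hN⟩ := id hf
  have e : ∀ z, Tm ψ f z = ∫ y, (V * ψ y) * f (z + iota n y) ∂μ := by
    intro z
    simp only [μ, ProbabilityTheory.cond, integral_smul_measure, mul_assoc, integral_const_mul, smul_eq_mul, ENNReal.toReal_inv]
    have hv : V * (volume K).toReal⁻¹ = 1 := mul_inv_cancel₀ V0.ne'
    rw [← mul_assoc, hv, one_mul, setIntegral_eq_integral_of_forall_compl_eq_zero]
    · rfl
    · intro y hy
      have : ψ y = 0 := image_eq_zero_of_notMem_tsupport fun hc => hy (by simpa [K] using (h.2 hc).2)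
      simp [this]
  simp only [e]
  have hb : ∀ y, |V * ψ y| ≤ V * M := fun y => by
    rw [abs_mul, abs_of_pos V0]; exact mll (hM y) V0.le
  refine mink2 μ (fun y z => (V * ψ y) * f (z + iota n y)) ?_ ((V * M) * N) ?_ s r _ (evf fun y => ?_)
  · exact ((h.1.continuous.measurable.comp measurable_fst).const_mul V).mul (m.comp (by fun_prop))
  · intro y z
    rw [abs_mul]
    exact mul_le_mul (hb y) (hN _) (abs_nonneg _) (by positivity)
  · simp only [mul_pow _ (f _)]
    rw [II_cmul]
    have n0 : 0 ≤ II s R (fun z => f z ^ 2) := II_nonneg fun z => sq_nonneg _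
    by_cases hy : ψ y = 0
    · simp only [hy]; simp; positivity
    · have hy' := h.2 (subset_tsupport _ hy)
      have := II_shift (s := s) (r := r) (R := R) (hf.pow 2) (fun z => sq_nonneg (f z)) (iota n y) hy'.1 (by rw [iota_norm]; linarith [hy'.2])
      refine mul_le_mul ?_ this (II_nonneg fun z => sq_nonneg _) (by positivity)
      exact sq_le_sq' (by linarith [(abs_le.1 (hb y)).1]) (abs_le.1 (hb y)).2
lemma Tg_iota {e : En n} (h : Tg e) : ∃ e' : Yn n, iota n e' = e := by
  rcases h with rfl | ⟨l, rfl⟩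
  · refine ⟨(1, 0), Prod.ext rfl (funext fun j => ?_)⟩
    refine Fin.cases rfl (fun i => ?_) j
    rw [iota_succ]; rfl
  · refine ⟨(0, Pi.single l 1), Prod.ext rfl (funext fun j => ?_)⟩
    refine Fin.cases ?_ (fun i => ?_) j
    · simp [iota_zero, ex]
    · rw [iota_succ]; simp [ex, Pi.single_apply]
lemma Tm_PN (l : List (En n)) (hl : ∀ e ∈ l, Tg e) {ψ : Yn n → ℝ} (h : PS ψ) : ∃ C, 0 ≤ C ∧
    ∀ β A, Co ν β A → ∀ s r R u, CT u → r + 1 / 8 ≤ R →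
    II s r (PN (LB β A) l (Tm ψ u)) ≤ C * II s R (fun z => Lt β A u z ^ 2) := by
  induction l generalizing ψ with
  | nil =>
    obtain ⟨C, hC, h1⟩ := Tm_L2 h
    refine ⟨C, hC, fun β A hc s r R u hu hR => ?_⟩
    have := h1 s r R _ (Lt_bdd hc hu) hR
    rw [← Tm_Lt hc h hu] at this
    exact this
  | cons e l ih =>
    obtain ⟨e', he'⟩ := Tg_iota (hl e (by simp))
    obtain ⟨C1, hC1, h1⟩ := ih (fun e he => hl e (by simp [he])) h
    obtain ⟨C2, hC2, h2⟩ := ih (fun e he => hl e (by simp [he])) (h.dv e')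
    refine ⟨C1 + C2, by positivity, fun β A hc s r R u hu hR => ?_⟩
    have a1 := h1 β A hc s r R u hu hR
    have a2 := h2 β A hc s r R u hu hR
    rw [← Tm_dv h hu, he'] at a2
    simp only [PN]
    rw [II_add (PN_bdd (LBb hc) l (Tm_CT h hu)) (PN_bdd (LBb hc) l ((Tm_CT h hu).dd e))]
    linarith
structure Mol {n : ℕ} (h : ℝ) (ψ : Yn n → ℝ) : Prop where
  ps : PS ψ
  nn : ∀ y, 0 ≤ ψ y
  one : ∫ y, ψ y = 1
  sup : ∀ y, ψ y ≠ 0 → 0 ≤ y.1 ∧ ‖y‖ ≤ h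
  ev : ∀ y : Yn n, ψ (y.1, -y.2) = ψ y
lemma Mol.exists (n : ℕ) (h : ℝ) (h0 : 0 < h) (h1 : h ≤ 1 / 8) : ∃ ψ : Yn n → ℝ, Mol h ψ := by
  let f : ContDiffBump (h / 2 : ℝ) := ⟨h / 8, h / 4, by linarith, by linarith⟩
  let g : ContDiffBump (0 : Fin n → ℝ) := ⟨h / 2, h, by linarith, by linarith⟩
  have hs : ∀ y : Yn n, f.normed volume y.1 * g.normed volume y.2 ≠ 0 → (0 ≤ y.1 ∧ ‖y‖ ≤ h) := by
    intro y hy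
    have a1 : y.1 ∈ Function.support (f.normed volume) := left_ne_zero_of_mul hy
    have a2 : y.2 ∈ Function.support (g.normed volume) := right_ne_zero_of_mul hy
    rw [ContDiffBump.support_normed_eq] at a1 a2
    simp only [mem_ball, dist_zero_right, dist_eq, f, g] at a1 a2
    have := abs_lt.1 a1
    refine ⟨by linarith, ?_⟩
    rw [Prod.norm_def]
    refine max_le ?_ a2.le
    rw [norm_eq_abs, abs_le]; constructor <;> linarith
  refine ⟨fun y => f.normed volume y.1 * g.normed volume y.2, ⟨?_, ?_⟩, ?_, ?_, hs, ?_⟩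
  · exact (f.contDiff_normed.comp contDiff_fst).mul (g.contDiff_normed.comp contDiff_snd)
  · refine closure_minimal (fun y hy => ⟨(hs y hy).1, (hs y hy).2.trans h1⟩) ?_
    exact (isClosed_le continuous_const continuous_fst).inter (isClosed_le continuous_norm continuous_const)
  · exact fun y => mul_nonneg (f.nonneg_normed _) (g.nonneg_normed _)
  · rw [volume_eq_prod, integral_prod_mul (f.normed volume) (g.normed volume), f.integral_normed, g.integral_normed, one_mul]
  · intro y; simp [g.normed_neg]
noncomputable def Mol.μ (ψ : Yn n → ℝ) : Measure (Yn n) := volume.withDensity fun y => ofReal (ψ y)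
variable {h : ℝ} {ψ : Yn n → ℝ}
lemma Mol.prob (H : Mol h ψ) : IsProbabilityMeasure (Mol.μ ψ) := ⟨by
  rw [Mol.μ, withDensity_apply _ MeasurableSet.univ, Measure.restrict_univ,
    ← ofReal_integral_eq_lintegral_ofReal (H.ps.1.continuous.integrable_of_hasCompactSupport H.ps.cs)
      (evf H.nn), H.one, ENNReal.ofReal_one]⟩
lemma Mol.int (H : Mol h ψ) (f : Yn n → ℝ) : ∫ y, f y ∂(Mol.μ ψ) = ∫ y, ψ y * f y := by
  rw [Mol.μ, integral_withDensity_eq_integral_toReal_smul (H.ps.1.continuous.measurable.ennreal_ofReal)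
    (evf fun y => ENNReal.ofReal_lt_top)]
  simp only [toReal_ofReal (H.nn _), smul_eq_mul]
lemma Mol.ae (H : Mol h ψ) : ∀ᵐ y ∂(Mol.μ ψ), 0 ≤ y.1 ∧ ‖y‖ ≤ h := by
  rw [Mol.μ, ae_withDensity_iff H.ps.1.continuous.measurable.ennreal_ofReal]
  refine evf fun y hy => H.sup y fun hc => hy (by simp [hc])
lemma Mol.contr (H : Mol h ψ) (hf : Bdd f) (hR : r + h ≤ R) :
    II s r (fun z => Tm ψ f z ^ 2) ≤ II s R (fun z => f z ^ 2) := by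
  have := H.prob
  obtain ⟨m, N, hN⟩ := id hf
  have e : ∀ z, Tm ψ f z = ∫ y, f (z + iota n y) ∂(Mol.μ ψ) := fun z => (H.int _).symm
  simp only [e]
  refine mink2 _ (fun y z => f (z + iota n y)) (m.comp (by fun_prop)) N (fun y z => hN _) s r _ ?_
  filter_upwards [H.ae] with y hy
  exact II_shift (hf.pow 2) (fun z => sq_nonneg _) _ hy.1 (by rw [iota_norm]; linarith [hy.2])
lemma diff2 (hu : CT u) (y : En n) (hy : y.1 = 0) (s r R : ℝ) (hR : r + 3 * ‖y‖ ≤ R) :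
    II s r (fun z => (u (z + y) + u (z - y) - 2 * u z) ^ 2) ≤ II s R (fun z => dd y (dd y u) z ^ 2) := by
  let F : En n → ℝ := fun z => u (z + y) - u z
  have hs : ∀ {v : Fu n}, CT v → CT (fun z => v (z + y)) := fun hv =>
    ⟨hv.1.comp (by fun_prop), hv.2.comp_homeomorph (Homeomorph.addRight y)⟩
  have hF : CT F := (hs hu).sub hu
  have hdF : dd y F = fun z => dd y u (z + y) - dd y u z := by
    simp only [F]
    rw [dd_sub (hs hu) hu]
    funext z
    simp only [dd, fderiv_comp_add_right]
  have a0 := II_shift (s := s) (r := r) (R := r + ‖y‖) (f := fun z => (F (z + y) - F z) ^ 2) (((hF.bdd.shift y).sub hF.bdd).pow 2)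
    (fun z => sq_nonneg _) (-y) (by simp [hy]) (by simp)
  have a1 := diff_le hF 2 one_le_two y hy.ge s (r + ‖y‖) (r + 2 * ‖y‖) (by linarith)
  have a2 := diff_le (hu.dd y) 2 one_le_two y hy.ge s (r + 2 * ‖y‖) R (by linarith)
  simp only [Real.rpow_two, sq_abs, hdF] at a1 a2
  refine le_trans (le_of_eq ?_) (a0.trans (a1.trans a2))
  congr 1; funext z
  simp only [F, neg_add_cancel_right, sub_eq_add_neg]; ring
lemma dd_smul (c : ℝ) (e : En n) (u : Fu n) : dd (c • e) u = fun z => c * dd e u z := by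
  funext z; simp [dd]
lemma dd_sum {ι : Type*} (S : Finset ι) (e : ι → En n) (u : Fu n) : dd (∑ i ∈ S, e i) u = fun z => ∑ i ∈ S, dd (e i) u z := by
  funext z; simp [dd]
lemma dd_cmul (c : ℝ) (e : En n) (hu : CT u) : dd e (fun z => c * u z) = fun z => c * dd e u z := by
  funext z; simp only [dd]; rw [fderiv_const_mul (hu.diff z)]; simp
lemma dd2_le (hu : CT u) (y : Fin n → ℝ) (z) :
    dd (iota n (0, y)) (dd (iota n (0, y)) u) z ^ 2 ≤ n * n * (‖y‖ ^ 2) ^ 2 * D2' u z := by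
  have e1 : iota n (0, y) = ∑ l, y l • ex l.succ := by
    refine Prod.ext ?_ (funext fun j => ?_)
    · rw [iota_fst]; simp [ex, Prod.fst_sum]
    · rw [Prod.snd_sum, Finset.sum_apply]
      refine Fin.cases ?_ (fun i => ?_) j
      · rw [iota_zero]; simp [ex]
      · rw [iota_succ]; simp [ex, Pi.single_apply]
  have e2 : dd (iota n (0, y)) u = fun z => ∑ l, y l * dx l.succ u z := by
    rw [e1, dd_sum]; funext z; simp only [dd_smul]
  have e3 : dd (iota n (0, y)) (dd (iota n (0, y)) u) z = ∑ l, ∑ k, (y l * y k) * dx k.succ (dx l.succ u) z := by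
    have c := fun l : Fin n => (hu.dd (ex l.succ))
    have h1 : ∀ e : En n, dd e (dd (iota n (0, y)) u) z = ∑ l, y l * dd e (dx l.succ u) z := by
      intro e
      rw [e2]
      show fderiv ℝ (fun z => ∑ l, y l * dx l.succ u z) z e = _
      rw [fderiv_fun_sum fun l _ => ((c l).const_mul (y l)).diff z, sum_apply]
      exact sum_congr rfl fun l _ => congrFun (dd_cmul (y l) e (c l)) z
    rw [h1]
    refine sum_congr rfl fun l _ => ?_
    rw [e1, dd_sum]
    simp only [dd_smul, mul_sum, mul_assoc]
  rw [e3]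
  refine (sq_sum2 _ _ (‖y‖ ^ 2) ?_).trans ?_
  · intro l k
    rw [abs_mul, pow_two]
    exact mul_le_mul (norm_le_pi_norm y l) (norm_le_pi_norm y k) (abs_nonneg _) (norm_nonneg _)
  · simp only [Fintype.card_fin]
    refine mll ?_ (by positivity)
    refine sum_le_sum fun l _ => ?_
    rw [D1, Fin.sum_univ_succ]
    exact le_add_of_nonneg_left (sq_nonneg _)
noncomputable def gg (w : Fu n) : En n → ℝ := fun z => dd et w z ^ 2 + D2' w z
lemma gg_nonneg (w : Fu n) (z) : 0 ≤ gg w z := add_nonneg (sq_nonneg _) (D2'_nonneg _ _)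
lemma gg_bdd (hw : CT w) : Bdd (gg w) := ((hw.dd et).bdd.pow 2).add (D2'_bdd hw)
lemma Mol.err (H : Mol h ψ) (h0 : 0 < h) (h1 : h ≤ 1 / 8) (hu : CT u) (hR : r + 1 / 2 ≤ R) :
    II s r (fun z => (u z - Tm ψ u z) ^ 2) ≤ (n * n + 2) * h ^ 2 * II s R (gg u) := by
  have := H.prob
  obtain ⟨m, N, hN⟩ := hu.bdd
  let F : Yn n → En n → ℝ := fun y z => u z - (u (z + iota n y) + u (z + iota n (y.1, -y.2))) / 2
  have e : ∀ z, u z - Tm ψ u z = ∫ y, F y z ∂(Mol.μ ψ) := by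
    intro z
    have e1 : Tm ψ u z = ∫ y, ψ y * u (z + iota n (y.1, -y.2)) := by
      have mp : MeasurePreserving (fun y : Yn n => (y.1, -y.2)) volume volume :=
        (MeasurePreserving.id (volume : Measure ℝ)).prod (Measure.measurePreserving_neg (volume : Measure (Fin n → ℝ)))
      have me : MeasurableEmbedding (fun y : Yn n => (y.1, -y.2)) :=
        (((MeasurableEquiv.refl ℝ).prodCongr (MeasurableEquiv.neg (Fin n → ℝ))).measurableEmbedding)
      have := mp.integral_comp me (fun y => ψ y * u (z + iota n y))
      simp only [H.ev] at this
      exact this.symm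
    have i1 := Tm_integ H.ps hu.bdd z
    have i2 : Integrable fun y : Yn n => ψ y * u (z + iota n (y.1, -y.2)) := by
      refine (H.ps.1.continuous.integrable_of_hasCompactSupport H.ps.cs).mul_bdd (c := N) ?_ ?_
      · exact (m.comp (by fun_prop : Measurable fun y : Yn n => z + iota n (y.1, -y.2))).aestronglyMeasurable
      · exact evf fun y => by simpa using hN _
    have i3 := (H.ps.1.continuous.integrable_of_hasCompactSupport (μ := volume) H.ps.cs).mul_const (u z)
    rw [H.int]
    have e2 : ∀ y, ψ y * F y z = ψ y * u z - (1/2 * (ψ y * u (z + iota n y)) + 1/2 * (ψ y * u (z + iota n (y.1, -y.2)))) := by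
      intro y; simp only [F]; ring
    simp only [e2]
    have i4 : Integrable fun y : Yn n => 1/2 * (ψ y * u (z + iota n y)) + 1/2 * (ψ y * u (z + iota n (y.1, -y.2))) :=
      (i1.const_mul _).add (i2.const_mul _)
    rw [integral_sub i3 i4, integral_add (i1.const_mul _) (i2.const_mul _),
      integral_const_mul, integral_const_mul, integral_mul_const, H.one, ← e1]
    have : ∫ y, ψ y * u (z + iota n y) = Tm ψ u z := rfl
    rw [this]; ring
  simp only [e]
  refine mink2 _ F ?_ (N + (N + N) / 2) ?_ s r _ ?_
  · have m1 : Measurable fun q : Yn n × En n => u q.2 := m.comp (by fun_prop)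
    have m2 : Measurable fun q : Yn n × En n => u (q.2 + iota n q.1) := m.comp (by fun_prop)
    have m3 : Measurable fun q : Yn n × En n => u (q.2 + iota n (q.1.1, -q.1.2)) := m.comp (by fun_prop)
    exact m1.sub ((m2.add m3).div_const 2)
  · intro y z
    have a1 := abs_le.1 (hN z)
    have a2 := abs_le.1 (hN (z + iota n y))
    have a3 := abs_le.1 (hN (z + iota n (y.1, -y.2)))
    simp only [F]
    rw [abs_le]; constructor <;> linarith
  · filter_upwards [H.ae] with y hy
    have hyn := hy.2
    rw [Prod.norm_def] at hyn
    have hy1 := (le_max_left _ _).trans hyn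
    have hy2 := (le_max_right _ _).trans hyn
    rw [norm_eq_abs] at hy1
    let Y := iota n (0, y.2)
    have hY : ‖Y‖ ≤ h := by simp only [Y]; rw [iota_norm, Prod.norm_def]; simpa using hy2
    have hT : ‖(y.1 • et : En n)‖ ≤ h := by
      simpa [norm_smul, et, Prod.norm_def] using hy1
    have d1 : iota n y = y.1 • et + Y := by
      refine Prod.ext ?_ (funext fun j => ?_)
      · simp [et, Y, iota_fst]
      · refine Fin.cases ?_ (fun i => ?_) j
        · simp [et, Y, iota_zero]
        · simp [et, Y, iota_succ]
    have d2 : iota n (y.1, -y.2) = y.1 • et - Y := by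
      refine Prod.ext ?_ (funext fun j => ?_)
      · simp [et, Y, iota_fst]
      · refine Fin.cases ?_ (fun i => ?_) j
        · simp [et, Y, iota_zero]
        · simp [et, Y, iota_succ]
    let S : En n → ℝ := fun z => (u (z + Y) + u (z - Y) - 2 * u z) ^ 2
    have bS : Bdd S := by
      simpa only [S, sub_eq_add_neg] using (((hu.bdd.shift Y).add (hu.bdd.shift (-Y))).sub ((Bdd.const 2).mul hu.bdd)).pow 2
    have bS' := bS.shift (y.1 • et)
    have bD : Bdd (fun z => (u (z + y.1 • et) - u z) ^ 2) := ((hu.bdd.shift _).sub hu.bdd).pow 2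
    have hFb : Bdd (fun z => F y z ^ 2) := by
      have : Bdd fun z => (u z - 1/2 * (u (z + iota n y) + u (z + iota n (y.1, -y.2)))) ^ 2 :=
        (hu.bdd.sub ((Bdd.const _).mul ((hu.bdd.shift _).add (hu.bdd.shift _)))).pow 2
      refine (iff_of_eq (congrArg Bdd (funext fun z => ?_))).2 this
      simp only [F]; ring
    have bsum : Bdd (fun z => S (z + y.1 • et) + 2 * (u (z + y.1 • et) - u z) ^ 2) := bS'.add ((Bdd.const 2).mul bD)
    have k1 : II s r (fun z => F y z ^ 2) ≤ II s r (fun z => S (z + y.1 • et) + 2 * (u (z + y.1 • et) - u z) ^ 2) := by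
      refine II_mono le_rfl hFb bsum (fun z => by simp only [S]; positivity) fun z => ?_
      simp only [F, S, d1, d2, ← add_assoc, ← add_sub_assoc]
      nlinarith [sq_nonneg ((u (z + y.1 • et + Y) + u (z + y.1 • et - Y) - 2 * u (z + y.1 • et)) / 2 - (u (z + y.1 • et) - u z)),
        sq_nonneg (u (z + y.1 • et + Y) + u (z + y.1 • et - Y) - 2 * u (z + y.1 • et))]
    rw [II_add bS' ((Bdd.const 2).mul bD), II_cmul] at k1
    have k2 := II_shift (s := s) (r := r) (R := r + h) bS (fun z => sq_nonneg _) (y.1 • et) (by simpa [et] using hy.1) (by linarith)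
    have k3 := diff2 hu Y rfl s (r + h) R (by linarith)
    have k4 : II s R (fun z => dd Y (dd Y u) z ^ 2) ≤ II s R (fun z => n * n * h ^ 2 * D2' u z) := by
      refine II_mono le_rfl ((hu.d2 Y Y).pow 2) ((Bdd.const _).mul (D2'_bdd hu)) (fun z => mul_nonneg (by positivity) (D2'_nonneg _ _)) fun z => ?_
      refine (dd2_le hu y.2 z).trans (mlr ?_ (D2'_nonneg _ _))
      refine mll ?_ (by positivity)
      rw [sq_le_sq₀ (by positivity) (by positivity)]
      nlinarith [norm_nonneg y.2]
    have k5 := diff_le hu 2 one_le_two (y.1 • et) (by simpa [et] using hy.1) s r R (by linarith)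
    simp only [Real.rpow_two, sq_abs, dd_smul, mul_pow] at k5
    rw [II_cmul] at k4 k5
    have k6 : y.1 ^ 2 ≤ h ^ 2 := sq_le_sq' (by linarith [(abs_le.1 hy1).1]) (abs_le.1 hy1).2
    have k7 : II s R (gg u) = II s R (fun z => dd et u z ^ 2) + II s R (D2' u) := II_add ((hu.dd et).bdd.pow 2) (D2'_bdd hu)
    have n1 : 0 ≤ II s R (fun z => dd et u z ^ 2) := II_nonneg fun z => sq_nonneg _
    have n2 : 0 ≤ II s R (D2' u) := II_nonneg fun z => D2'_nonneg _ _
    rw [k7]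
    have k8 := mlr k6 n1
    have k9 : (0:ℝ) ≤ n * n * h ^ 2 * II s R (fun z => dd et u z ^ 2) := by positivity
    have k10 : (0:ℝ) ≤ h ^ 2 * II s R (D2' u) := by positivity
    have k11 : II s (r + h) S = II s (r + h) fun z => (u (z + Y) + u (z - Y) - 2 * u z) ^ 2 := rfl
    linarith
end moll2
section key
lemma supA (n : ℕ) (ν : ℝ) (hν : 0 < ν) : ∃ C, 0 ≤ C ∧ ∀ β A, Co ν β A → ∀ s < 0, ∀ w : Fu n, CT w → ∀ z ∈ Hs n s ∩ ball 0 1,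
    w z ^ 2 ≤ C * II s (3/2) (fun z => PN (LB β A) (TL n) w z + w z ^ 2) := by
  obtain ⟨C, hC, h⟩ := (seed0 (n := n) hν).chain (TL n) TL_Tg 1 (3/2) one_pos (by norm_num)
  refine ⟨2 ^ (n+2) * C, by positivity, fun β A hc s hs w hw z hz => (sobolev hs hw z hz).trans ?_⟩
  rw [mul_assoc]
  exact mll (h β A hc s w hw) (by positivity)
lemma PN_dd (b : (Fu n) → Fu n) (l : List (En n)) (hw : CT w) (e : En n) :
    PN b l (dd e w) = PN (fun w => b (dd e w)) l w := by
  induction l generalizing w with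
  | nil => rfl
  | cons e' l ih => simp only [PN]; rw [ih hw, dd_comm hw, ih (hw.dd e')]
lemma supB (n : ℕ) (ν : ℝ) (hν : 0 < ν) : ∃ C, 0 ≤ C ∧ ∀ β A, Co ν β A → ∀ s < 0, ∀ w : Fu n, CT w → ∀ z ∈ Hs n s ∩ ball 0 1,
    ∀ k, dx k w z ^ 2 ≤ C * II s (3/2) (fun z => PN (LB β A) (TL n) w z + D1 w z) := by
  have := fun k => (seed1 (n := n) hν k).chain (TL n) TL_Tg 1 (3/2) one_pos (by norm_num)
  choose C hC h using this
  refine ⟨2 ^ (n+2) * ∑ k, C k, mul_nonneg (by positivity) (sum_nonneg fun k _ => hC k), fun β A hc s hs w hw z hz k => (sobolev hs (hw.dd (ex k)) z hz).trans ?_⟩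
  rw [mul_assoc, PN_dd _ _ hw]
  refine mll ((h k β A hc s w hw).trans (mlr ?_ ?_)) (by positivity)
  · exact single_le_sum (fun k _ => hC k) (mem_univ k)
  · exact II_nonneg fun z => add_nonneg (PN_nonneg LB0 _ _ _) (D1_nonneg _ _)
lemma D2'_le_D2 (hw : CT w) (z) : D2' w z ≤ D2 w z := by
  simp only [D2, D2', D1]
  rw [Finset.sum_comm (f := fun j k => dx j (dx k w) z ^ 2), Fin.sum_univ_succ (f := fun k => ∑ j, dx j (dx k w) z ^ 2)]
  exact le_add_of_nonneg_left (sum_nonneg fun _ _ => sq_nonneg _)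
lemma cacc12 (n : ℕ) (ν r R : ℝ) (hν : 0 < ν) (hr : 0 < r) (hR : r < R) : ∃ C, 0 ≤ C ∧
    ∀ (β : Fu n) (A : Fa n), Co ν β A → ∀ (s : ℝ) (w : Fu n), CT w →
    II s r (gg w) ≤ C * II s R (fun z => Lt β A w z ^ 2 + w z ^ 2) := by
  obtain ⟨C1, hC1, h1⟩ := cacc1 n ν ((r+R)/2) R hν (by linarith) (by linarith)
  obtain ⟨C2, hC2, h2⟩ := cacc2 n ν r ((r+R)/2) hν (by linarith) (by linarith)
  refine ⟨C2 * (1 + C1), by positivity, fun β A hc s w hw => ?_⟩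
  have bL := (Lt_bdd hc hw).pow 2
  have bw := hw.bdd.pow 2
  have a1 : II s ((r+R)/2) (D1 w) ≤ C1 * II s R (fun z => Lt β A w z ^ 2 + w z ^ 2) := h1 β A hc s w hw
  have a2 := h2 β A hc s w hw
  have a3 : II s r (gg w) ≤ II s r (fun z => dd et w z ^ 2 + D2 w z) :=
    II_mono le_rfl (gg_bdd hw) (((hw.dd et).bdd.pow 2).add (D2_bdd hw)) (fun z => add_nonneg (sq_nonneg _) (D2_nonneg _ _))
      fun z => add_le_add le_rfl (D2'_le_D2 hw z)
  rw [II_add bL (D1_bdd hw)] at a2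
  have a4 : II s ((r+R)/2) (fun z => Lt β A w z ^ 2) ≤ II s R (fun z => Lt β A w z ^ 2 + w z ^ 2) :=
    II_mono (by linarith) bL (bL.add bw) (fun z => by positivity) fun z => le_add_of_nonneg_right (sq_nonneg _)
  calc _ ≤ _ := a3.trans a2
    _ ≤ C2 * (II s R (fun z => Lt β A w z ^ 2 + w z ^ 2) + C1 * II s R (fun z => Lt β A w z ^ 2 + w z ^ 2)) := by gcongr
    _ = _ := by ring
lemma Lt_sub (hc : Co ν β A) (hu : CT u) (hv : CT v) (z) :
    Lt β A (fun z => u z - v z) z = Lt β A u z - Lt β A v z := by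
  simp only [Lt]
  have : ∀ j k, dx j (dx k fun z => u z - v z) z = dx j (dx k u) z - dx j (dx k v) z := by
    intro j k; rw [dd_sub hu hv, dd_sub (hu.dd _) (hv.dd _)]
  simp only [this]; rw [dd_sub hu hv]; simp only [mul_sub, Finset.sum_sub_distrib]; ring
lemma gg_sub (hu : CT u) (hv : CT v) (z) :
    gg u z ≤ 2 * gg v z + 2 * gg (fun z => u z - v z) z := by
  have q : ∀ a b : ℝ, a ^ 2 ≤ 2 * b ^ 2 + 2 * (a - b) ^ 2 := fun a b => by nlinarith [sq_nonneg (a - 2 * b)]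
  simp only [gg, D2', D1, dd_sub hu hv, dd_sub (hu.dd _) (hv.dd _)]
  have h1 := q (dd et u z) (dd et v z)
  have h2 : ∑ l : Fin n, ∑ k, dx k (dx l.succ u) z ^ 2 ≤ 2 * ∑ l : Fin n, ∑ k, dx k (dx l.succ v) z ^ 2 +
      2 * ∑ l : Fin n, ∑ k, (dx k (dx l.succ u) z - dx k (dx l.succ v) z) ^ 2 := by
    simp only [mul_sum, ← sum_add_distrib]
    exact sum_le_sum fun l _ => sum_le_sum fun k _ => q _ _
  linarith
lemma Tg_et : Tg (et : En n) := Or.inl rfl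
lemma Tg_ex (l : Fin n) : Tg (ex l.succ : En n) := Or.inr ⟨l, rfl⟩
lemma gg_sup (n : ℕ) (ν : ℝ) (hν : 0 < ν) : ∃ C, 0 ≤ C ∧ ∀ h ψ, h ≤ 1 / 8 → Mol h ψ → ∃ C', 0 ≤ C' ∧
    ∀ β A, Co ν β A → ∀ s < 0, ∀ u : Fu n, CT u → ∀ z ∈ Hs n s ∩ ball 0 1,
    gg (Tm ψ u) z ≤ C * II s 3 (gg u) + C' * II s 3 (fun z => Lt β A u z ^ 2) := by
  obtain ⟨CA, hCA, hA⟩ := supA n ν hν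
  obtain ⟨CB, hCB, hB⟩ := supB n ν hν
  refine ⟨CA + (n + 1) * CB, by positivity, fun h ψ hh H => ?_⟩
  obtain ⟨et', he'⟩ := Tg_iota (n := n) Tg_et
  choose e' he using fun l => Tg_iota (Tg_ex (n := n) l)
  obtain ⟨C0, hC0, h0⟩ := Tm_PN (ν := ν) (TL n) TL_Tg (H.ps.dv et')
  have hP := fun l => Tm_PN (ν := ν) (TL n) TL_Tg (H.ps.dv (e' l))
  choose Cl hCl hl using hP
  refine ⟨CA * C0 + ∑ l, (n + 1) * (CB * Cl l), by
    have := sum_nonneg fun l (_ : l ∈ Finset.univ) => (by have := hCl l; positivity : 0 ≤ ((n:ℝ) + 1) * (CB * Cl l))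
    positivity, fun β A hc s hs u hu z hz => ?_⟩
  have hv := Tm_CT H.ps hu
  set J := II s 3 (fun z => Lt β A u z ^ 2) with hJ
  have t1 : dd et (Tm ψ u) z ^ 2 ≤ CA * (C0 * J + II s 3 (fun z => dd et u z ^ 2)) := by
    refine (hA β A hc s hs _ (hv.dd et) z hz).trans (mll ?_ hCA)
    rw [II_add (PN_bdd (LBb hc) _ (hv.dd et)) ((hv.dd et).bdd.pow 2)]
    have a1 := h0 β A hc s (3/2) 3 u hu (by norm_num)
    have a2 := H.contr (s := s) (r := 3/2) (R := 3) (hu.dd et).bdd (by linarith)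
    rw [← Tm_dv H.ps hu, he'] at a1
    rw [← Tm_dd H.ps hu] at a2
    linarith
  have t2 : ∀ l k, dx k (dx l.succ (Tm ψ u)) z ^ 2 ≤ CB * (Cl l * J + II s 3 (D1 (dx l.succ u))) := by
    intro l k
    refine (hB β A hc s hs _ (hv.dd (ex l.succ)) z hz k).trans (mll ?_ hCB)
    rw [II_add (PN_bdd (LBb hc) _ (hv.dd _)) (D1_bdd (hv.dd _))]
    have a1 := hl l β A hc s (3/2) 3 u hu (by norm_num)
    rw [← Tm_dv H.ps hu, he] at a1
    have a2 : II s (3/2) (D1 (dx l.succ (Tm ψ u))) ≤ II s 3 (D1 (dx l.succ u)) := by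
      unfold D1
      rw [II_sum _ fun j => (((hv.dd _).dd _).bdd.pow 2), II_sum _ fun j => (((hu.dd _).dd _).bdd.pow 2)]
      refine sum_le_sum fun j _ => ?_
      have a3 := H.contr (s := s) (r := 3/2) (R := 3) (hu.d2 (ex j) (ex l.succ)) (by linarith)
      rwa [← Tm_dd H.ps (hu.dd _), ← Tm_dd H.ps hu] at a3
    linarith
  have t3 : D2' (Tm ψ u) z ≤ ∑ l, (n + 1) * (CB * (Cl l * J + II s 3 (D1 (dx l.succ u)))) := by
    refine sum_le_sum fun l _ => ?_
    refine (sum_le_sum fun k _ => t2 l k).trans (le_of_eq ?_)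
    simp
  have k7 : II s 3 (gg u) = II s 3 (fun z => dd et u z ^ 2) + ∑ l, II s 3 (D1 (dd (ex (Fin.succ l)) u)) := by
    rw [← II_sum _ fun l => D1_bdd (hu.dd _)]
    exact II_add ((hu.dd et).bdd.pow 2) (D2'_bdd hu)
  have n1 : 0 ≤ II s 3 (fun z => dd et u z ^ 2) := II_nonneg fun z => sq_nonneg _
  have n2 : 0 ≤ ∑ l, II s 3 (D1 (dd (ex (Fin.succ l)) u)) := sum_nonneg fun l _ => II_nonneg fun z => D1_nonneg _ _
  have e4 : ∑ l, ((n:ℝ) + 1) * (CB * (Cl l * J + II s 3 (D1 (dd (ex (Fin.succ l)) u)))) =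
    (∑ l, ((n:ℝ) + 1) * (CB * Cl l)) * J + (n + 1) * CB * ∑ l, II s 3 (D1 (dd (ex (Fin.succ l)) u)) := by
    rw [Finset.sum_mul, mul_sum, ← sum_add_distrib]
    exact sum_congr rfl fun l _ => by ring
  rw [e4] at t3
  rw [k7]
  simp only [gg]
  have p1 : 0 ≤ (n + 1) * CB * II s 3 (fun z => dd et u z ^ 2) := by positivity
  have p2 : 0 ≤ CA * ∑ l, II s 3 (D1 (dd (ex (Fin.succ l)) u)) := by positivity
  linarith
lemma key_unit (n : ℕ) (ν : ℝ) (hν : 0 < ν) : ∃ C, 0 ≤ C ∧ ∀ ε > 0, ∃ C', 0 ≤ C' ∧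
    ∀ β A, Co ν β A → ∀ s < 0, ∀ u : Fu n, CT u → ∀ Λ,
    C * II s 3 (gg u) + C' * II s 3 (fun z => Lt β A u z ^ 2) ≤ Λ →
    ∫ z in Hs n s ∩ ball 0 1 ∩ {z | 4 * Λ < gg u z}, gg u z ≤
      ε * II s 3 (gg u) + C * II s 3 (fun z => Lt β A u z ^ 2) := by
  obtain ⟨C1, hC1, h1⟩ := gg_sup n ν hν
  obtain ⟨C2, hC2, h2⟩ := cacc12 n ν 1 2 hν one_pos one_lt_two
  refine ⟨C1 + 16 * C2, by positivity, fun ε hε => ?_⟩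
  set c : ℝ := 4 * C2 * (n * n + 2) + 1 with hcdef
  have c1 : 1 ≤ c := by rw [hcdef]; have : 0 ≤ 4 * C2 * ((n:ℝ) * n + 2) := by positivity
                        linarith
  set h : ℝ := min (1/8) (ε / c) with hh
  have h0 : 0 < h := lt_min (by norm_num) (by positivity)
  have h18 : h ≤ 1 / 8 := min_le_left _ _
  have hε' : 4 * C2 * (n * n + 2) * h ^ 2 ≤ ε := by
    have : h ≤ ε / c := min_le_right _ _
    rw [le_div_iff₀ (by linarith)] at this
    have e2 : h ^ 2 ≤ h := by nlinarith
    have : 4 * C2 * (n * n + 2) * h ^ 2 ≤ 4 * C2 * (n * n + 2) * h := by gcongr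
    nlinarith
  obtain ⟨ψ, H⟩ := Mol.exists n h h0 h18
  obtain ⟨C', hC', h3⟩ := h1 h ψ h18 H
  refine ⟨C', hC', fun β A hc s hs u hu Λ hΛ => ?_⟩
  have hv := Tm_CT H.ps hu
  set v := Tm ψ u with hvd
  have hw := hu.sub hv
  set w := fun z => u z - v z with hwd
  set J := II s 3 (fun z => Lt β A u z ^ 2) with hJ
  have J0 : 0 ≤ J := II_nonneg fun z => sq_nonneg _
  have G0 : 0 ≤ II s 3 (gg u) := II_nonneg fun z => gg_nonneg _ _
  have bg := gg_bdd hu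
  have bw := gg_bdd hw
  have mS : MeasurableSet (Hs n s ∩ ball 0 1 ∩ {z | 4 * Λ < gg u z}) :=
    ((Hs_meas s).inter measurableSet_ball).inter (measurableSet_lt measurable_const bg.1)
  have fS : volume (Hs n s ∩ ball 0 1 ∩ {z | 4 * Λ < gg u z}) ≠ ⊤ :=
    measure_ne_top_of_subset inter_subset_left (Hball_fin s 1)
  have bw4 : Bdd (fun z => 4 * gg w z) := (Bdd.const 4).mul bw
  have s1 : ∫ z in Hs n s ∩ ball 0 1 ∩ {z | 4 * Λ < gg u z}, gg u z ≤ 4 * II s 1 (gg w) := by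
    rw [← II_cmul]
    refine (setIntegral_mono_on (bg.integOn fS) (bw4.integOn fS) mS fun z hz => ?_).trans
      (setIntegral_mono_set (bw4.integOn (Hball_fin s 1)) (evf fun z => mul_nonneg (by norm_num) (gg_nonneg _ _))
        (LE.le.eventuallyLE inter_subset_left))
    have a1 := h3 β A hc s hs u hu z hz.1
    have a2 := gg_sub hu hv z
    have a3 : 4 * Λ < gg u z := hz.2
    have : 0 ≤ 16 * C2 * II s 3 (gg u) := by positivity
    linarith
  have s2 := h2 β A hc s w hw
  have bL := Lt_bdd hc hu
  have bLw := Lt_bdd hc hw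
  rw [II_add (bLw.pow 2) (hw.bdd.pow 2)] at s2
  have s3 := H.err (s := s) (r := 2) (R := 3) h0 h18 hu (by norm_num)
  have s4 : II s 2 (fun z => Lt β A w z ^ 2) ≤ 2 * J + 2 * J := by
    have bT : Bdd (Tm ψ (Lt β A u)) := by rw [← Tm_Lt hc H.ps hu]; exact Lt_bdd hc hv
    have b1 : Bdd (fun z => 2 * Lt β A u z ^ 2) := by fun_prop
    have b2 : Bdd (fun z => 2 * Tm ψ (Lt β A u) z ^ 2) := by fun_prop
    have a1 : II s 2 (fun z => Lt β A w z ^ 2) ≤ II s 2 (fun z => 2 * Lt β A u z ^ 2 + 2 * Tm ψ (Lt β A u) z ^ 2) := by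
      refine II_mono le_rfl (bLw.pow 2) (b1.add b2) (fun z => by positivity) fun z => ?_
      rw [Lt_sub hc hu hv, hvd, Tm_Lt hc H.ps hu]
      nlinarith [sq_nonneg (Lt β A u z + Tm ψ (Lt β A u) z)]
    rw [II_add b1 b2, II_cmul, II_cmul] at a1
    have a2 := H.contr (s := s) (r := 2) (R := 3) bL (by linarith)
    have a3 : II s 2 (fun z => Lt β A u z ^ 2) ≤ J := II_mono (by norm_num) (bL.pow 2) (bL.pow 2) (fun z => sq_nonneg _) fun z => le_rfl
    linarith
  have s5 : II s 1 (gg w) ≤ C2 * (4 * J + (n * n + 2) * h ^ 2 * II s 3 (gg u)) :=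
    s2.trans (mll (by linarith) hC2)
  have s6 := mlr hε' G0
  have s7 : 0 ≤ C1 * J := by positivity
  linarith
end key
section scale
def Qb (z : En n) (r : ℝ) : Set (En n) := ball z.1 (r ^ 2) ×ˢ ball z.2 r
lemma Qb_open (z : En n) (r : ℝ) : IsOpen (Qb z r) := Metric.isOpen_ball.prod Metric.isOpen_ball
lemma Qb_meas (z : En n) (r : ℝ) : MeasurableSet (Qb z r) := (Qb_open z r).measurableSet
lemma Qb_self (z : En n) (hr : 0 < r) : z ∈ Qb z r :=
  ⟨Metric.mem_ball_self (by positivity), Metric.mem_ball_self hr⟩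
lemma Qb_mono (z : En n) (h0 : 0 ≤ r) (h : r ≤ R) : Qb z r ⊆ Qb z R :=
  Set.prod_mono (ball_subset_ball (by gcongr)) (ball_subset_ball h)
lemma Qb_vol (z : En n) (hr : 0 < r) : volume (Qb z r) = ofReal (2 ^ (n+2) * r ^ (n+3)) := by
  rw [Qb, volume_eq_prod, Measure.prod_prod, Real.volume_ball, Real.volume_pi_ball _ hr, ← ofReal_mul (by positivity)]
  congr 1; simp; ring
lemma Qb_fin (z : En n) (s : ℝ) : volume (Hs n s ∩ Qb z r) ≠ ⊤ :=
  measure_ne_top_of_subset inter_subset_right ((Metric.isBounded_ball.prod Metric.isBounded_ball).measure_lt_top.ne)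
noncomputable def JJ (s : ℝ) (z : En n) (r : ℝ) (f : Fu n) : ℝ := ∫ y in Hs n s ∩ Qb z r, f y
noncomputable def Ph (z : En n) (r : ℝ) (y : En n) : En n := z + (r ^ 2 * y.1, r • y.2)
lemma Ph_map (z : En n) (hr : 0 < r) : Measure.map (Ph z r) volume = ofReal ((r ^ (n+3))⁻¹) • (volume : Measure (En n)) := by
  have e : Ph z r = (fun y => z + y) ∘ Prod.map (fun t : ℝ => r ^ 2 • t) (fun x : Ix n → ℝ => r • x) := by
    funext y; rfl
  have m1 : Measurable (fun t : ℝ => r ^ 2 • t) := measurable_const_smul _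
  have m2 : Measurable (fun x : Ix n → ℝ => r • x) := measurable_const_smul _
  rw [e, ← Measure.map_map (measurable_const_add z) (m1.prodMap m2), volume_eq_prod,
    ← Measure.map_prod_map _ _ m1 m2, Measure.map_addHaar_smul _ (by positivity), Measure.map_addHaar_smul _ hr.ne',
    Measure.prod_smul_left, Measure.prod_smul_right, ← volume_eq_prod, smul_smul, Measure.map_smul,
    map_add_left_eq_self, ← ofReal_mul (by positivity)]
  congr 2
  simp
  rw [abs_of_pos hr, ← mul_inv, ← pow_add, add_comm, add_assoc]
noncomputable def PhE (n : ℕ) (z : En n) {r : ℝ} (hr : 0 < r) : En n ≃ₜ En n where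
  toFun := Ph z r
  invFun y := ((r ^ 2)⁻¹ * (y.1 - z.1), r⁻¹ • (y.2 - z.2))
  left_inv y := by ext <;> simp [Ph] <;> field_simp
  right_inv y := by ext <;> simp [Ph] <;> field_simp <;> ring
  continuous_toFun := by unfold Ph; fun_prop
  continuous_invFun := by fun_prop
lemma Ph_int (z : En n) (hr : 0 < r) (f : Fu n) (S : Set (En n)) :
    ∫ y in Ph z r ⁻¹' S, f (Ph z r y) = (r ^ (n+3))⁻¹ * ∫ y in S, f y := by
  have : MeasurableEmbedding (Ph z r) := (PhE n z hr).measurableEmbedding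
  rw [← this.setIntegral_map, Ph_map z hr, Measure.restrict_smul, integral_smul_measure,
    toReal_ofReal (by positivity), smul_eq_mul]
lemma Ph_dd (z : En n) (hu : CT u) (e : En n) :
    dd e (fun y => u (Ph z r y)) = fun y => dd (r ^ 2 * e.1, r • e.2) u (Ph z r y) := by
  funext y
  let Φ : En n →L[ℝ] En n := ((r ^ 2) • ContinuousLinearMap.fst ℝ _ _).prod (r • ContinuousLinearMap.snd ℝ _ _)
  have h : HasFDerivAt (Ph z r) Φ y := Φ.hasFDerivAt.const_add z
  have := ((hu.diff (Ph z r y)).hasFDerivAt.comp y h).fderiv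
  simp only [dd]
  change fderiv ℝ (u ∘ Ph z r) y e = _
  rw [this]; rfl
lemma Ph_CT (z : En n) (hr : 0 < r) (hu : CT u) : CT (fun y => u (Ph z r y)) := by
  refine ⟨hu.1.comp ?_, hu.2.comp_homeomorph (PhE n z hr)⟩
  unfold Ph; fun_prop
lemma Ph_t (z : En n) (hu : CT u) :
    dd et (fun y => u (Ph z r y)) = fun y => r ^ 2 * dd et u (Ph z r y) := by
  rw [Ph_dd z hu]
  have : ((r ^ 2 * (et : En n).1, r • (et : En n).2) : En n) = r ^ 2 • et := by simp [et]
  rw [this, dd_smul]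
lemma Ph_x (z : En n) (hu : CT u) (j) :
    dx j (fun y => u (Ph z r y)) = fun y => r * dx j u (Ph z r y) := by
  rw [Ph_dd z hu]
  have : ((r ^ 2 * (ex j : En n).1, r • (ex j : En n).2) : En n) = r • ex j := by simp [ex]
  rw [this, dd_smul]
lemma Ph_xx (z : En n) (hr : 0 < r) (hu : CT u) (j k) (y) :
    dx j (dx k (fun y => u (Ph z r y))) y = r ^ 2 * dx j (dx k u) (Ph z r y) := by
  rw [Ph_x z hu, dd_cmul r _ (Ph_CT z hr (hu.dd _)), Ph_x z (hu.dd _)]; ring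
lemma Ph_gg (z : En n) (hr : 0 < r) (hu : CT u) (y) :
    gg (fun y => u (Ph z r y)) y = r ^ 4 * gg u (Ph z r y) := by
  simp only [gg, D2', D1, Ph_xx z hr hu]
  rw [Ph_t z hu]
  simp only [mul_pow, ← pow_mul, ← mul_sum]; ring
lemma Ph_Lt (z : En n) (hr : 0 < r) (hu : CT u) (y) :
    Lt (fun y => β (Ph z r y)) (fun j k y => A j k (Ph z r y)) (fun y => u (Ph z r y)) y = r ^ 2 * Lt β A u (Ph z r y) := by
  simp only [Lt, Ph_xx z hr hu]
  rw [Ph_t z hu, mul_add]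
  simp only [mul_sum]
  congr 1
  · ring
  · exact sum_congr rfl fun j _ => sum_congr rfl fun k _ => by ring
lemma Ph_Co (hc : Co ν β A) (z : En n) (r : ℝ) : Co ν (fun y => β (Ph z r y)) (fun j k y => A j k (Ph z r y)) := by
  have m : Measurable (Ph z r) := by
    have : Continuous (Ph z r) := by unfold Ph; fun_prop
    exact this.measurable
  have i : ∀ x y : En n, y.2 0 = 0 → Ph z r (x + y) = Ph z r x + (r ^ 2 * y.1, r • y.2) := by
    intro x y _; ext <;> simp [Ph] <;> ring
  exact ⟨hc.ν0, hc.mβ.comp m, fun j k => (hc.mA j k).comp m,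
    fun x y hy => by rw [i x y hy]; exact hc.iβ _ _ (by simp [hy]),
    fun j k x y hy => by rw [i x y hy]; exact hc.iA _ _ _ _ (by simp [hy]),
    fun _ => hc.βl _, fun _ => hc.βu _, fun _ => hc.A00 _, fun k _ hk => hc.A0k k _ hk, fun _ => hc.ell _, fun j k _ => hc.Au j k _⟩
lemma Ph_II (z : En n) (hr : 0 < r) (s ρ : ℝ) (hρ : 1 ≤ ρ) (hf : Bdd f) (h0 : ∀ y, 0 ≤ f y) :
    II ((s - z.1) / r ^ 2) ρ (fun y => f (Ph z r y)) ≤ (r ^ (n+3))⁻¹ * JJ s z (ρ * r) f := by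
  rw [JJ, ← Ph_int z hr, II]
  have mE : MeasurableEmbedding (Ph z r) := (PhE n z hr).measurableEmbedding
  have hb : Bdd (fun y => f (Ph z r y)) := ⟨hf.1.comp mE.measurable, hf.2.imp fun M h y => h _⟩
  have hfin : volume (Ph z r ⁻¹' (Hs n s ∩ Qb z (ρ * r))) ≠ ⊤ := by
    rw [← mE.map_apply, Ph_map z hr, Measure.smul_apply, smul_eq_mul]
    exact mul_ne_top ofReal_ne_top (Qb_fin z s)
  refine setIntegral_mono_set (hb.integOn hfin) (evf fun y => h0 _) (LE.le.eventuallyLE ?_)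
  rintro y ⟨h1, h2⟩
  rw [mem_ball_zero_iff, Prod.norm_def, max_lt_iff] at h2
  refine ⟨?_, ?_, ?_⟩
  · simp only [Hs, mem_ofPred_eq, Ph, Prod.fst_add] at h1 ⊢
    rw [div_lt_iff₀ (by positivity)] at h1; linarith
  · rw [mem_ball_iff_norm]
    simp only [Ph, Prod.fst_add, add_sub_cancel_left, norm_mul, norm_pow, norm_eq_abs, abs_of_pos hr, mul_pow]
    have : |y.1| < ρ ^ 2 := by have := h2.1; rw [norm_eq_abs] at this; nlinarith
    rw [mul_comm]; gcongr
  · rw [mem_ball_iff_norm]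
    simp only [Ph, Prod.snd_add, add_sub_cancel_left, norm_smul, norm_eq_abs, abs_of_pos hr]
    rw [mul_comm]; gcongr; exact h2.2
lemma Ph_pre (z : En n) (hr : 0 < r) (s : ℝ) :
    Ph z r ⁻¹' (Hs n s ∩ Qb z r) = Hs n ((s - z.1) / r ^ 2) ∩ ball 0 1 := by
  ext y
  have e1 : Ph z r y ∈ Hs n s ↔ y ∈ Hs n ((s - z.1) / r ^ 2) := by
    simp only [Hs, mem_ofPred_eq, Ph, Prod.fst_add]
    rw [div_lt_iff₀ (by positivity)]; constructor <;> intro h <;> linarith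
  have e2 : Ph z r y ∈ Qb z r ↔ y ∈ ball 0 1 := by
    rw [mem_ball_zero_iff, Prod.norm_def, max_lt_iff, Qb, Set.mem_prod, mem_ball_iff_norm, mem_ball_iff_norm]
    simp only [Ph, Prod.fst_add, Prod.snd_add, add_sub_cancel_left, norm_mul, norm_pow, norm_smul, norm_eq_abs, abs_of_pos hr]
    rw [mul_lt_iff_lt_one_right (by positivity), mul_lt_iff_lt_one_right hr]
  simp only [Set.mem_preimage, Set.mem_inter_iff, e1, e2]
lemma key_sc (n : ℕ) (ν : ℝ) (hν : 0 < ν) : ∃ C, 0 ≤ C ∧ ∀ ε > 0, ∃ C', 0 ≤ C' ∧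
    ∀ β A, Co ν β A → ∀ s, ∀ z ∈ Hs n s, ∀ r > 0, ∀ u : Fu n, CT u → ∀ Λ,
    C * JJ s z (3 * r) (gg u) + C' * JJ s z (3 * r) (fun z => Lt β A u z ^ 2) ≤ r ^ (n+3) * Λ →
    ∫ y in Hs n s ∩ Qb z r ∩ {y | 4 * Λ < gg u y}, gg u y ≤
      ε * JJ s z (3 * r) (gg u) + C * JJ s z (3 * r) (fun z => Lt β A u z ^ 2) := by
  obtain ⟨C, hC, h⟩ := key_unit n ν hν
  refine ⟨C, hC, fun ε hε => ?_⟩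
  obtain ⟨C', hC', h⟩ := h ε hε
  refine ⟨C', hC', fun β A hc s z hz r hr u hu Λ hΛ => ?_⟩
  have b1 := Ph_II z hr s 3 (by norm_num) (gg_bdd hu) (gg_nonneg u)
  have b2 := Ph_II z hr s 3 (by norm_num) ((Lt_bdd hc hu).pow 2) (fun _ => sq_nonneg _)
  have hs : (s - z.1) / r ^ 2 < 0 := div_neg_of_neg_of_pos (sub_neg.2 hz) (by positivity)
  have h := h _ _ (Ph_Co hc z r) _ hs _ (Ph_CT z hr hu) (r ^ 4 * Λ)
  have eg : gg (fun y => u (Ph z r y)) = fun y => r ^ 4 * gg u (Ph z r y) := funext (Ph_gg z hr hu)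
  simp only [eg, Ph_Lt z hr hu, mul_pow, ← pow_mul, II_cmul] at h
  norm_num at h
  rw [integral_const_mul] at h
  have hr3 : 0 < r ^ (n+3) := by positivity
  have hr4 : 0 < r ^ 4 := by positivity
  have e : Hs n ((s - z.1) / r ^ 2) ∩ ball 0 1 ∩ {y | 4 * (r ^ 4 * Λ) < r ^ 4 * gg u (Ph z r y)} =
      Ph z r ⁻¹' (Hs n s ∩ Qb z r ∩ {y | 4 * Λ < gg u y}) := by
    rw [Set.preimage_inter, Ph_pre z hr]
    congr 1; ext y
    simp only [mem_ofPred_eq, Set.mem_preimage]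
    rw [mul_left_comm, mul_lt_mul_iff_right₀ hr4]
  rw [e, Ph_int z hr] at h
  set X := JJ s z (3 * r) (gg u)
  set Y := JJ s z (3 * r) (fun z => Lt β A u z ^ 2)
  set X' := II ((s - z.1) / r ^ 2) 3 (fun y => gg u (Ph z r y))
  set Y' := II ((s - z.1) / r ^ 2) 3 (fun y => Lt β A u (Ph z r y) ^ 2)
  have h2 : C * X' + C' * Y' ≤ Λ := by
    calc _ ≤ C * ((r ^ (n+3))⁻¹ * X) + C' * ((r ^ (n+3))⁻¹ * Y) := by gcongr
      _ = (r ^ (n+3))⁻¹ * (C * X + C' * Y) := by ring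
      _ ≤ (r ^ (n+3))⁻¹ * (r ^ (n+3) * Λ) := by gcongr
      _ = Λ := by field_simp
  have h3 := h (by nlinarith)
  have h4 : (r ^ (n+3))⁻¹ * ∫ y in Hs n s ∩ Qb z r ∩ {y | 4 * Λ < gg u y}, gg u y ≤ ε * X' + C * Y' := by
    refine le_of_mul_le_mul_left (h3.trans_eq ?_) hr4; ring
  have h5 : (r ^ (n+3))⁻¹ * ∫ y in Hs n s ∩ Qb z r ∩ {y | 4 * Λ < gg u y}, gg u y ≤ (r ^ (n+3))⁻¹ * (ε * X + C * Y) :=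
    h4.trans (by calc _ ≤ ε * ((r ^ (n+3))⁻¹ * X) + C * ((r ^ (n+3))⁻¹ * Y) := by gcongr
                   _ = _ := by ring)
  exact le_of_mul_le_mul_left h5 (by positivity)
lemma cacc_sc (n : ℕ) (ν : ℝ) (hν : 0 < ν) : ∃ C, 0 ≤ C ∧
    ∀ (β : Fu n) A, Co ν β A → ∀ s, ∀ z, ∀ r > 0, ∀ u : Fu n, CT u →
    JJ s z r (gg u) ≤ C * JJ s z (2 * r) (fun z => Lt β A u z ^ 2 + (r ^ 4)⁻¹ * u z ^ 2) := by
  obtain ⟨C, hC, h⟩ := cacc12 n ν 1 2 hν one_pos one_lt_two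
  refine ⟨C, hC, fun β A hc s z r hr u hu => ?_⟩
  have b2 := Ph_II z hr s 2 (by norm_num) (((Lt_bdd hc hu).pow 2).add ((Bdd.const (r ^ 4)⁻¹).mul (hu.bdd.pow 2))) (fun _ => by positivity)
  have h := h _ _ (Ph_Co hc z r) ((s - z.1) / r ^ 2) _ (Ph_CT z hr hu)
  have hr4 : 0 < r ^ 4 := by positivity
  have e : ∀ y, (r ^ 2 * Lt β A u (Ph z r y)) ^ 2 + u (Ph z r y) ^ 2 = r ^ 4 * (Lt β A u (Ph z r y) ^ 2 + (r ^ 4)⁻¹ * u (Ph z r y) ^ 2) := by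
    intro y; field_simp
  have eg : gg (fun y => u (Ph z r y)) = fun y => r ^ 4 * gg u (Ph z r y) := funext (Ph_gg z hr hu)
  simp only [eg, Ph_Lt z hr hu, e, II_cmul] at h
  rw [mul_left_comm] at h
  have h4 := le_of_mul_le_mul_left h hr4
  rw [II, ← Ph_pre z hr, Ph_int z hr] at h4
  have h5 := h4.trans (mll b2 hC)
  rw [mul_left_comm] at h5
  exact le_of_mul_le_mul_left h5 (show 0 < (r ^ (n+3))⁻¹ by positivity)
end scale
section freeze
structure Ell {m : ℕ} (δ : ℝ) (M : Fin m → Fin m → ℝ) : Prop where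
  sym : ∀ j k, M j k = M k j
  lo : ∀ θ : Fin m → ℝ, δ * ∑ j, θ j ^ 2 ≤ ∑ j, ∑ k, M j k * θ j * θ k
  hi : ∀ θ : Fin m → ℝ, ∑ j, ∑ k, M j k * θ j * θ k ≤ δ⁻¹ * ∑ j, θ j ^ 2
lemma Ell.diag {m : ℕ} {M : Fin m → Fin m → ℝ} (h : Ell δ M) (j) : δ ≤ M j j ∧ M j j ≤ δ⁻¹ := by
  have h1 := h.lo (Pi.single j 1)
  have h2 := h.hi (Pi.single j 1)
  have e1 : ∑ i, (Pi.single j 1 : Fin m → ℝ) i ^ 2 = 1 := by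
    simp [Pi.single_apply, ite_pow]
  have e2 : ∑ i, ∑ k, M i k * (Pi.single j 1 : Fin m → ℝ) i * (Pi.single j 1 : Fin m → ℝ) k = M j j := by
    simp [Pi.single_apply]
  rw [e1, e2, mul_one] at h1 h2
  exact ⟨h1, h2⟩
lemma Ell.bd {m : ℕ} {M : Fin m → Fin m → ℝ} (hδ : 0 < δ) (h : Ell δ M) (j k) : |M j k| ≤ δ⁻¹ := by
  have dj := h.diag j
  have dk := h.diag k
  by_cases hjk : j = k
  · subst hjk; rw [abs_of_pos (by linarith)]; exact dj.2
  have key : ∀ c : ℝ, c ^ 2 = 1 → M j j + 2 * c * M j k + M k k ≤ δ⁻¹ * 2 := by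
    intro c hc
    have h2 := h.hi (Pi.single j 1 + Pi.single k c)
    have hkj : k ≠ j := fun h => hjk h.symm
    have e1 : ∑ i, (Pi.single j 1 + Pi.single k c : Fin m → ℝ) i ^ 2 = 2 := by
      have : ∀ i, (Pi.single j 1 + Pi.single k c : Fin m → ℝ) i ^ 2 = (if i = j then 1 else 0) + (if i = k then 1 else 0) := by
        intro i
        simp only [Pi.add_apply, Pi.single_apply]
        by_cases h1 : i = j
        · subst h1; simp [hjk]
        · by_cases h2 : i = k
          · subst h2; simp [h1, hc]
          · simp [h1, h2]
      simp only [this, sum_add_distrib]; simp; norm_num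
    have e2 : ∑ i, ∑ l, M i l * (Pi.single j 1 + Pi.single k c : Fin m → ℝ) i * (Pi.single j 1 + Pi.single k c : Fin m → ℝ) l = M j j + 2 * c * M j k + M k k := by
      simp only [Pi.add_apply, mul_add, add_mul, sum_add_distrib]
      simp [Pi.single_apply]
      rw [h.sym k j]; linear_combination M k k * hc
    rwa [e1, e2] at h2
  have h1 := key 1 (by norm_num)
  have h2 := key (-1) (by norm_num)
  rw [abs_le]; constructor <;> linarith
noncomputable def Afz (M : Ix n → Ix n → ℝ) (j k : Ix n) : ℝ :=
  if j = 0 then (if k = 0 then 1 else 0) else if k = 0 then 2 * M j 0 / M 0 0 else M j k / M 0 0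
lemma Afz_sum {M X : Ix n → Ix n → ℝ} (hM : ∀ j k, M j k = M k j) (hX : ∀ j k, X j k = X k j) (h0 : M 0 0 ≠ 0) :
    ∑ j, ∑ k, Afz M j k * X j k = (M 0 0)⁻¹ * ∑ j, ∑ k, M j k * X j k := by
  simp only [Fin.sum_univ_succ, Afz]
  simp only [if_true, Fin.succ_ne_zero, if_false, zero_mul, Finset.sum_const_zero, sum_add_distrib, mul_add, mul_sum]
  have e1 : ∀ i : Fin n, 2 * M i.succ 0 / M 0 0 * X i.succ 0 = (M 0 0)⁻¹ * (M 0 i.succ * X 0 i.succ) + (M 0 0)⁻¹ * (M i.succ 0 * X i.succ 0) := by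
    intro i; rw [hM 0 i.succ, hX 0 i.succ]; ring
  have e2 : ∀ i j : Fin n, M i.succ j.succ / M 0 0 * X i.succ j.succ = (M 0 0)⁻¹ * (M i.succ j.succ * X i.succ j.succ) := by
    intro i j; ring
  simp only [e1, e2, sum_add_distrib]
  field_simp
  ring
lemma Co_of {M : ℝ → Ix n → Ix n → ℝ} (hδ : 0 < δ) (hδ1 : δ < 1) (hm : ∀ j k, Measurable fun t => M t j k)
    (hM : ∀ t, Ell δ (M t)) :
    Co (δ ^ 2 / 2) (fun y : En n => (M (y.2 0) 0 0)⁻¹) (fun j k y => Afz (M (y.2 0)) j k) := by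
  have m0 : Measurable fun y : En n => y.2 0 := (measurable_pi_apply 0).comp measurable_snd
  have d0 := fun t => (hM t).diag 0
  have p0 : ∀ t, 0 < M t 0 0 := fun t => hδ.trans_le (d0 t).1
  have i1 : ∀ t, δ ≤ (M t 0 0)⁻¹ := fun t => by
    rw [le_inv_comm₀ hδ (p0 t)]; exact (d0 t).2
  have i2 : ∀ t, (M t 0 0)⁻¹ ≤ δ⁻¹ := fun t => inv_anti₀ hδ (d0 t).1
  have hi : (1:ℝ) ≤ δ⁻¹ := (one_le_inv₀ hδ).2 hδ1.le
  have ei : (δ ^ 2 / 2)⁻¹ = 2 * δ⁻¹ ^ 2 := by field_simp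
  refine ⟨by positivity, ((hm 0 0).comp m0).inv, fun j k => ?_, fun z y hy => by simp [hy], fun j k z y hy => by simp [hy],
    fun z => ?_, fun z => ?_, fun z => by simp [Afz], fun k z hk => by simp [Afz, hk], fun z θ => ?_, fun j k z => ?_⟩
  · unfold Afz
    split_ifs
    · exact measurable_const
    · exact measurable_const
    · exact (((hm j 0).comp m0).const_mul 2).div ((hm 0 0).comp m0)
    · exact ((hm j k).comp m0).div ((hm 0 0).comp m0)
  · exact le_trans (by nlinarith) (i1 _)
  · rw [ei]; exact (i2 _).trans (by nlinarith)
  · rw [Afz_sum (hM _).sym (fun j k => mul_comm _ _) (p0 _).ne']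
    have := (hM (z.2 0)).lo θ
    simp only [mul_assoc] at this
    have hs : 0 ≤ ∑ j, θ j ^ 2 := sum_nonneg fun _ _ => sq_nonneg _
    calc _ ≤ δ * (δ * ∑ j, θ j ^ 2) := by nlinarith [mul_nonneg (sq_nonneg δ) hs]
      _ ≤ _ := mul_le_mul (i1 _) this (by positivity) (inv_nonneg.2 (p0 _).le)
  · rw [ei]
    have b : ∀ j k, |M (z.2 0) j k / M (z.2 0) 0 0| ≤ δ⁻¹ ^ 2 := by
      intro j k; rw [div_eq_mul_inv, abs_mul, pow_two, abs_of_pos (inv_pos.2 (p0 _))]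
      exact mul_le_mul ((hM _).bd hδ j k) (i2 _) (inv_nonneg.2 (p0 _).le) (by positivity)
    unfold Afz
    split_ifs
    · rw [abs_one]; nlinarith
    · simp; positivity
    · rw [mul_div_assoc, abs_mul, abs_two]; linarith [b j 0]
    · exact (b j k).trans (by nlinarith [sq_nonneg δ⁻¹])
noncomputable def mp (a : Fm n) (u : Fu n) : En n → ℝ :=
  fun z => dd et u z + ∑ j, ∑ k, a z j k * dx j (dx k u) z
noncomputable def VV (w : Fu n) : En n → ℝ := fun z => dd et w z ^ 2 + D2 w z
lemma Lt_fz {M : ℝ → Ix n → Ix n → ℝ} (hδ : 0 < δ) (hM : ∀ t, Ell δ (M t))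
    (a : Fm n) (hu : CT u) (y) :
    Lt (fun y : En n => (M (y.2 0) 0 0)⁻¹) (fun j k y => Afz (M (y.2 0)) j k) u y ^ 2 ≤
      2 * δ⁻¹ ^ 2 * (mp a u y ^ 2 + (∑ j, ∑ k, (M (y.2 0) j k - a y j k) ^ 2) * VV u y) := by
  have d0 := (hM (y.2 0)).diag 0
  have p0 : 0 < M (y.2 0) 0 0 := hδ.trans_le d0.1
  have i2 : (M (y.2 0) 0 0)⁻¹ ≤ δ⁻¹ := inv_anti₀ hδ d0.1
  have e : Lt (fun y : En n => (M (y.2 0) 0 0)⁻¹) (fun j k y => Afz (M (y.2 0)) j k) u y =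
      (M (y.2 0) 0 0)⁻¹ * (mp a u y + ∑ j, ∑ k, (M (y.2 0) j k - a y j k) * dx j (dx k u) y) := by
    simp only [Lt, mp]
    rw [Afz_sum (X := fun j k => dx j (dx k u) y) (hM _).sym (fun j k => by rw [dd_comm hu]) p0.ne']
    simp only [sub_mul, Finset.sum_sub_distrib]; ring
  have cs : (∑ j, ∑ k, (M (y.2 0) j k - a y j k) * dx j (dx k u) y) ^ 2 ≤
      (∑ j, ∑ k, (M (y.2 0) j k - a y j k) ^ 2) * D2 u y := by
    simp only [D2, ← Finset.univ_product_univ, ← Finset.sum_product']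
    exact Finset.sum_mul_sq_le_sq_mul_sq _ _ _
  have hE : 0 ≤ ∑ j, ∑ k, (M (y.2 0) j k - a y j k) ^ 2 := by positivity
  have hD := D2_nonneg u y
  rw [e, mul_pow]
  set S := ∑ j, ∑ k, (M (y.2 0) j k - a y j k) * dx j (dx k u) y
  set E := ∑ j, ∑ k, (M (y.2 0) j k - a y j k) ^ 2
  have h1 : (mp a u y + S) ^ 2 ≤ 2 * (mp a u y ^ 2 + E * VV u y) := by
    have : E * D2 u y ≤ E * VV u y := by gcongr; unfold VV; linarith [sq_nonneg (dd et u y)]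
    nlinarith [sq_nonneg (mp a u y - S)]
  calc _ ≤ δ⁻¹ ^ 2 * (2 * (mp a u y ^ 2 + E * VV u y)) := by
        have : (M (y.2 0) 0 0)⁻¹ ^ 2 ≤ δ⁻¹ ^ 2 := by gcongr
        exact mul_le_mul this h1 (by positivity) (by positivity)
    _ = _ := by ring
end freeze
section freeze2
noncomputable def sg (q : ℝ × (ℝ × (Fin n → ℝ))) : En n := (q.2.1, Fin.cons q.1 q.2.2)
lemma sg_mp : MeasurePreserving (sg (n := n)) ∧ MeasurableEmbedding (sg (n := n)) := by
  let e := (MeasurableEquiv.piFinSuccAbove (fun _ : Ix n => ℝ) 0).symm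
  have he : MeasurePreserving e := (volume_preserving_piFinSuccAbove (fun _ : Ix n => ℝ) 0).symm
  have h0 : sg (n := n) = (Prod.map id e) ∘ MeasurableEquiv.prodAssoc ∘ (Prod.map Prod.swap id) ∘ MeasurableEquiv.prodAssoc.symm := by
    funext q
    simp only [sg, Function.comp_apply, MeasurableEquiv.prodAssoc, Equiv.prodAssoc, MeasurableEquiv.symm, Prod.map,
      e, MeasurableEquiv.piFinSuccAbove, Prod.swap, id]
    refine Prod.ext rfl ?_
    simp [MeasurableEquiv.coe_mk]; rfl
  have h1 : MeasurePreserving (sg (n := n)) := by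
    rw [h0]
    refine MeasurePreserving.comp (((MeasurePreserving.id volume).prod he)) ?_
    refine (measurePreserving_prodAssoc (volume : Measure ℝ) (volume : Measure ℝ) (volume : Measure (Fin n → ℝ))).comp ?_
    refine MeasurePreserving.comp ((Measure.measurePreserving_swap).prod (MeasurePreserving.id _)) ?_
    exact (measurePreserving_prodAssoc (volume : Measure ℝ) (volume : Measure ℝ) (volume : Measure (Fin n → ℝ))).symm _
  refine ⟨h1, ?_⟩
  refine MeasurableEmbedding.of_measurable_inverse (g := fun y : En n => (y.2 0, (y.1, fun j : Fin n => y.2 j.succ))) h1.measurable ?_ (by fun_prop) ?_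
  · have : Set.range (sg (n := n)) = Set.univ := by
      rw [Set.range_eq_univ]; intro y
      exact ⟨(y.2 0, (y.1, fun j => y.2 j.succ)), by simp only [sg]; exact Prod.ext rfl (Fin.cons_self_tail _)⟩
    rw [this]; exact MeasurableSet.univ
  · intro q; simp [sg]
lemma ballC_vol (r : ℝ) (x : Fin n → ℝ) : volume (ballC r x) = volume (ballC r (0 : Fin n → ℝ)) := by
  rw [← measure_preimage_add_right volume (-x) (ballC r 0)]
  congr 1; ext y; simp [ballC, sub_eq_add_neg]
lemma ballC_open (r : ℝ) (x : Fin n → ℝ) : IsOpen (ballC r x) := by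
  unfold ballC; exact isOpen_lt (by fun_prop) (by fun_prop)
lemma ballC_sub (hr : 0 < r) (x : Fin n → ℝ) : ballC r x ⊆ ball x r := by
  intro y hy
  rw [mem_ball, dist_pi_lt_iff hr]
  intro j
  have h1 : (y j - x j) ^ 2 ≤ ∑ j, (y j - x j) ^ 2 := single_le_sum (f := fun j => (y j - x j) ^ 2) (fun _ _ => sq_nonneg _) (mem_univ j)
  rw [dist_eq]
  exact abs_lt_of_sq_lt_sq (h1.trans_lt hy) hr.le
lemma ballC_real (hr : 0 < r) : 0 < volume.real (ballC r (0 : Fin n → ℝ)) ∧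
    volume.real (ballC r (0 : Fin n → ℝ)) ≤ (2 * r) ^ n ∧ volume (ballC r (0 : Fin n → ℝ)) ≠ ⊤ := by
  have h := measure_mono (μ := volume) (ballC_sub hr (0 : Fin n → ℝ))
  have hv := Real.volume_pi_ball (0 : Fin n → ℝ) hr
  have h3 : volume (ballC r (0 : Fin n → ℝ)) ≠ ⊤ := ne_top_of_le_ne_top (by rw [hv]; exact ofReal_ne_top) h
  refine ⟨ENNReal.toReal_pos ?_ h3, ?_, h3⟩
  · exact ((ballC_open r 0).measure_pos volume ⟨0, by simp [ballC]; positivity⟩).ne'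
  · refine (ENNReal.toReal_mono (by rw [hv]; exact ofReal_ne_top) h).trans ?_
    rw [hv, toReal_ofReal (by positivity)]; simp
lemma Gam_vol (r t : ℝ) (x : Fin n → ℝ) : volume (GammaC r t x) = ofReal (r ^ 2) * volume (ballC r (0 : Fin n → ℝ)) := by
  rw [GammaC, volume_eq_prod, Measure.prod_prod, ballC_vol, Real.volume_Ioo]; simp
lemma Gam_real (r t : ℝ) (x : Fin n → ℝ) : volume.real (GammaC r t x) = r ^ 2 * volume.real (ballC r (0 : Fin n → ℝ)) := by
  rw [measureReal_def, Gam_vol, ENNReal.toReal_mul, toReal_ofReal (by positivity), measureReal_def]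
lemma Gam_fin (hr : 0 < r) (t : ℝ) (x : Fin n → ℝ) : volume (GammaC r t x) ≠ ⊤ := by
  rw [Gam_vol]; exact mul_ne_top ofReal_ne_top (ballC_real hr).2.2
lemma msup_le {m : ℕ} {f : Fin m → Fin m → ℝ} {B : ℝ} (hB : 0 ≤ B) (h : ∀ j k, f j k ≤ B) : ⨆ j, ⨆ k, f j k ≤ B :=
  Real.iSup_le (fun j => Real.iSup_le (fun k => h j k) hB) hB
lemma le_msup {m : ℕ} (f : Fin m → Fin m → ℝ) (j k) : f j k ≤ ⨆ j, ⨆ k, f j k :=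
  (le_ciSup (Set.finite_range (f j)).bddAbove k).trans (le_ciSup (f := fun j => ⨆ k, f j k) (Set.finite_range _).bddAbove j)
lemma osc_le (hδ : 0 < δ) (hE : ∀ y, Ell δ (a y)) (hr : 0 < r) (t x) :
    oscA a r t x ≤ 4 * δ⁻¹ := by
  have b : ∀ (y y' : En n), ‖⨆ j, ⨆ k, |a y j k - a y' j k|‖ ≤ 2 * δ⁻¹ := by
    intro y y'
    rw [norm_eq_abs, abs_of_nonneg (iSup_nonneg fun _ => iSup_nonneg fun _ => abs_nonneg _)]
    refine msup_le (by positivity) fun j k => (abs_sub _ _).trans ?_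
    linarith [(hE y).bd hδ j k, (hE y').bd hδ j k]
  set G := GammaC r t (fun j : Fin n => x j.succ) with hG
  have fG : volume G < ⊤ := (Gam_fin hr _ _).lt_top
  have vG : volume.real G = r ^ 2 * volume.real (ballC r (0 : Fin n → ℝ)) := Gam_real _ _ _
  have h3 := norm_setIntegral_le_of_norm_le_const (μ := volume) (s := Ioo (x 0 - r) (x 0 + r)) (by simp)
    (fun τ _ => norm_setIntegral_le_of_norm_le_const fG (fun s₁ _ => norm_setIntegral_le_of_norm_le_const fG
      (fun s₂ _ => b (s₁.1, Fin.cons τ s₁.2) (s₂.1, Fin.cons τ s₂.2))))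
  rw [vG, Real.volume_real_Ioo_of_le (by linarith)] at h3
  obtain ⟨v0, -, -⟩ := ballC_real (n := n) hr
  unfold oscA
  rw [← hG, ← measureReal_def]
  set v := volume.real (ballC r (0 : Fin n → ℝ))
  calc _ ≤ (r ^ 5)⁻¹ * (v ^ 2)⁻¹ * (2 * δ⁻¹ * (r ^ 2 * v) * (r ^ 2 * v) * (x 0 + r - (x 0 - r))) := by
        gcongr; exact (le_abs_self _).trans h3
    _ = 4 * δ⁻¹ := by field_simp; ring
lemma osc_sharp (hδ : 0 < δ) (hE : ∀ y, Ell δ (a y)) (hr : 0 < r) (hR : r ≤ R) (z : En n) :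
    oscA a r z.1 z.2 ≤ aSharp a R := by
  have hb : ∀ z : En n, BddAbove (Set.range fun r : {r : ℝ // 0 < r ∧ r ≤ R} => oscA a r.val z.1 z.2) := fun z =>
    ⟨4 * δ⁻¹, by rintro _ ⟨r, rfl⟩; exact osc_le hδ hE r.2.1 _ _⟩
  refine (le_ciSup (hb z) ⟨r, hr, hR⟩).trans ?_
  unfold aSharp
  refine le_ciSup (f := fun z : En n => ⨆ r : {r : ℝ // 0 < r ∧ r ≤ R}, oscA a r.val z.1 z.2) ⟨4 * δ⁻¹, ?_⟩ z
  rintro _ ⟨z, rfl⟩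
  exact Real.iSup_le (fun r => osc_le hδ hE r.2.1 _ _) (by positivity)
lemma freeze (hδ : 0 < δ) (hm : ∀ j k, Measurable fun q => a q j k) (hE : ∀ y, Ell δ (a y))
    (hn : 1 ≤ n) (z : En n) (hr : 0 < r) {κ : ℝ} (hκ : oscA a ((n+1) * r) (z.1 - r ^ 2) z.2 ≤ κ) :
    ∃ M : ℝ → Ix n → Ix n → ℝ, (∀ j k, Measurable fun t => M t j k) ∧ (∀ t, Ell δ (M t)) ∧
      ∀ j k, ∫ y in Qb z r, |M (y.2 0) j k - a y j k| ≤ 2 ^ n * ((n+1) * r) ^ (n+3) * κ := by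
  set ρ : ℝ := (n+1) * r with hρd
  have hn1 : (1:ℝ) ≤ n := by exact_mod_cast hn
  have hρ : 0 < ρ := by positivity
  set G := GammaC ρ (z.1 - r ^ 2) (fun j : Fin n => z.2 j.succ) with hG
  set I := Ioo (z.2 0 - ρ) (z.2 0 + ρ) with hI
  have fG : volume G ≠ ⊤ := Gam_fin hρ _ _
  have mG : MeasurableSet G := measurableSet_Ioo.prod (ballC_open _ _).measurableSet
  obtain ⟨v0, v1, -⟩ := ballC_real (n := n) hρ
  have vG : volume.real G = ρ ^ 2 * volume.real (ballC ρ (0 : Fin n → ℝ)) := Gam_real _ _ _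
  set v := volume.real (ballC ρ (0 : Fin n → ℝ)) with hv
  have gp : 0 < volume.real G := by rw [vG]; positivity
  have : IsFiniteMeasure (volume.restrict G) := ⟨by rw [Measure.restrict_apply_univ]; exact fG.lt_top⟩
  have ms := (sg_mp (n := n)).1.measurable
  have ma : ∀ j k, Measurable fun q => a (sg q) j k := fun j k => (hm j k).comp ms
  have ia : ∀ τ j k, IntegrableOn (fun s => a (sg (τ, s)) j k) G := fun τ j k =>
    integrableOn_of_bounded (M := δ⁻¹) fG ((ma j k).comp measurable_prodMk_left).aestronglyMeasurable
      (evf fun s => (hE _).bd hδ j k)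
  obtain ⟨M, hMd⟩ : ∃ M : ℝ → Ix n → Ix n → ℝ, ∀ j k, (fun τ => M τ j k) = fun τ => (volume.real G)⁻¹ * ∫ s in G, a (sg (τ, s)) j k :=
    ⟨fun τ j k => (volume.real G)⁻¹ * ∫ s in G, a (sg (τ, s)) j k, fun _ _ => rfl⟩
  have hMd' : ∀ τ j k, M τ j k = (volume.real G)⁻¹ * ∫ s in G, a (sg (τ, s)) j k := fun τ j k => congrFun (hMd j k) τ
  have mM : ∀ j k, Measurable fun t => M t j k := fun j k => by
    rw [hMd]
    exact ((StronglyMeasurable.integral_prod_right (f := fun τ s => a (sg (τ, s)) j k) (ν := volume.restrict G)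
      (ma j k).stronglyMeasurable).measurable).const_mul _
  have eM : ∀ τ (θ : Ix n → ℝ), ∑ j, ∑ k, M τ j k * θ j * θ k = (volume.real G)⁻¹ * ∫ s in G, ∑ j, ∑ k, a (sg (τ, s)) j k * θ j * θ k := by
    intro τ θ
    rw [integral_finsetSum _ fun j _ => integrable_finsetSum _ fun k _ => ((ia τ j k).mul_const _).mul_const _, mul_sum]
    refine sum_congr rfl fun j _ => ?_
    rw [integral_finsetSum _ fun k _ => ((ia τ j k).mul_const _).mul_const _, mul_sum]
    refine sum_congr rfl fun k _ => ?_
    rw [integral_mul_const, integral_mul_const, hMd']; ring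
  have iS : ∀ τ (θ : Ix n → ℝ), IntegrableOn (fun s => ∑ j, ∑ k, a (sg (τ, s)) j k * θ j * θ k) G := fun τ θ =>
    integrable_finsetSum _ fun j _ => integrable_finsetSum _ fun k _ => ((ia τ j k).mul_const _).mul_const _
  have ec : ∀ c : ℝ, c = (volume.real G)⁻¹ * ∫ s in G, c := fun c => by
    rw [setIntegral_const, smul_eq_mul]; field_simp
  refine ⟨M, mM, fun τ => ⟨fun j k => ?_, fun θ => ?_, fun θ => ?_⟩, fun j k => ?_⟩
  · rw [hMd', hMd']; congr 2; funext s; exact (hE _).sym j k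
  · rw [eM, ec (δ * ∑ j, θ j ^ 2)]
    refine mll (integral_mono (integrable_const _) (iS τ θ) fun s => (hE _).lo θ) (by positivity)
  · rw [eM, ec (δ⁻¹ * ∑ j, θ j ^ 2)]
    refine mll (integral_mono (iS τ θ) (integrable_const _) fun s => (hE _).hi θ) (by positivity)
  obtain ⟨Φ, hΦ⟩ : ∃ Φ : ℝ → ℝ × (Fin n → ℝ) → ℝ × (Fin n → ℝ) → ℝ, ∀ τ s₁ s₂, Φ τ s₁ s₂ = ⨆ j, ⨆ k, |a (sg (τ, s₁)) j k - a (sg (τ, s₂)) j k| :=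
    ⟨_, fun _ _ _ => rfl⟩
  have bΦ : ∀ τ s₁ s₂, 0 ≤ Φ τ s₁ s₂ ∧ Φ τ s₁ s₂ ≤ 2 * δ⁻¹ := fun τ s₁ s₂ => by
    rw [hΦ]
    exact ⟨iSup_nonneg fun _ => iSup_nonneg fun _ => abs_nonneg _, msup_le (by positivity) fun j k => (abs_sub _ _).trans (by
      linarith [(hE (sg (τ, s₁))).bd hδ j k, (hE (sg (τ, s₂))).bd hδ j k])⟩
  have mΦ : Measurable fun q : (ℝ × (ℝ × (Fin n → ℝ))) × (ℝ × (Fin n → ℝ)) => Φ q.1.1 q.1.2 q.2 := by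
    simp only [hΦ]
    exact Measurable.iSup fun j => Measurable.iSup fun k =>
      (((ma j k).comp measurable_fst).sub ((ma j k).comp ((measurable_fst.comp measurable_fst).prodMk measurable_snd))).abs
  obtain ⟨Ψ, hΨ⟩ : ∃ Ψ : ℝ × (ℝ × (Fin n → ℝ)) → ℝ, Ψ = fun q => ∫ s₂ in G, Φ q.1 q.2 s₂ := ⟨_, rfl⟩
  have mΨ : Measurable Ψ := by
    rw [hΨ]; exact (StronglyMeasurable.integral_prod_right (f := fun (q : ℝ × (ℝ × (Fin n → ℝ))) s₂ => Φ q.1 q.2 s₂) (ν := volume.restrict G) mΦ.stronglyMeasurable).measurable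
  have bΨ : ∀ q, ‖Ψ q‖ ≤ 2 * δ⁻¹ * volume.real G := fun q => by
    rw [hΨ]
    exact norm_setIntegral_le_of_norm_le_const fG.lt_top fun s _ => by
      rw [norm_eq_abs, abs_of_nonneg (bΦ _ _ _).1]; exact (bΦ _ _ _).2
  have fIG : volume (I ×ˢ G) ≠ ⊤ := by
    rw [volume_eq_prod, Measure.prod_prod]; exact mul_ne_top (by simp [hI]) fG
  have iΨ : IntegrableOn Ψ (I ×ˢ G) := integrableOn_of_bounded fIG mΨ.aestronglyMeasurable (evf bΨ)
  have osc : ∫ q in I ×ˢ G, Ψ q = ρ ^ 5 * v ^ 2 * oscA a ρ (z.1 - r ^ 2) z.2 := by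
    rw [volume_eq_prod, setIntegral_prod _ (by rwa [← volume_eq_prod])]
    unfold oscA
    rw [← measureReal_def, ← hv]
    rw [← mul_assoc, show ρ ^ 5 * v ^ 2 * ((ρ ^ 5)⁻¹ * (v ^ 2)⁻¹) = 1 by field_simp, one_mul, hΨ]
    simp only [hΦ, sg]; rfl
  set S : Set (En n) := {y | y.2 0 ∈ I ∧ (y.1, fun j : Fin n => y.2 j.succ) ∈ G} with hS
  have preS : sg ⁻¹' S = I ×ˢ G := by ext q; simp [hS, sg]
  have QS : Qb z r ⊆ S := by
    rintro y ⟨h1, h2⟩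
    rw [mem_ball, dist_eq, abs_lt] at h1
    rw [mem_ball, dist_pi_lt_iff hr] at h2
    have h2' : ∀ j, |y.2 j - z.2 j| < r := fun j => by rw [← dist_eq]; exact h2 j
    have rρ : 2 * r ≤ ρ := by rw [hρd]; nlinarith
    refine ⟨?_, ?_, ?_⟩
    · have := abs_lt.1 (h2' 0); constructor <;> linarith
    · constructor <;> nlinarith
    · simp only [ballC, mem_ofPred_eq]
      calc ∑ j : Fin n, (y.2 j.succ - z.2 j.succ) ^ 2 ≤ ∑ j : Fin n, r ^ 2 :=
            sum_le_sum fun j _ => sq_le_sq' (abs_lt.1 (h2' _)).1.le (abs_lt.1 (h2' _)).2.le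
        _ = n * r ^ 2 := by simp
        _ < ρ ^ 2 := by rw [hρd, mul_pow]; gcongr; nlinarith
  have fS : volume S ≠ ⊤ := by
    have mS : MeasurableSet S := by
      have : Measurable fun y : En n => (y.1, fun j : Fin n => y.2 j.succ) := by fun_prop
      exact (((measurable_pi_apply 0).comp measurable_snd) measurableSet_Ioo).inter (this mG)
    rw [← (sg_mp (n := n)).1.measure_preimage mS.nullMeasurableSet, preS]; exact fIG
  have mD : Measurable fun y : En n => |M (y.2 0) j k - a y j k| :=
    (((mM j k).comp ((measurable_pi_apply 0).comp measurable_snd)).sub (hm j k)).abs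
  have iD : ∀ q : ℝ × (ℝ × (Fin n → ℝ)), |M q.1 j k - a (sg q) j k| ≤ (volume.real G)⁻¹ * Ψ q := by
    intro q
    have e : M q.1 j k - a (sg q) j k = (volume.real G)⁻¹ * ∫ s in G, (a (sg (q.1, s)) j k - a (sg q) j k) := by
      rw [integral_sub (ia _ j k) (integrable_const _), mul_sub, ← ec, hMd']
    rw [e, abs_mul, abs_of_pos (inv_pos.2 gp), hΨ]
    refine mll (abs_integral_le_integral_abs.trans ?_) (by positivity)
    refine integral_mono ((ia _ j k).sub (integrable_const _)).abs ?_ fun s => ?_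
    · exact Integrable.of_bound (mΦ.comp (measurable_prodMk_left (x := q))).aestronglyMeasurable (2 * δ⁻¹) (evf fun s => by
        change |Φ q.1 q.2 s| ≤ _; rw [abs_of_nonneg (bΦ _ _ _).1]; exact (bΦ _ _ _).2)
    · simp only [hΦ]
      rw [abs_sub_comm]
      exact le_msup (fun j k => |a (sg (q.1, q.2)) j k - a (sg (q.1, s)) j k|) j k
  have iDS : IntegrableOn (fun y : En n => |M (y.2 0) j k - a y j k|) S := by
    rw [← (sg_mp (n := n)).1.integrableOn_comp_preimage sg_mp.2, preS]
    refine (iΨ.const_mul (volume.real G)⁻¹).mono' (mD.comp ms).aestronglyMeasurable (evf fun q => ?_)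
    simp only [Function.comp, norm_eq_abs, abs_abs]
    exact iD q
  calc ∫ y in Qb z r, |M (y.2 0) j k - a y j k| ≤ ∫ y in S, |M (y.2 0) j k - a y j k| :=
        setIntegral_mono_set iDS (evf fun _ => abs_nonneg _) (LE.le.eventuallyLE QS)
    _ = ∫ q in I ×ˢ G, |M q.1 j k - a (sg q) j k| := by
        rw [← (sg_mp (n := n)).1.setIntegral_preimage_emb sg_mp.2, preS]; rfl
    _ ≤ ∫ q in I ×ˢ G, (volume.real G)⁻¹ * Ψ q := by
        refine integral_mono ?_ (iΨ.const_mul _) iD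
        rw [← preS]; exact ((sg_mp (n := n)).1.integrableOn_comp_preimage sg_mp.2).2 iDS
    _ = ρ ^ 3 * v * oscA a ρ (z.1 - r ^ 2) z.2 := by
        rw [integral_const_mul, osc, vG]; field_simp
    _ ≤ ρ ^ 3 * (2 * ρ) ^ n * κ := by
        have h0 : 0 ≤ oscA a ρ (z.1 - r ^ 2) z.2 := by
          unfold oscA
          refine mul_nonneg (by positivity) (integral_nonneg fun τ => integral_nonneg fun _ => integral_nonneg fun _ => iSup_nonneg fun _ => iSup_nonneg fun _ => abs_nonneg _)
        have : 0 ≤ κ := h0.trans hκ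
        gcongr
    _ = 2 ^ n * ρ ^ (n+3) * κ := by rw [mul_pow 2 ρ n]; ring
end freeze2
section frz3
open Classical in
noncomputable def tr (c : ℝ) (f : Fu n) : En n → ℝ := fun z => if c < f z then f z else 0
lemma tr_nonneg {c : ℝ} (hf : ∀ z, 0 ≤ f z) (z) : 0 ≤ tr c f z := by
  unfold tr; split_ifs; exacts [hf z, le_rfl]
lemma tr_le {c : ℝ} (hf : ∀ z, 0 ≤ f z) (z) : tr c f z ≤ f z := by
  unfold tr; split_ifs; exacts [le_rfl, hf z]
lemma le_tr {c : ℝ} (f : Fu n) (hc : 0 ≤ c) (z) : f z ≤ tr c f z + c := by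
  unfold tr; split_ifs <;> linarith
lemma tr_meas {c : ℝ} (hf : Measurable f) : Measurable (tr c f) := by
  unfold tr
  exact Measurable.ite (measurableSet_lt measurable_const hf) hf measurable_const
lemma tr_bdd {c : ℝ} (hf : Bdd f) : Bdd (tr c f) := by
  obtain ⟨m, M, h⟩ := hf
  refine ⟨tr_meas m, M, fun z => ?_⟩
  unfold tr; split_ifs; exacts [h z, by simpa using (abs_nonneg _).trans (h z)]
lemma JJ_mono (hf : Bdd f) (hg : Bdd g) (h : ∀ z, f z ≤ g z) : JJ s z r f ≤ JJ s z r g :=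
  integral_mono (hf.integOn (Qb_fin z s)) (hg.integOn (Qb_fin z s)) h
lemma JJ_add (hf : Bdd f) (hg : Bdd g) : JJ s z r (fun y => f y + g y) = JJ s z r f + JJ s z r g :=
  integral_add (hf.integOn (Qb_fin z s)) (hg.integOn (Qb_fin z s))
lemma JJ_cmul (c : ℝ) (f : Fu n) : JJ s z r (fun y => c * f y) = c * JJ s z r f :=
  integral_const_mul _ _
lemma JJ_nonneg (hf : ∀ z, 0 ≤ f z) : 0 ≤ JJ s z r f := integral_nonneg hf
lemma JJ_dom (hb : Bdd f) (hf : ∀ z, 0 ≤ f z) (h0 : 0 ≤ r) (h : r ≤ R) : JJ s z r f ≤ JJ s z R f :=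
  setIntegral_mono_set (hb.integOn (Qb_fin z s)) (evf hf)
    (LE.le.eventuallyLE (Set.inter_subset_inter_right _ (Qb_mono z h0 h)))
lemma JJ_const (hr : 0 < r) {c : ℝ} (hc : 0 ≤ c) : JJ s z r (fun _ => c) ≤ c * (2 ^ (n+2) * r ^ (n+3)) := by
  unfold JJ
  rw [setIntegral_const, smul_eq_mul, mul_comm]
  refine mll ?_ hc
  have h := measure_mono (μ := volume) (inter_subset_right : Hs n s ∩ Qb z r ⊆ Qb z r)
  rw [Qb_vol z hr] at h
  have := ENNReal.toReal_mono ofReal_ne_top h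
  rwa [toReal_ofReal (by positivity)] at this
lemma mp_bdd (hδ : 0 < δ) (hm : ∀ j k, Measurable fun q => a q j k) (hE : ∀ y, Ell δ (a y))
    (hu : CT u) : Bdd (mp a u) := by
  have h1 : ∀ j k, Bdd fun y => a y j k := fun j k => ⟨hm j k, δ⁻¹, fun y => (hE y).bd hδ j k⟩
  have := (hu.dd et).bdd
  have := fun j k => hu.d2 (ex j) (ex k)
  unfold mp; fun_prop
lemma VV_bdd (hu : CT u) : Bdd (VV u) := by
  have := (hu.dd et).bdd
  have := D2_bdd hu
  unfold VV; fun_prop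
lemma VV_nonneg (u : Fu n) (z) : 0 ≤ VV u z := by unfold VV; linarith [sq_nonneg (dd et u z), D2_nonneg u z]
lemma frz (n : ℕ) (δ : ℝ) (hδ : 0 < δ) (hδ1 : δ < 1) (hn : 1 ≤ n) : ∃ C, 0 ≤ C ∧ ∀ (a : Fm n),
    (∀ j k, Measurable fun q => a q j k) → (∀ y, Ell δ (a y)) → ∀ (z : En n) (r : ℝ), 0 < r → ∀ κ, oscA a ((n+1) * r) (z.1 - r ^ 2) z.2 ≤ κ →
    ∃ β A, Co (δ ^ 2 / 2) β A ∧ ∀ u, CT u → ∀ s L, 0 ≤ L →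
      JJ s z r (fun y => Lt β A u y ^ 2) ≤ C * (JJ s z r (fun y => mp a u y ^ 2) + JJ s z r (tr L (VV u)) + L * κ * r ^ (n+3)) := by
  obtain ⟨c1, hc1⟩ : ∃ c1 : ℝ, c1 = (n+1) ^ 2 * (4 * δ⁻¹ ^ 2) := ⟨_, rfl⟩
  obtain ⟨c2, hc2⟩ : ∃ c2 : ℝ, c2 = 2 * δ⁻¹ * ((n+1) ^ 2 * (2 ^ n * (n+1) ^ (n+3))) := ⟨_, rfl⟩
  have c10 : 0 ≤ c1 := by rw [hc1]; positivity
  have c20 : 0 ≤ c2 := by rw [hc2]; positivity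
  refine ⟨2 * δ⁻¹ ^ 2 * (1 + c1 + c2), by positivity, fun a hm hE z r hr κ hκ => ?_⟩
  obtain ⟨M, mM, eM, hM⟩ := freeze hδ hm hE hn z hr hκ
  have κ0 : 0 ≤ κ := by
    have h := (integral_nonneg (μ := volume.restrict (Qb z r)) fun y => abs_nonneg _).trans (hM 0 0)
    by_contra hh
    have : 2 ^ n * ((n+1) * r) ^ (n+3) * κ < 0 := mul_neg_of_pos_of_neg (by positivity) (not_le.1 hh)
    linarith
  refine ⟨_, _, Co_of hδ hδ1 mM eM, fun u hu s L hL => ?_⟩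
  have hc := Co_of hδ hδ1 mM eM
  obtain ⟨d, hd⟩ : ∃ d : Fa n, ∀ j k y, d j k y = |M (y.2 0) j k - a y j k| := ⟨_, fun _ _ _ => rfl⟩
  have db : ∀ j k y, 0 ≤ d j k y ∧ d j k y ≤ 2 * δ⁻¹ := fun j k y => by
    rw [hd]; exact ⟨abs_nonneg _, (abs_sub _ _).trans (by linarith [(hE y).bd hδ j k, (eM (y.2 0)).bd hδ j k])⟩
  have dB : ∀ j k, Bdd (d j k) := fun j k => ⟨by
    have : d j k = fun y => |M (y.2 0) j k - a y j k| := funext fun y => hd j k y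
    rw [this]
    exact (((mM j k).comp ((measurable_pi_apply 0).comp measurable_snd)).sub (hm j k)).abs, 2 * δ⁻¹, fun y => by rw [abs_of_nonneg (db j k y).1]; exact (db j k y).2⟩
  have hF := (mp_bdd hδ hm hE hu).pow 2
  have hV := tr_bdd (c := L) (VV_bdd hu)
  have hD : Bdd (fun y => ∑ j, ∑ k, d j k y) := by fun_prop
  have pt : ∀ y, Lt (fun y : En n => (M (y.2 0) 0 0)⁻¹) (fun j k y => Afz (M (y.2 0)) j k) u y ^ 2 ≤
      2 * δ⁻¹ ^ 2 * (mp a u y ^ 2 + (c1 * tr L (VV u) y + L * (2 * δ⁻¹) * ∑ j, ∑ k, d j k y)) := by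
    intro y
    refine (Lt_fz hδ eM a hu y).trans ?_
    have e1 : ∑ j, ∑ k, (M (y.2 0) j k - a y j k) ^ 2 ≤ (2 * δ⁻¹) * ∑ j, ∑ k, d j k y := by
      rw [mul_sum]
      refine sum_le_sum fun j _ => ?_
      rw [mul_sum]
      refine sum_le_sum fun k _ => ?_
      rw [← sq_abs, ← hd, pow_two]
      exact mlr (db j k y).2 (db j k y).1
    have e2 : ∑ j, ∑ k, (M (y.2 0) j k - a y j k) ^ 2 ≤ c1 := by
      calc _ ≤ ∑ j : Ix n, ∑ k : Ix n, (4 * δ⁻¹ ^ 2) := by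
            refine sum_le_sum fun j _ => sum_le_sum fun k _ => ?_
            rw [← sq_abs, ← hd]; nlinarith [(db j k y).1, (db j k y).2]
        _ = c1 := by simp [hc1]; ring
    have e0 : 0 ≤ ∑ j, ∑ k, (M (y.2 0) j k - a y j k) ^ 2 := by positivity
    have t0 := tr_nonneg (c := L) (VV_nonneg u) y
    have t1 := le_tr (VV u) hL y
    gcongr
    calc _ ≤ (∑ j, ∑ k, (M (y.2 0) j k - a y j k) ^ 2) * (tr L (VV u) y + L) := by gcongr
      _ = (∑ j, ∑ k, (M (y.2 0) j k - a y j k) ^ 2) * tr L (VV u) y + L * ∑ j, ∑ k, (M (y.2 0) j k - a y j k) ^ 2 := by ring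
      _ ≤ c1 * tr L (VV u) y + L * ((2 * δ⁻¹) * ∑ j, ∑ k, d j k y) := by gcongr
      _ = _ := by ring
  have iD : JJ s z r (fun y => ∑ j, ∑ k, d j k y) ≤ (n+1) ^ 2 * (2 ^ n * ((n+1) * r) ^ (n+3) * κ) := by
    unfold JJ
    rw [integral_finsetSum _ fun j _ => integrable_finsetSum _ fun k _ => (dB j k).integOn (Qb_fin z s)]
    calc _ ≤ ∑ j : Ix n, ∑ k : Ix n, (2 ^ n * ((n+1) * r) ^ (n+3) * κ) := by
          refine sum_le_sum fun j _ => ?_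
          rw [integral_finsetSum _ fun k _ => (dB j k).integOn (Qb_fin z s)]
          refine sum_le_sum fun k _ => le_trans ?_ (hM j k)
          simp only [← hd]
          refine setIntegral_mono_set ((dB j k).integOn ?_) (evf fun y => (db j k y).1) (LE.le.eventuallyLE inter_subset_right)
          rw [Qb_vol z hr]; exact ofReal_ne_top
      _ = _ := by simp; ring
  have F0 := JJ_nonneg (s := s) (z := z) (r := r) (fun y => sq_nonneg (mp a u y))
  have V0 := JJ_nonneg (s := s) (z := z) (r := r) (tr_nonneg (c := L) (VV_nonneg u))
  have hV' : Bdd (fun y => c1 * tr L (VV u) y) := by fun_prop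
  have hD' : Bdd (fun y => L * (2 * δ⁻¹) * ∑ j, ∑ k, d j k y) := by fun_prop
  have hVD : Bdd (fun y => c1 * tr L (VV u) y + L * (2 * δ⁻¹) * ∑ j, ∑ k, d j k y) := hV'.add hD'
  calc _ ≤ JJ s z r (fun y => 2 * δ⁻¹ ^ 2 * (mp a u y ^ 2 + (c1 * tr L (VV u) y + L * (2 * δ⁻¹) * ∑ j, ∑ k, d j k y))) :=
        JJ_mono ((Lt_bdd hc hu).pow 2) (by fun_prop) pt
    _ = 2 * δ⁻¹ ^ 2 * (JJ s z r (fun y => mp a u y ^ 2) + (c1 * JJ s z r (tr L (VV u)) + L * (2 * δ⁻¹) * JJ s z r (fun y => ∑ j, ∑ k, d j k y))) := by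
        rw [JJ_cmul, JJ_add hF hVD, JJ_add hV' hD', JJ_cmul, JJ_cmul]
    _ ≤ 2 * δ⁻¹ ^ 2 * (JJ s z r (fun y => mp a u y ^ 2) + (c1 * JJ s z r (tr L (VV u)) + L * (2 * δ⁻¹) * ((n+1) ^ 2 * (2 ^ n * ((n+1) * r) ^ (n+3) * κ)))) := by gcongr
    _ = 2 * δ⁻¹ ^ 2 * (JJ s z r (fun y => mp a u y ^ 2) + c1 * JJ s z r (tr L (VV u)) + c2 * (L * κ * r ^ (n+3))) := by
        rw [hc2, mul_pow]; ring
    _ ≤ _ := by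
        set X := JJ s z r (fun y => mp a u y ^ 2)
        set Y := JJ s z r (tr L (VV u))
        have Z0 : 0 ≤ L * κ * r ^ (n+3) := by positivity
        set Z := L * κ * r ^ (n+3)
        rw [mul_assoc (2 * δ⁻¹ ^ 2)]
        gcongr
        nlinarith [mul_nonneg c10 F0, mul_nonneg c20 F0, mul_nonneg c10 V0, mul_nonneg c20 V0, mul_nonneg c10 Z0, mul_nonneg c20 Z0]
end frz3
section gb
noncomputable def mm (a : Fm n) (u : Fu n) (B L lam : ℝ) : En n → ℝ :=
  fun y => tr lam (gg u) y + (tr lam (fun y => B * mp a u y ^ 2) y + B * tr L (VV u) y)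
lemma mm_bdd (hδ : 0 < δ) (hm : ∀ j k, Measurable fun q => a q j k) (hE : ∀ y, Ell δ (a y))
    (hu : CT u) (B L lam : ℝ) : Bdd (mm a u B L lam) := by
  have := tr_bdd (c := lam) (gg_bdd hu)
  have := tr_bdd (c := lam) (f := fun y => B * mp a u y ^ 2) ((Bdd.const B).mul ((mp_bdd hδ hm hE hu).pow 2))
  have := tr_bdd (c := L) (VV_bdd hu)
  unfold mm; fun_prop
lemma mm_nonneg {B L lam : ℝ} (hB : 0 ≤ B) (y) : 0 ≤ mm a u B L lam y := by
  have h1 := tr_nonneg (c := lam) (gg_nonneg u) y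
  have h2 := tr_nonneg (c := lam) (f := fun y => B * mp a u y ^ 2) (fun y => by positivity) y
  have h3 := tr_nonneg (c := L) (VV_nonneg u) y
  unfold mm; positivity
lemma JJ_tr {c : ℝ} (hf : Measurable f) :
    JJ s z r (tr c f) = ∫ y in Hs n s ∩ Qb z r ∩ {y | c < f y}, f y := by
  unfold JJ
  rw [← setIntegral_indicator (measurableSet_lt measurable_const hf)]
  rfl
lemma good_alg {C1 C' Cf c ε θ B X Y W Z P I O l l' : ℝ} (C10 : 0 ≤ C1) (C'0 : 0 ≤ C') (Cf0 : 0 ≤ Cf) (c0 : 0 ≤ c)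
    (hε : 0 < ε) (hε1 : ε ≤ 1) (hθ : θ * (C' * Cf + 1) = ε) (θ0 : 0 ≤ θ) (B1 : C' * Cf ≤ B) (B2 : 1 ≤ ε * B)
    (X0 : 0 ≤ X) (Y0 : 0 ≤ Y) (W0 : 0 ≤ W) (l0 : 0 < l) (l3 : l ≤ l') (hlo : l ≤ I) (hA2 : Z ≤ θ * l)
    (hA : P ≤ Cf * (Y + W + Z)) (sum : X + B * Y + B * W ≤ c * l)
    (h3 : C1 * X + C' * P ≤ ((C1 + 1) * c + 1) * l' → O ≤ ε * X + C1 * P) : O ≤ (c + C1 * Cf * (c + 1)) * ε * I := by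
  have D0 : 0 ≤ C' * Cf := by positivity
  have B0 : 0 ≤ B := by linarith
  have YW : 0 ≤ Y + W := by positivity
  have BYW : 0 ≤ B * (Y + W) := by positivity
  have sum' : X + B * (Y + W) ≤ c * l := by linarith
  have θD : 0 ≤ θ * (C' * Cf) := by positivity
  have θε : θ ≤ ε := by linarith
  have b1 : X ≤ c * l := by linarith
  have b2' : B * (Y + W) ≤ c * l := by linarith
  have h4 : C1 * X + C' * P ≤ ((C1 + 1) * c + 1) * l' := by
    have a1 : C' * P ≤ C' * (Cf * (Y + W + θ * l)) := by
      gcongr; exact hA.trans (by gcongr)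
    have a2 : C' * Cf * (Y + W) ≤ B * (Y + W) := by gcongr
    have a3 : (θ * (C' * Cf)) * l ≤ 1 * l := by gcongr; linarith
    have a4 : C1 * X ≤ C1 * (c * l) := by gcongr
    have a5 : ((C1 + 1) * c + 1) * l ≤ ((C1 + 1) * c + 1) * l' := by gcongr
    linarith
  have h5 := h3 h4
  have b2 : Y + W ≤ ε * (c * l) := by
    calc Y + W = 1 * (Y + W) := by ring
      _ ≤ ε * B * (Y + W) := by gcongr
      _ ≤ ε * (c * l) := by rw [mul_assoc]; gcongr
  have b3 : Z ≤ ε * l := hA2.trans (by gcongr)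
  calc O ≤ ε * X + C1 * P := h5
    _ ≤ ε * (c * l) + C1 * (Cf * (ε * (c * l) + ε * l)) := by
        have : P ≤ Cf * (ε * (c * l) + ε * l) := hA.trans (by gcongr)
        gcongr
    _ = (c + C1 * Cf * (c + 1)) * ε * l := by ring
    _ ≤ _ := by gcongr
lemma bad_alg {Cc Cf B D D' θ θ' X Y W U Y' U' Z P I l ρ : ℝ} (Cc0 : 0 ≤ Cc) (Cf0 : 0 ≤ Cf) (hB : 1 ≤ B) (hD : D = Cc * Cf + B) (hD' : D' = Cc * ρ)
    (hθ : θ * (Cc * Cf + 1) = 1 / 4) (θ0 : 0 ≤ θ) (hθ' : θ' * (D + D') = 1 / 4) (W0 : 0 ≤ W) (F0 : 0 ≤ Y') (U0 : 0 ≤ U') (l0 : 0 < l) (hlo : l ≤ I)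
    (sum : I ≤ X + B * Y + B * W) (h2 : X ≤ Cc * (P + ρ * U)) (hA : P ≤ Cf * (Y + W + Z)) (hA2 : Z ≤ θ * l)
    (tF1 : Y ≤ Y' + θ' * l) (tU1 : U ≤ U' + θ' * l) (d0 : 0 ≤ D) (d0' : 0 ≤ D') : l ≤ 2 * D * W + 2 * (D + D') * (Y' + U') := by
  have a1 : Cc * P ≤ Cc * (Cf * (Y + W + θ * l)) := by
    gcongr; exact hA.trans (by gcongr)
  have a2 : (θ * (Cc * Cf)) * l ≤ 1 / 4 * l := by gcongr; linarith
  have a3 : l ≤ D * (Y + W) + 1 / 4 * l + D' * U := by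
    rw [hD, hD']; linarith
  have a4 : D * Y ≤ D * (Y' + θ' * l) := by gcongr
  have a5 : D' * U ≤ D' * (U' + θ' * l) := by gcongr
  have a6 : θ' * (D + D') * l = 1 / 4 * l := by rw [hθ']
  linarith [mul_nonneg d0' F0, mul_nonneg d0 U0]
lemma good (n : ℕ) (δ : ℝ) (hδ : 0 < δ) (hδ1 : δ < 1) (hn : 1 ≤ n) : ∃ N0 C2 : ℝ, 1 ≤ N0 ∧ 0 ≤ C2 ∧ ∀ ε, 0 < ε → ε ≤ 1 → ∃ B η : ℝ,
    1 ≤ B ∧ 0 < η ∧ ∀ (a : Fm n),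
    (∀ j k, Measurable fun q => a q j k) → (∀ y, Ell δ (a y)) → ∀ u, CT u → ∀ s, ∀ z ∈ Hs n s, ∀ r, 0 < r → ∀ κ L lam, 0 < lam → 0 ≤ L →
    oscA a ((n+1) * (3 * (3 * r))) (z.1 - (3 * (3 * r)) ^ 2) z.2 ≤ κ → L * κ ≤ η * lam →
    JJ s z (16 * r) (mm a u B L lam) ≤ lam * (16 * r) ^ (n+3) → lam * r ^ (n+3) ≤ JJ s z r (mm a u B L lam) →
    JJ s z (3 * r) (tr (N0 * lam) (gg u)) ≤ C2 * ε * JJ s z r (mm a u B L lam) := by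
  obtain ⟨C1, C10, h1⟩ := key_sc n (δ ^ 2 / 2) (by positivity)
  obtain ⟨Cf, Cf0, hf⟩ := frz n δ hδ hδ1 hn
  obtain ⟨c, hc⟩ : ∃ c : ℝ, c = 16 ^ (n+3) + 2 ^ (n+3) * 9 ^ (n+3) := ⟨_, rfl⟩
  have c0 : 0 ≤ c := by rw [hc]; positivity
  refine ⟨4 * ((C1 + 1) * c + 1), c + C1 * Cf * (c + 1), by nlinarith [mul_nonneg C10 c0], by positivity, fun ε hε hε1 => ?_⟩
  obtain ⟨C', C'0, h2⟩ := h1 ε hε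
  have D0 : 0 ≤ C' * Cf := by positivity
  obtain ⟨η, hη⟩ : ∃ η : ℝ, η = ε / (9 ^ (n+3) * (C' * Cf + 1)) := ⟨_, rfl⟩
  have hη' : η * 9 ^ (n+3) * (C' * Cf + 1) = ε := by rw [hη]; field_simp
  have η0 : 0 < η := by rw [hη]; positivity
  have η9 : 0 ≤ η * 9 ^ (n+3) := by positivity
  refine ⟨C' * Cf + 1 / ε + 1, η, by have : 0 < 1 / ε := by positivity
                                     linarith, η0, ?_⟩
  obtain ⟨B, hB⟩ : ∃ B : ℝ, B = C' * Cf + 1 / ε + 1 := ⟨_, rfl⟩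
  rw [← hB]
  have eε : 0 < 1 / ε := by positivity
  have B1 : C' * Cf ≤ B := by linarith
  have B2 : 1 ≤ ε * B := by rw [hB]; have : ε * (1 / ε) = 1 := by field_simp
                            nlinarith [mul_nonneg hε.le D0]
  have B0 : 0 < B := by linarith
  intro a hm hE u hu s z hz r hr κ L lam hl hL hosc hLκ hup hlo
  obtain ⟨β, A, hco, hA⟩ := hf a hm hE z (3 * (3 * r)) (by positivity) κ hosc
  have hA := hA u hu s L hL
  have h3 := h2 β A hco s z hz (3 * r) (by positivity) u hu (((C1 + 1) * c + 1) * lam)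
  rw [show 4 * (((C1 + 1) * c + 1) * lam) = 4 * ((C1 + 1) * c + 1) * lam by ring, ← JJ_tr (gg_bdd hu).1] at h3
  have bF : Bdd (fun y => mp a u y ^ 2) := (mp_bdd hδ hm hE hu).pow 2
  have bG := gg_bdd hu
  have bV := tr_bdd (c := L) (VV_bdd hu)
  have bm := mm_bdd hδ hm hE hu B L lam
  have sum : JJ s z (3 * (3 * r)) (gg u) + B * JJ s z (3 * (3 * r)) (fun y => mp a u y ^ 2) + B * JJ s z (3 * (3 * r)) (tr L (VV u)) ≤ c * (lam * r ^ (n+3)) := by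
    have e : JJ s z (3 * (3 * r)) (gg u) + B * JJ s z (3 * (3 * r)) (fun y => mp a u y ^ 2) + B * JJ s z (3 * (3 * r)) (tr L (VV u)) =
        JJ s z (3 * (3 * r)) (fun y => gg u y + (B * mp a u y ^ 2 + B * tr L (VV u) y)) := by
      rw [JJ_add bG (by fun_prop), JJ_add (by fun_prop) (by fun_prop), JJ_cmul, JJ_cmul]; ring
    have e2 : JJ s z (3 * (3 * r)) (fun y => gg u y + (B * mp a u y ^ 2 + B * tr L (VV u) y)) ≤
        JJ s z (3 * (3 * r)) (fun y => mm a u B L lam y + 2 * lam) := by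
      refine JJ_mono (by fun_prop) (by fun_prop) fun y => ?_
      have := le_tr (gg u) hl.le y
      have := le_tr (fun y => B * mp a u y ^ 2) hl.le y
      simp only [mm]; linarith
    rw [JJ_add bm (by fun_prop)] at e2
    have e3 := JJ_const (s := s) (z := z) (n := n) (r := 3 * (3 * r)) (by positivity) (c := 2 * lam) (by positivity)
    have e4 : JJ s z (3 * (3 * r)) (mm a u B L lam) ≤ JJ s z (16 * r) (mm a u B L lam) := JJ_dom bm (mm_nonneg B0.le) (by positivity) (by linarith)
    rw [e]
    calc _ ≤ lam * (16 * r) ^ (n+3) + 2 * lam * (2 ^ (n+2) * (3 * (3 * r)) ^ (n+3)) := by linarith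
      _ = c * (lam * r ^ (n+3)) := by rw [hc, show 3 * (3 * r) = 9 * r by ring, mul_pow, mul_pow]; ring
  have X0 := JJ_nonneg (s := s) (z := z) (r := 3 * (3 * r)) (gg_nonneg u)
  have Y0 := JJ_nonneg (s := s) (z := z) (r := 3 * (3 * r)) (fun y => sq_nonneg (mp a u y))
  have W0 := JJ_nonneg (s := s) (z := z) (r := 3 * (3 * r)) (tr_nonneg (c := L) (VV_nonneg u))
  have l0 : 0 < lam * r ^ (n+3) := by positivity
  have hA2 : L * κ * (3 * (3 * r)) ^ (n+3) ≤ η * 9 ^ (n+3) * (lam * r ^ (n+3)) := by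
    calc _ ≤ η * lam * (3 * (3 * r)) ^ (n+3) := by gcongr
      _ = _ := by rw [show 3 * (3 * r) = 9 * r by ring, mul_pow]; ring
  have l3 : lam * r ^ (n+3) ≤ lam * (3 * r) ^ (n+3) := by gcongr; linarith
  refine good_alg C10 C'0 Cf0 c0 hε hε1 hη' η9 B1 B2 X0 Y0 W0 l0 l3 hlo hA2 hA sum fun h => h3 (h.trans_eq ?_)
  ring
lemma bad (n : ℕ) (δ : ℝ) (hδ : 0 < δ) (hδ1 : δ < 1) (hn : 1 ≤ n) : ∃ η : ℝ, 0 < η ∧ ∀ B : ℝ, 1 ≤ B → ∃ C4 : ℝ, 0 ≤ C4 ∧ ∀ R : ℝ, 0 < R →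
    ∃ C5 c5 : ℝ, 0 ≤ C5 ∧ 0 < c5 ∧ ∀ (a : Fm n),
    (∀ j k, Measurable fun q => a q j k) → (∀ y, Ell δ (a y)) → ∀ u, CT u → ∀ s z, ∀ κ L lam, 0 < lam → 0 ≤ L →
    oscA a ((n+1) * (2 * R)) (z.1 - (2 * R) ^ 2) z.2 ≤ κ → L * κ ≤ η * lam →
    lam * R ^ (n+3) ≤ JJ s z R (mm a u B L lam) →
    lam * R ^ (n+3) ≤ C4 * JJ s z (2 * R) (tr L (VV u)) +
      C5 * (JJ s z (2 * R) (tr (c5 * lam) (fun y => mp a u y ^ 2)) + JJ s z (2 * R) (tr (c5 * lam) (fun y => u y ^ 2))) := by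
  obtain ⟨Cc, Cc0, h1⟩ := cacc_sc n (δ ^ 2 / 2) (by positivity)
  obtain ⟨Cf, Cf0, hf⟩ := frz n δ hδ hδ1 hn
  have D0 : 0 ≤ Cc * Cf := by positivity
  obtain ⟨η, hη⟩ : ∃ η : ℝ, η = 1 / (4 * 2 ^ (n+3) * (Cc * Cf + 1)) := ⟨_, rfl⟩
  have hη' : η * 2 ^ (n+3) * (Cc * Cf + 1) = 1 / 4 := by rw [hη]; field_simp
  have η0 : 0 < η := by rw [hη]; positivity
  refine ⟨η, η0, fun B hB => ⟨2 * (Cc * Cf + B), by positivity, fun R hR => ?_⟩⟩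
  obtain ⟨D, hD⟩ : ∃ D : ℝ, D = Cc * Cf + B := ⟨_, rfl⟩
  obtain ⟨D', hD'⟩ : ∃ D' : ℝ, D' = Cc * (R ^ 4)⁻¹ := ⟨_, rfl⟩
  have d0 : 0 < D := by rw [hD]; positivity
  have d0' : 0 ≤ D' := by rw [hD']; positivity
  obtain ⟨c5, hc5⟩ : ∃ c5 : ℝ, c5 = 1 / (4 * (2 ^ (n+2) * 2 ^ (n+3)) * (D + D')) := ⟨_, rfl⟩
  have hc5' : c5 * (2 ^ (n+2) * 2 ^ (n+3)) * (D + D') = 1 / 4 := by rw [hc5]; field_simp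
  have c50 : 0 < c5 := by rw [hc5]; positivity
  refine ⟨2 * (D + D'), c5, by positivity, c50, ?_⟩
  rw [← hD]
  intro a hm hE u hu s z κ L lam hl hL hosc hLκ hlo
  obtain ⟨β, A, hco, hA⟩ := hf a hm hE z (2 * R) (by positivity) κ hosc
  have hA := hA u hu s L hL
  have h2 := h1 β A hco s z R hR u hu
  have bF : Bdd (fun y => mp a u y ^ 2) := (mp_bdd hδ hm hE hu).pow 2
  have bU : Bdd (fun y => u y ^ 2) := hu.bdd.pow 2
  have bG := gg_bdd hu
  have bV := tr_bdd (c := L) (VV_bdd hu)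
  have bm := mm_bdd hδ hm hE hu B L lam
  have bL : Bdd (fun z => Lt β A u z ^ 2) := (Lt_bdd hco hu).pow 2
  rw [JJ_add bL (by fun_prop), JJ_cmul] at h2
  have sum : JJ s z R (mm a u B L lam) ≤ JJ s z R (gg u) + B * JJ s z (2 * R) (fun y => mp a u y ^ 2) + B * JJ s z (2 * R) (tr L (VV u)) := by
    have e2 : JJ s z R (mm a u B L lam) ≤ JJ s z R (fun y => gg u y + (B * mp a u y ^ 2 + B * tr L (VV u) y)) := by
      refine JJ_mono bm (by fun_prop) fun y => ?_
      have := tr_le (c := lam) (gg_nonneg u) y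
      have := tr_le (c := lam) (f := fun y => B * mp a u y ^ 2) (fun y => by positivity) y
      simp only [mm]; linarith
    rw [JJ_add bG (by fun_prop), JJ_add (by fun_prop) (by fun_prop), JJ_cmul, JJ_cmul] at e2
    have e3 : JJ s z R (fun y => mp a u y ^ 2) ≤ JJ s z (2 * R) (fun y => mp a u y ^ 2) := JJ_dom bF (fun y => sq_nonneg _) hR.le (by linarith)
    have e4 : JJ s z R (tr L (VV u)) ≤ JJ s z (2 * R) (tr L (VV u)) := JJ_dom bV (tr_nonneg (VV_nonneg u)) hR.le (by linarith)
    nlinarith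
  have tF : ∀ f : Fu n, Bdd f → JJ s z (2 * R) f ≤ JJ s z (2 * R) (tr (c5 * lam) f) + c5 * (2 ^ (n+2) * 2 ^ (n+3)) * (lam * R ^ (n+3)) := by
    intro f hf
    have e1 := JJ_mono (s := s) (z := z) (r := 2 * R) hf ((tr_bdd (c := c5 * lam) hf).add (Bdd.const (c5 * lam))) (le_tr f (by positivity))
    rw [JJ_add (tr_bdd hf) (Bdd.const _)] at e1
    have e3 := JJ_const (s := s) (z := z) (n := n) (r := 2 * R) (by positivity) (c := c5 * lam) (by positivity)
    have e4 : c5 * lam * (2 ^ (n+2) * (2 * R) ^ (n+3)) = c5 * (2 ^ (n+2) * 2 ^ (n+3)) * (lam * R ^ (n+3)) := by rw [mul_pow]; ring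
    linarith
  have tF1 := tF _ bF
  have tU1 := tF _ bU
  have W0 := JJ_nonneg (s := s) (z := z) (r := 2 * R) (tr_nonneg (c := L) (VV_nonneg u))
  have F0 := JJ_nonneg (s := s) (z := z) (r := 2 * R) (tr_nonneg (c := c5 * lam) fun y => sq_nonneg (mp a u y))
  have U0 := JJ_nonneg (s := s) (z := z) (r := 2 * R) (tr_nonneg (c := c5 * lam) fun y => sq_nonneg (u y))
  have hA2 : L * κ * (2 * R) ^ (n+3) ≤ η * 2 ^ (n+3) * (lam * R ^ (n+3)) := by
    calc _ ≤ η * lam * (2 * R) ^ (n+3) := by gcongr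
      _ = _ := by rw [mul_pow]; ring
  have l0 : 0 < lam * R ^ (n+3) := by positivity
  refine bad_alg Cc0 Cf0 hB hD hD' hη' (by positivity) hc5' W0 F0 U0 l0 hlo sum h2 hA hA2 tF1 tU1 d0.le d0'
end gb
section vit
lemma Qb_meet {w : En n} {t : ℝ} (hr : 0 < r) (ht : 0 < t) (h : (Qb z r ∩ Qb w t).Nonempty) (hrt : r ≤ 5 / 4 * t) : z ∈ Qb w (3 * t) := by
  obtain ⟨y, ⟨h1, h2⟩, h3, h4⟩ := h
  rw [mem_ball] at h1 h2 h3 h4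
  refine ⟨?_, ?_⟩ <;> rw [mem_ball]
  · have := dist_triangle z.1 y.1 w.1
    rw [dist_comm] at h1
    nlinarith
  · have := dist_triangle z.2 y.2 w.2
    rw [dist_comm] at h2
    nlinarith
lemma vitali (μ1 μ2 : Measure (En n)) (S : Set (En n)) (ρ : Fu n) (R : ℝ) (h0 : ∀ z ∈ S, 0 < ρ z) (hR : ∀ z ∈ S, ρ z ≤ R)
    (h : ∀ z ∈ S, μ1 (Qb z (3 * ρ z)) ≤ μ2 (Qb z (ρ z))) : μ1 S ≤ μ2 Set.univ := by
  obtain ⟨v, vS, vd, hv⟩ := Vitali.exists_disjoint_subfamily_covering_enlargement (fun z => Qb z (ρ z)) S ρ (5 / 4) (by norm_num)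
    (fun z hz => (h0 z hz).le) R hR (fun z hz => ⟨z, Qb_self z (h0 z hz)⟩)
  have vc : v.Countable := vd.countable_of_isOpen (fun z _ => Qb_open _ _) (fun z hz => ⟨z, Qb_self z (h0 z (vS hz))⟩)
  have cov : S ⊆ ⋃ z ∈ v, Qb z (3 * ρ z) := by
    intro z hz
    obtain ⟨w, hw, hm, hle⟩ := hv z hz
    simp only [Set.mem_iUnion]
    exact ⟨w, hw, Qb_meet (h0 z hz) (h0 w (vS hw)) hm hle⟩
  calc μ1 S ≤ μ1 (⋃ z ∈ v, Qb z (3 * ρ z)) := measure_mono cov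
    _ ≤ ∑' z : v, μ1 (Qb z (3 * ρ z)) := measure_biUnion_le _ vc _
    _ ≤ ∑' z : v, μ2 (Qb z (ρ z)) := ENNReal.tsum_le_tsum fun z => h z (vS z.2)
    _ = μ2 (⋃ z ∈ v, Qb z (ρ z)) := (measure_biUnion vc vd fun z _ => Qb_meas _ _).symm
    _ ≤ _ := measure_mono (Set.subset_univ _)
noncomputable def wd (s : ℝ) (f : Fu n) : Measure (En n) := (volume.restrict (Hs n s)).withDensity fun y => ofReal (f y)
lemma wd_Qb (hf : Bdd f) (h0 : ∀ y, 0 ≤ f y) (z : En n) (r : ℝ) : wd s f (Qb z r) = ofReal (JJ s z r f) := by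
  rw [wd, withDensity_apply _ (Qb_meas z r), Measure.restrict_restrict (Qb_meas z r), JJ, Set.inter_comm,
    ofReal_integral_eq_lintegral_ofReal (hf.integOn (Qb_fin z s)) (evf h0)]
lemma wd_univ (s : ℝ) (f : Fu n) : wd s f Set.univ = ∫⁻ y in Hs n s, ofReal (f y) := by
  rw [wd, withDensity_apply _ MeasurableSet.univ, Measure.restrict_univ]
lemma gg_cont (hu : CT u) : Continuous (gg u) := by
  have := (hu.dd et).cont
  have := fun j k => ((hu.dd (ex k)).dd (ex j)).cont
  unfold gg D2' D1
  fun_prop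
lemma small_r (hδ : 0 < δ) (hm : ∀ j k, Measurable fun q => a q j k) (hE : ∀ y, Ell δ (a y))
    (hu : CT u) {B L lam : ℝ} (hl : 0 < lam) (hB : 0 ≤ B) (hz : z ∈ Hs n s) (hG : lam < gg u z) :
    ∃ r0 > 0, ∀ r, 0 < r → r < r0 → lam * r ^ (n+3) < JJ s z r (mm a u B L lam) := by
  have ho : IsOpen (Hs n s ∩ {y | lam < gg u y}) := (isOpen_lt continuous_const continuous_fst).inter (isOpen_lt continuous_const (gg_cont hu))
  obtain ⟨e, he, hb⟩ := Metric.isOpen_iff.1 ho z ⟨hz, hG⟩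
  refine ⟨min e 1, by positivity, fun r hr hre => ?_⟩
  have h1 : r < e := hre.trans_le (min_le_left _ _)
  have h2 : r < 1 := hre.trans_le (min_le_right _ _)
  have sub : Qb z r ⊆ Hs n s ∩ {y | lam < gg u y} := by
    refine subset_trans ?_ hb
    rintro y ⟨y1, y2⟩
    rw [mem_ball] at *
    rw [Prod.dist_eq]
    exact max_lt (y1.trans (by nlinarith)) (y2.trans h1)
  have e1 : Hs n s ∩ Qb z r = Qb z r := Set.inter_eq_right.2 fun y hy => (sub hy).1
  have fin : volume (Qb z r) ≠ ⊤ := by rw [Qb_vol z hr]; exact ofReal_ne_top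
  have h3 : lam * volume.real (Qb z r) ≤ JJ s z r (mm a u B L lam) := by
    rw [JJ, e1]
    have : ∫ y in Qb z r, lam = lam * volume.real (Qb z r) := by rw [setIntegral_const, smul_eq_mul, mul_comm]
    rw [← this]
    refine setIntegral_mono_on (integrableOn_const fin) ((mm_bdd hδ hm hE hu B L lam).integOn fin) (Qb_meas z r) fun y hy => ?_
    have hy : lam < gg u y := (sub hy).2
    have t2 := tr_nonneg (c := lam) (f := fun y => B * mp a u y ^ 2) (fun y => by positivity) y
    have t3 := tr_nonneg (c := L) (VV_nonneg u) y
    have t1 : tr lam (gg u) y = gg u y := by simp only [tr, if_pos hy]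
    have t4 : 0 ≤ B * tr L (VV u) y := by positivity
    simp only [mm]; linarith
  refine lt_of_lt_of_le ?_ h3
  rw [measureReal_def, Qb_vol z hr, toReal_ofReal (by positivity)]
  have : (1:ℝ) < 2 ^ (n+2) := one_lt_pow₀ (by norm_num) (by omega)
  have : 0 < r ^ (n+3) := by positivity
  nlinarith [mul_pos hl this]
lemma gg_le_VV (y) : gg u y ≤ VV u y := by
  unfold gg VV D2' D2 D1
  gcongr
  have e : ∑ j : Ix n, ∑ k : Ix n, dx j (dx k u) y ^ 2 = ∑ k : Ix n, ∑ j : Ix n, dx j (dx k u) y ^ 2 := Finset.sum_comm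
  rw [e, Fin.sum_univ_succ (f := fun k => ∑ j : Ix n, dx j (dx k u) y ^ 2)]
  linarith [sum_nonneg fun (k : Ix n) (_ : k ∈ Finset.univ) => sq_nonneg (dx k (dx 0 u) y)]
lemma VV_le (n : ℕ) (δ : ℝ) (hδ : 0 < δ) (hδ1 : δ < 1) : ∃ C, 0 ≤ C ∧ ∀ (a : Fm n), (∀ y, Ell δ (a y)) → ∀ u, CT u →
    ∀ y, VV u y ≤ C * (gg u y + mp a u y ^ 2) := by
  refine ⟨1 + 6 * δ⁻¹ ^ 2 + 3 * (δ ^ 2 / 2)⁻¹ ^ 2 + (3 * ((n:ℝ) * (n+1) * (δ ^ 2 / 2)⁻¹ ^ 2) + 2), by positivity, fun a hE u hu y => ?_⟩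
  have h1 := Lt_fz (M := fun _ => a y) hδ (fun _ => hE y) a hu y
  have h2 := D2_le' (Co_of (n := n) (M := fun _ => a y) hδ hδ1 (fun _ _ => measurable_const) (fun _ => hE y)) hu y
  simp only [sub_self, ne_eq, OfNat.ofNat_ne_zero, not_false_eq_true, zero_pow, Finset.sum_const_zero, zero_mul, add_zero] at h1
  have g1 := D2'_nonneg u y
  unfold VV gg
  have p1 : 0 ≤ 3 * (δ ^ 2 / 2)⁻¹ ^ 2 := by positivity
  have p2 : 0 ≤ 3 * ((n:ℝ) * (n+1) * (δ ^ 2 / 2)⁻¹ ^ 2) := by positivity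
  have p3 : 0 ≤ 6 * δ⁻¹ ^ 2 := by positivity
  have q1 := sq_nonneg (dd et u y)
  have q2 := sq_nonneg (mp a u y)
  generalize mp a u y ^ 2 = F at *
  generalize dd et u y ^ 2 = t at *
  generalize D2' u y = D at *
  generalize D2 u y = E at *
  generalize Lt _ _ u y ^ 2 = P at *
  generalize 3 * (δ ^ 2 / 2)⁻¹ ^ 2 = c1 at *
  generalize 3 * ((n:ℝ) * (n+1) * (δ ^ 2 / 2)⁻¹ ^ 2) = c2 at *
  have : P ≤ 2 * δ⁻¹ ^ 2 * F := h1
  generalize δ⁻¹ ^ 2 = c3 at *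
  nlinarith [mul_nonneg p1 g1, mul_nonneg p1 q2, mul_nonneg p2 q1, mul_nonneg p2 q2, mul_nonneg p3 g1, mul_nonneg p3 q1]
lemma level (hδ : 0 < δ) (hm : ∀ j k, Measurable fun q => a q j k) (hE : ∀ y, Ell δ (a y))
    (hu : CT u) {B L lam N0 E C4 C5 c5 K2 : ℝ} (hl : 0 < lam) (hB : 1 ≤ B) (hR : 0 < R) (hN : 1 ≤ N0) (hE0 : 0 ≤ E)
    (hC4 : 0 ≤ C4) (hC5 : 0 ≤ C5) (hK2 : 0 ≤ K2)
    (hgood : ∀ z ∈ Hs n s, ∀ r, 0 < r → 16 * r ≤ R → JJ s z (16 * r) (mm a u B L lam) ≤ lam * (16 * r) ^ (n+3) →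
      lam * r ^ (n+3) ≤ JJ s z r (mm a u B L lam) → JJ s z (3 * r) (tr (N0 * lam) (gg u)) ≤ E * JJ s z r (mm a u B L lam))
    (hbad : ∀ z ∈ Hs n s, lam * R ^ (n+3) ≤ JJ s z R (mm a u B L lam) → lam * R ^ (n+3) ≤ C4 * JJ s z (2 * R) (tr L (VV u)) +
      C5 * (JJ s z (2 * R) (tr (c5 * lam) (fun y => mp a u y ^ 2)) + JJ s z (2 * R) (tr (c5 * lam) (fun y => u y ^ 2)))) :
    ∫⁻ y in Hs n s, ofReal (tr (N0 * lam) (gg u) y) ≤ (∫⁻ y in Hs n s, ofReal (E * mm a u B L lam y)) +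
      ((∫⁻ y in Hs n s, ofReal (tr (K2 * lam) (VV u) y)) +
       ∫⁻ y in Hs n s, ofReal (K2 * (2 ^ (n+2) * 6 ^ (n+3) * (C4 * tr L (VV u) y +
        C5 * (tr (c5 * lam) (fun y => mp a u y ^ 2) y + tr (c5 * lam) (fun y => u y ^ 2) y))))) := by
  have B0 : 0 ≤ B := by linarith
  have bG := tr_bdd (c := N0 * lam) (gg_bdd hu)
  have bm := mm_bdd hδ hm hE hu B L lam
  have m0 := mm_nonneg (a := a) (u := u) (L := L) (lam := lam) B0
  have G0 := tr_nonneg (c := N0 * lam) (gg_nonneg u)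
  obtain ⟨S, hS⟩ : ∃ S : Set (En n), S = Hs n s ∩ {y | N0 * lam < gg u y} := ⟨_, rfl⟩
  have mS : MeasurableSet S := by rw [hS]; exact (Hs_meas s).inter (measurableSet_lt measurable_const (gg_bdd hu).1)
  have lN : lam ≤ N0 * lam := by nlinarith
  have sel : ∀ z, ∃ r : ℝ, z ∈ S → JJ s z R (mm a u B L lam) ≤ lam * R ^ (n+3) → 0 < r ∧ 16 * r ≤ R ∧
      JJ s z (16 * r) (mm a u B L lam) ≤ lam * (16 * r) ^ (n+3) ∧ lam * r ^ (n+3) ≤ JJ s z r (mm a u B L lam) := by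
    intro z
    by_cases hz : z ∈ S ∧ JJ s z R (mm a u B L lam) ≤ lam * R ^ (n+3)
    swap
    · exact ⟨0, fun h1 h2 => (hz ⟨h1, h2⟩).elim⟩
    obtain ⟨hz, h0⟩ := hz
    rw [hS] at hz
    obtain ⟨r0, r00, hr0⟩ := small_r hδ hm hE hu (B := B) (L := L) hl B0 hz.1 (lN.trans_lt hz.2)
    have ex : ∃ k : ℕ, lam * (R / 16 ^ k) ^ (n+3) < JJ s z (R / 16 ^ k) (mm a u B L lam) := by
      obtain ⟨k, hk⟩ := exists_pow_lt_of_lt_one (show 0 < r0 / R by positivity) (show (1 / 16 : ℝ) < 1 by norm_num)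
      refine ⟨k, hr0 _ (by positivity) ?_⟩
      rw [one_div, inv_pow, lt_div_iff₀ hR] at hk
      rw [div_eq_inv_mul]; exact hk
    classical
    obtain ⟨k, hk, hmin⟩ : ∃ k : ℕ, lam * (R / 16 ^ k) ^ (n+3) < JJ s z (R / 16 ^ k) (mm a u B L lam) ∧
      ∀ i < k, ¬ lam * (R / 16 ^ i) ^ (n+3) < JJ s z (R / 16 ^ i) (mm a u B L lam) := ⟨Nat.find ex, Nat.find_spec ex, fun i hi => Nat.find_min ex hi⟩
    rcases k with _ | k
    · simp at hk; linarith
    have e16 : 16 * (R / 16 ^ (k+1)) = R / 16 ^ k := by rw [pow_succ]; field_simp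
    refine ⟨R / 16 ^ (k+1), fun _ _ => ⟨by positivity, ?_, ?_, hk.le⟩⟩
    · rw [e16]; exact div_le_self hR.le (one_le_pow₀ (by norm_num))
    · rw [e16]; exact not_lt.1 (hmin k (Nat.lt_succ_self k))
  choose ρ hρ using sel
  obtain ⟨Sg, hSg⟩ : ∃ Sg : Set (En n), Sg = S ∩ {z | JJ s z R (mm a u B L lam) ≤ lam * R ^ (n+3)} := ⟨_, rfl⟩
  obtain ⟨Sb, hSb⟩ : ∃ Sb : Set (En n), Sb = S ∩ {z | lam * R ^ (n+3) ≤ JJ s z R (mm a u B L lam)} := ⟨_, rfl⟩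
  have SHs : ∀ z ∈ S, z ∈ Hs n s := fun z hz => by rw [hS] at hz; exact hz.1
  have cov : S ⊆ Sg ∪ Sb := fun z hz => by
    rw [hSg, hSb]
    rcases le_total (JJ s z R (mm a u B L lam)) (lam * R ^ (n+3)) with h | h
    exacts [Or.inl ⟨hz, h⟩, Or.inr ⟨hz, h⟩]
  have hg' : ∀ z ∈ Sg, _ := fun z hz => by rw [hSg] at hz; exact hρ z hz.1 hz.2
  have v1 : wd s (tr (N0 * lam) (gg u)) Sg ≤ wd s (fun y => E * mm a u B L lam y) Set.univ := by
    refine vitali _ _ Sg ρ R (fun z hz => (hg' z hz).1) (fun z hz => by linarith [(hg' z hz).1, (hg' z hz).2.1]) fun z hz => ?_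
    obtain ⟨r0, r1, r2, r3⟩ := hg' z hz
    rw [wd_Qb bG G0, wd_Qb (by fun_prop) (fun y => mul_nonneg hE0 (m0 y)), JJ_cmul]
    exact ofReal_le_ofReal (hgood z (SHs z (by rw [hSg] at hz; exact hz.1)) _ r0 r1 r2 r3)
  have bV := tr_bdd (c := L) (VV_bdd hu)
  have bF := tr_bdd (c := c5 * lam) (f := fun y => mp a u y ^ 2) ((mp_bdd hδ hm hE hu).pow 2)
  have bU := tr_bdd (c := c5 * lam) (f := fun y => u y ^ 2) (hu.bdd.pow 2)
  have V0 := tr_nonneg (c := L) (VV_nonneg u)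
  have F0 := tr_nonneg (c := c5 * lam) (f := fun y => mp a u y ^ 2) (fun y => sq_nonneg _)
  have U0 := tr_nonneg (c := c5 * lam) (f := fun y => u y ^ 2) (fun y => sq_nonneg _)
  obtain ⟨q, hq⟩ : ∃ q : Fu n, q = fun y => K2 * (2 ^ (n+2) * 6 ^ (n+3) * (C4 * tr L (VV u) y +
        C5 * (tr (c5 * lam) (fun y => mp a u y ^ 2) y + tr (c5 * lam) (fun y => u y ^ 2) y))) := ⟨_, rfl⟩
  have bq : Bdd q := by rw [hq]; fun_prop
  have q0 : ∀ y, 0 ≤ q y := fun y => by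
    have := V0 y; have := F0 y; have := U0 y
    rw [hq]; positivity
  have v2 : (ofReal (K2 * lam) • (volume : Measure (En n))) Sb ≤ wd s q Set.univ := by
    refine vitali _ _ Sb (fun _ => 2 * R) (2 * R) (fun z hz => by positivity) (fun z hz => le_rfl) fun z hz => ?_
    rw [hSb] at hz
    have h := hbad z (SHs z hz.1) hz.2
    rw [wd_Qb bq q0, Measure.smul_apply, Qb_vol z (by positivity), smul_eq_mul, ← ofReal_mul (by positivity)]
    refine ofReal_le_ofReal ?_
    rw [hq, JJ_cmul, JJ_cmul, JJ_add (by fun_prop) (by fun_prop), JJ_cmul, JJ_cmul, JJ_add bF bU]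
    calc _ = K2 * (2 ^ (n+2) * 6 ^ (n+3) * (lam * R ^ (n+3))) := by
          rw [show 3 * (2 * R) = 6 * R by ring, mul_pow]; ring
      _ ≤ _ := by gcongr
  have v3 : wd s (tr (N0 * lam) (gg u)) Sb ≤ wd s (tr (K2 * lam) (VV u)) Set.univ + (ofReal (K2 * lam) • (volume : Measure (En n))) Sb := by
    have le : wd s (tr (N0 * lam) (gg u)) ≤ wd s (tr (K2 * lam) (VV u)) + ofReal (K2 * lam) • volume.restrict (Hs n s) := by
      unfold wd
      rw [← withDensity_const, ← withDensity_add_left ((tr_bdd (VV_bdd hu)).1.ennreal_ofReal)]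
      refine withDensity_mono (evf fun y => ?_)
      simp only [Pi.add_apply]
      rw [← ofReal_add (tr_nonneg (VV_nonneg u) y) (by positivity)]
      exact ofReal_le_ofReal ((tr_le (gg_nonneg u) y).trans ((gg_le_VV y).trans (le_tr _ (by positivity) y)))
    refine (le Sb).trans ?_
    rw [Measure.add_apply, Measure.smul_apply, Measure.smul_apply, smul_eq_mul, smul_eq_mul]
    gcongr
    · exact Set.subset_univ _
    · exact Measure.restrict_le_self
  have v4 : wd s (tr (N0 * lam) (gg u)) Set.univ = wd s (tr (N0 * lam) (gg u)) S := by
    rw [wd_univ, wd, withDensity_apply _ mS, Measure.restrict_restrict mS, ← setLIntegral_indicator mS]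
    refine setLIntegral_congr_fun (Hs_meas s) fun y hy => ?_
    by_cases h : y ∈ S
    · simp only [indicator_of_mem h]
    · simp only [indicator_of_notMem h]
      have : ¬ N0 * lam < gg u y := fun h' => h (by rw [hS]; exact ⟨hy, h'⟩)
      simp [tr, this]
  rw [← wd_univ, ← wd_univ, ← wd_univ, v4]
  calc _ ≤ wd s (tr (N0 * lam) (gg u)) Sg + wd s (tr (N0 * lam) (gg u)) Sb := (measure_mono cov).trans (measure_union_le _ _)
    _ ≤ wd s (fun y => E * mm a u B L lam y) Set.univ + (wd s (tr (K2 * lam) (VV u)) Set.univ + wd s q Set.univ) := by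
        refine add_le_add v1 (v3.trans ?_)
        gcongr
    _ = _ := by rw [wd_univ s q, hq]
end vit
section lay
lemma lc1 {θ x : ℝ} (hq : 1 < q) (hθ : 0 < θ) (hx : 0 ≤ x) :
    ∫⁻ l in Ioi (0:ℝ), ofReal (l ^ (q - 2)) * ofReal (if θ * l < x then x else 0) =
      ofReal (θ ^ (1 - q) / (q - 1)) * ofReal (x ^ q) := by
  rcases hx.eq_or_lt with rfl | hx
  · rw [zero_rpow (by linarith)]
    simp
  have e1 : ∀ l ∈ Ioi (0:ℝ), ofReal (l ^ (q - 2)) * ofReal (if θ * l < x then x else 0) =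
      (Set.Iio (x / θ)).indicator (fun l => ofReal x * ofReal (l ^ (q - 2))) l := by
    intro l hl
    by_cases h : θ * l < x
    · rw [if_pos h, indicator_of_mem (by rw [Set.mem_Iio, lt_div_iff₀ hθ]; linarith), mul_comm]
    · rw [if_neg h, indicator_of_notMem (by rw [Set.mem_Iio, lt_div_iff₀ hθ]; linarith)]; simp
  rw [setLIntegral_congr_fun measurableSet_Ioi e1, setLIntegral_indicator measurableSet_Iio, lintegral_const_mul' _ _ ofReal_ne_top,
    Set.Iio_inter_Ioi]
  have hx' : 0 < x / θ := by positivity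
  have hint : IntegrableOn (fun l : ℝ => l ^ (q - 2)) (Ioo 0 (x / θ)) :=
    ((intervalIntegral.integrableOn_Ioo_rpow_iff hx').2 (by linarith))
  rw [← ofReal_integral_eq_lintegral_ofReal hint ((ae_restrict_iff' measurableSet_Ioo).2 (evf fun l hl => rpow_nonneg hl.1.le _)),
    ← integral_Ioc_eq_integral_Ioo, ← intervalIntegral.integral_of_le hx'.le, integral_rpow (Or.inl (by linarith)),
    zero_rpow (by linarith), ← ofReal_mul hx.le, ← ofReal_mul (by have : 0 < q - 1 := (by linarith); positivity)]
  congr 1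
  rw [show q - 2 + 1 = q - 1 by ring, Real.div_rpow hx.le hθ.le, show (1 - q) = -(q - 1) by ring, Real.rpow_neg hθ.le,
    show x ^ q = x ^ (q - 1) * x by rw [← Real.rpow_add_one hx.ne']; congr 1; ring]
  have : θ ^ (q - 1) ≠ 0 := (Real.rpow_pos_of_pos hθ _).ne'
  have : q - 1 ≠ 0 := by linarith
  field_simp
  ring
noncomputable def XX (s θ : ℝ) (f : Fu n) (l : ℝ) : ℝ≥0∞ := ∫⁻ y in Hs n s, ofReal (tr (θ * l) f y)
lemma tr_jm {θ : ℝ} (hf : Measurable f) : Measurable fun z : ℝ × En n => ofReal (tr (θ * z.1) f z.2) := by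
  unfold tr
  refine Measurable.ennreal_ofReal (Measurable.ite (measurableSet_lt ?_ ?_) ?_ measurable_const) <;> fun_prop
lemma XX_meas {θ : ℝ} (hf : Measurable f) : Measurable (XX s θ f) := (tr_jm hf).lintegral_prod_right'
lemma lc {θ : ℝ} (hq : 1 < q) (hθ : 0 < θ) (hf : Measurable f) (h0 : ∀ y, 0 ≤ f y) (s : ℝ) :
    ∫⁻ l in Ioi (0:ℝ), ofReal (l ^ (q - 2)) * XX s θ f l =
      ofReal (θ ^ (1 - q) / (q - 1)) * ∫⁻ y in Hs n s, ofReal (f y ^ q) := by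
  have e : ∀ l, ofReal (l ^ (q - 2)) * XX s θ f l = ∫⁻ y in Hs n s, ofReal (l ^ (q - 2)) * ofReal (tr (θ * l) f y) :=
    fun l => (lintegral_const_mul' _ _ ofReal_ne_top).symm
  simp_rw [e]
  rw [lintegral_lintegral_swap, ← lintegral_const_mul' _ _ ofReal_ne_top]
  · refine lintegral_congr fun y => ?_
    exact lc1 hq hθ (h0 y)
  · refine Measurable.aemeasurable (Measurable.mul ?_ (tr_jm hf))
    exact (measurable_fst.pow_const _).ennreal_ofReal
lemma li_c {μ : Measure (En n)} {c : ℝ} (hc : 0 ≤ c) (f : Fu n) : ∫⁻ y, ofReal (c * f y) ∂μ = ofReal c * ∫⁻ y, ofReal (f y) ∂μ := by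
  simp_rw [ofReal_mul hc]
  exact lintegral_const_mul' _ _ ofReal_ne_top
lemma li_a {μ : Measure (En n)} (hf : Measurable f) (f0 : ∀ y, 0 ≤ f y) (g0 : ∀ y, 0 ≤ g y) :
    ∫⁻ y, ofReal (f y + g y) ∂μ = ∫⁻ y, ofReal (f y) ∂μ + ∫⁻ y, ofReal (g y) ∂μ := by
  simp_rw [ofReal_add (f0 _) (g0 _)]
  exact lintegral_add_left hf.ennreal_ofReal _
noncomputable def PW (s q : ℝ) (f : Fu n) : ℝ := ∫ y in Hs n s, f y ^ q
lemma pw_int (hq : 0 < q) (hf : Bdd f) (h0 : ∀ y, 0 ≤ f y) (hu : CT u) (hz : ∀ z, z ∉ tsupport u → f z = 0) :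
    Integrable (fun y => f y ^ q) := by
  refine Bdd.integ' (S := tsupport u) ?_ hu.2.measure_lt_top.ne fun z hz' => by rw [hz z hz', zero_rpow hq.ne']
  obtain ⟨m, M, hM⟩ := hf
  refine ⟨m.pow_const q, M ^ q, fun z => ?_⟩
  have h := h0 z
  rw [abs_of_nonneg (by positivity)]
  exact rpow_le_rpow h ((le_abs_self _).trans (hM z)) hq.le
lemma pw_li (h0 : ∀ y, 0 ≤ f y) (hi : Integrable fun y => f y ^ q) (s : ℝ) :
    ∫⁻ y in Hs n s, ofReal (f y ^ q) = ofReal (PW s q f) :=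
  (ofReal_integral_eq_lintegral_ofReal hi.integrableOn (evf fun y => rpow_nonneg (h0 y) _)).symm
lemma PW_nonneg (h0 : ∀ y, 0 ≤ f y) : 0 ≤ PW s q f := integral_nonneg fun y => rpow_nonneg (h0 y) _
lemma layered (hq : 1 < q) {F U : Fu n} (bg : Bdd g) (bv : Bdd v) (bF : Bdd F) (bU : Bdd U)
    (g0 : ∀ y, 0 ≤ g y) (v0 : ∀ y, 0 ≤ v y) (F0 : ∀ y, 0 ≤ F y) (U0 : ∀ y, 0 ≤ U y) 
    (ig : Integrable fun y => g y ^ q) (iv : Integrable fun y => v y ^ q) (iF : Integrable fun y => F y ^ q) (iU : Integrable fun y => U y ^ q)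
    {N0 E B K K2 c C4 C5 c5 : ℝ} (hN0 : 0 < N0) (hE : 0 ≤ E) (hB : 0 ≤ B) (hK : 0 < K) (hK2 : 0 < K2) (hc : 0 ≤ c) (hC4 : 0 ≤ C4) (hC5 : 0 ≤ C5) (hc5 : 0 < c5)
    (h : ∀ l, 0 < l → ∫⁻ y in Hs n s, ofReal (tr (N0 * l) g y) ≤ 
      (∫⁻ y in Hs n s, ofReal (E * (tr l g y + (tr l (fun y => B * F y) y + B * tr (K * l) v y)))) +
      ((∫⁻ y in Hs n s, ofReal (tr (K2 * l) v y)) +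
       ∫⁻ y in Hs n s, ofReal (K2 * (c * (C4 * tr (K * l) v y +
        C5 * (tr (c5 * l) F y + tr (c5 * l) U y)))))) :
    N0 ^ (1 - q) * PW s q g ≤ E * (PW s q g + (B ^ q * PW s q F + B * (K ^ (1 - q) * PW s q v))) + (K2 ^ (1 - q) * PW s q v +
      K2 * (c * (C4 * (K ^ (1 - q) * PW s q v) + C5 * (c5 ^ (1 - q) * PW s q F + c5 ^ (1 - q) * PW s q U)))) := by
  have BF0 : ∀ y, 0 ≤ B * F y := fun y => mul_nonneg hB (F0 y)
  have bBF : Bdd fun y => B * F y := by fun_prop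
  have t0 : ∀ {c} {f : Fu n}, (∀ y, 0 ≤ f y) → ∀ y, 0 ≤ tr c f y := fun h y => tr_nonneg h y
  have h' : ∀ l, 0 < l → XX s N0 g l ≤ ofReal E * (XX s 1 g l + (XX s 1 (fun y => B * F y) l + ofReal B * XX s K v l)) +
      (XX s K2 v l + ofReal K2 * (ofReal c * (ofReal C4 * XX s K v l + ofReal C5 * (XX s c5 F l + XX s c5 U l)))) := by
    intro l hl
    have := h l hl
    have b0 : ∀ y, 0 ≤ B * tr (K * l) v y := fun y => mul_nonneg hB (t0 v0 y)
    have b1 : ∀ y, 0 ≤ tr (c5 * l) F y + tr (c5 * l) U y := fun y => add_nonneg (t0 F0 y) (t0 U0 y)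
    rw [li_c hE, li_a (tr_meas bg.1) (t0 g0) (fun y => add_nonneg (t0 BF0 y) (b0 y)), li_a (tr_meas bBF.1) (t0 BF0) b0, li_c hB, li_c hK2.le, li_c hc,
      li_a ((tr_meas bv.1).const_mul _) (fun y => mul_nonneg hC4 (t0 v0 y)) (fun y => mul_nonneg hC5 (b1 y)), li_c hC4, li_c hC5, li_a (tr_meas bF.1) (t0 F0) (t0 U0)] at this
    simpa only [XX, one_mul] using this
  obtain ⟨Y, hY⟩ : ∃ Y : ℝ → (Fu n) → ℝ → ℝ≥0∞, Y = fun θ f l => ofReal (l ^ (q - 2)) * XX s θ f l := ⟨_, rfl⟩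
  have mY : ∀ θ f, Measurable f → Measurable (Y θ f) := fun θ f hf => by
    rw [hY]; exact Measurable.mul ((measurable_id.pow_const _).ennreal_ofReal) (XX_meas hf)
  have iY : ∀ θ f, 0 < θ → Bdd f → (∀ y, 0 ≤ f y) → (Integrable fun y => f y ^ q) →
      ∫⁻ l in Ioi (0:ℝ), Y θ f l = ofReal ((q - 1)⁻¹ * (θ ^ (1 - q) * PW s q f)) := fun θ f hθ hf h0 hi => by
    rw [hY]
    simp only
    rw [lc hq hθ hf.1 h0, pw_li h0 hi, ← ofReal_mul (by have : 0 < q - 1 := (by linarith); positivity)]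
    congr 1
    ring
  have m1 := mY 1 g bg.1
  have m2 := mY 1 _ bBF.1
  have m3 := mY K v bv.1
  have m4 := mY K2 v bv.1
  have m5 := mY c5 F bF.1
  have m6 := mY c5 U bU.1
  have h2 : ∀ l ∈ Ioi (0:ℝ), Y N0 g l ≤ ofReal E * (Y 1 g l + (Y 1 (fun y => B * F y) l + ofReal B * Y K v l)) +
      (Y K2 v l + ofReal K2 * (ofReal c * (ofReal C4 * Y K v l + ofReal C5 * (Y c5 F l + Y c5 U l)))) := by
    intro l hl
    have := mul_le_mul_right (h' l hl) (ofReal (l ^ (q - 2)))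
    rw [hY]
    refine this.trans (le_of_eq ?_)
    simp only
    ring
  have h3 := setLIntegral_mono (μ := volume) (s := Ioi (0:ℝ)) (by fun_prop) h2
  have iBF : Integrable fun y => (B * F y) ^ q := by
    simp_rw [fun y => mul_rpow hB (F0 y) (z := q)]
    exact iF.const_mul _
  have eBF : PW s q (fun y => B * F y) = B ^ q * PW s q F := by
    unfold PW
    simp_rw [fun y => mul_rpow hB (F0 y) (z := q)]
    exact integral_const_mul _ _
  rw [lintegral_add_left (by fun_prop), lintegral_add_left m4, lintegral_const_mul _ (by fun_prop), lintegral_const_mul _ (by fun_prop),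
    lintegral_add_left m1, lintegral_add_left m2, lintegral_const_mul _ (by fun_prop), lintegral_const_mul _ (by fun_prop), 
    lintegral_add_left (by fun_prop), lintegral_const_mul _ (by fun_prop), lintegral_const_mul _ (by fun_prop), lintegral_add_left m5,
    iY _ _ hN0 bg g0 ig, iY _ _ one_pos bg g0 ig, iY _ _ one_pos bBF BF0 iBF, iY _ _ hK bv v0 iv, iY _ _ hK2 bv v0 iv, iY _ _ hc5 bF F0 iF, iY _ _ hc5 bU U0 iU,
    eBF] at h3
  have q1 : 0 < q - 1 := by linarith
  have := PW_nonneg (s := s) (q := q) g0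
  have := PW_nonneg (s := s) (q := q) v0
  have := PW_nonneg (s := s) (q := q) F0
  have := PW_nonneg (s := s) (q := q) U0
  rw [Real.one_rpow] at h3
  repeat rw [← ofReal_mul (by positivity)] at h3
  repeat first | rw [← ofReal_add (by positivity) (by positivity)] at h3 | rw [← ofReal_mul (by positivity)] at h3
  rw [ENNReal.ofReal_le_ofReal_iff (by positivity)] at h3
  refine le_of_mul_le_mul_left (h3.trans (le_of_eq ?_)) (inv_pos.2 q1)
  ring
end lay
section est
lemma absorb {n1 G V F U E b B k k2 K2 c C4 C5 m C6 : ℝ} (hn : 0 < n1) (G0 : 0 ≤ G) (F0 : 0 ≤ F) (U0 : 0 ≤ U) (hC6 : 0 ≤ C6)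
    (hE0 : 0 ≤ E) (hb : 0 ≤ b) (hB : 0 ≤ B) (hk : 0 ≤ k) (hk2 : 0 ≤ k2) (hK2 : 0 ≤ K2) (hc : 0 ≤ c) (hC4 : 0 ≤ C4) (hC5 : 0 ≤ C5) (hm : 0 ≤ m)
    (h : n1 * G ≤ E * (G + (b * F + B * (k * V))) + (k2 * V + K2 * (c * (C4 * (k * V) + C5 * (m * F + m * U)))))
    (hE : E ≤ n1 / 4) (hV : V ≤ C6 * (G + F)) (h2 : k2 * C6 ≤ n1 / 4) (h3 : k * ((E * B + K2 * c * C4) * C6) ≤ n1 / 4) :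
    V ≤ C6 * (4 / n1 * (E * b + n1 / 2 + K2 * c * C5 * m) + 1) * (F + U) := by
  obtain ⟨x, hx⟩ : ∃ x, x = K2 * c * C5 * m := ⟨_, rfl⟩
  obtain ⟨e, he⟩ : ∃ e, e = E * B + K2 * c * C4 := ⟨_, rfl⟩
  have e0 : 0 ≤ e := by rw [he]; positivity
  have x0 : 0 ≤ x := by rw [hx]; positivity
  rw [← he] at h3
  rw [← hx]
  have h4 : n1 * G ≤ E * G + E * b * F + (k * e + k2) * V + x * (F + U) := by
    rw [he, hx]; linarith [h]
  have h5 : (k * e + k2) * V ≤ n1 / 2 * (G + F) := by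
    calc (k * e + k2) * V ≤ (k * e + k2) * (C6 * (G + F)) := by gcongr
      _ = (k * (e * C6) + k2 * C6) * (G + F) := by ring
      _ ≤ (n1 / 4 + n1 / 4) * (G + F) := by gcongr
      _ = _ := by ring
  have h6 : E * G ≤ n1 / 4 * G := by gcongr
  have h7 : n1 / 4 * G ≤ (E * b + n1 / 2 + x) * (F + U) := by
    have : 0 ≤ (E * b + n1 / 2) * U := by positivity
    linarith
  have h8 : G ≤ 4 / n1 * (E * b + n1 / 2 + x) * (F + U) := by
    have := mll h7 (show 0 ≤ 4 / n1 by positivity)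
    rw [show 4 / n1 * (n1 / 4 * G) = G by field_simp] at this
    linarith
  calc V ≤ C6 * (G + F) := hV
    _ ≤ C6 * (4 / n1 * (E * b + n1 / 2 + x) * (F + U) + (F + U)) := by gcongr; linarith
    _ = _ := by ring
lemma ex_k (hq : 1 < q) {X e : ℝ} (hX : 0 ≤ X) (he : 0 < e) : ∃ k : ℝ, 0 < k ∧ k ^ (1 - q) * X ≤ e := by
  refine ⟨(e / (X + 1)) ^ (1 / (1 - q)), by positivity, ?_⟩
  rw [← rpow_mul (by positivity), one_div_mul_cancel (by linarith), Real.rpow_one, div_mul_eq_mul_div, div_le_iff₀ (by positivity)]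
  nlinarith
lemma off_dd (e : En n) (hz : z ∉ tsupport u) : z ∉ tsupport (dd e u) := by
  rw [notMem_tsupport_iff_eventuallyEq] at *
  have := hz.fderiv (𝕜 := ℝ)
  filter_upwards [this] with y hy
  simp [dd, hy]
lemma off0 (hz : z ∉ tsupport u) : u z = 0 := image_eq_zero_of_notMem_tsupport hz
lemma off_VV (hz : z ∉ tsupport u) : VV u z = 0 := by
  simp [VV, D2, off0 (off_dd _ hz), off0 (off_dd _ (off_dd _ hz))]
lemma off_gg (hz : z ∉ tsupport u) : gg u z = 0 :=
  le_antisymm ((gg_le_VV z).trans (off_VV hz).le) (gg_nonneg u z)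
lemma off_mp (a : Fm n) (hz : z ∉ tsupport u) : mp a u z = 0 := by
  simp [mp, off0 (off_dd _ hz), off0 (off_dd _ (off_dd _ hz))]
lemma two_rpow {x y : ℝ} (hq : 0 ≤ q) (hx : 0 ≤ x) (hy : 0 ≤ y) : (x + y) ^ q ≤ 2 ^ q * (x ^ q + y ^ q) := by
  have h : x + y ≤ 2 * max x y := by linarith [le_max_left x y, le_max_right x y]
  have h0 : 0 ≤ max x y := hx.trans (le_max_left _ _)
  calc (x + y) ^ q ≤ (2 * max x y) ^ q := rpow_le_rpow (by positivity) h hq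
    _ = 2 ^ q * (max x y) ^ q := mul_rpow (by norm_num) h0
    _ ≤ _ := by
      gcongr
      have := rpow_nonneg hx q
      have := rpow_nonneg hy q
      rcases max_choice x y with h | h <;> rw [h] <;> linarith
lemma main_est (n : ℕ) (δ : ℝ) (hδ : 0 < δ) (hδ1 : δ < 1) (hn : 1 ≤ n) (q : ℝ) (hq : 1 < q)
    (om : ℝ → ℝ) (hom : ContinuousOn om (Ici 0)) (hom0 : om 0 = 0) : ∃ C, 0 ≤ C ∧ ∀ (a : Fm n),
    (∀ j k, Measurable fun q => a q j k) → (∀ y, Ell δ (a y)) → (∀ R, 0 ≤ R → aSharp a R ≤ om R) → ∀ u, CT u → ∀ s,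
    PW s q (VV u) ≤ C * (PW s q (fun y => mp a u y ^ 2) + PW s q (fun y => u y ^ 2)) := by
  obtain ⟨N0, C2, hN0, hC2, Hg⟩ := good n δ hδ hδ1 hn
  obtain ⟨Cv, hCv, Hv⟩ := VV_le n δ hδ hδ1
  obtain ⟨C6, hC6⟩ : ∃ C6 : ℝ, C6 = Cv ^ q * 2 ^ q := ⟨_, rfl⟩
  have C60 : 0 ≤ C6 := by rw [hC6]; positivity
  obtain ⟨n1, hn1⟩ : ∃ n1 : ℝ, n1 = N0 ^ (1 - q) := ⟨_, rfl⟩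
  have n10 : 0 < n1 := by rw [hn1]; positivity
  obtain ⟨ε, hε⟩ : ∃ ε : ℝ, ε = min 1 (n1 / 4 / (C2 + 1)) := ⟨_, rfl⟩
  have ε0 : 0 < ε := by rw [hε]; positivity
  have hE : C2 * ε ≤ n1 / 4 := by
    have : ε ≤ n1 / 4 / (C2 + 1) := by rw [hε]; exact min_le_right _ _
    rw [le_div_iff₀ (by positivity)] at this
    nlinarith
  obtain ⟨B, η, hB, hη, Hg⟩ := Hg ε ε0 (by rw [hε]; exact min_le_left _ _)
  obtain ⟨η', hη', Hb⟩ := bad n δ hδ hδ1 hn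
  obtain ⟨C4, hC4, Hb⟩ := Hb B hB
  obtain ⟨K2, K20, hK2⟩ := ex_k hq C60 (show 0 < n1 / 4 by positivity)
  obtain ⟨c, hc⟩ : ∃ c : ℝ, c = 2 ^ (n+2) * 6 ^ (n+3) := ⟨_, rfl⟩
  have c0 : 0 ≤ c := by rw [hc]; positivity
  have B0 : 0 ≤ B := by linarith
  have E0 : 0 ≤ C2 * ε := by positivity
  obtain ⟨K, K0, hK⟩ := ex_k (X := ((C2 * ε) * B + K2 * c * C4) * C6) hq (by positivity) (show 0 < n1 / 4 by positivity)
  obtain ⟨κ, hκ⟩ : ∃ κ : ℝ, κ = min η η' / K := ⟨_, rfl⟩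
  have κ0 : 0 < κ := by rw [hκ]; have := lt_min hη hη'; positivity
  have κ1 : K * κ ≤ η := by rw [hκ, mul_div_cancel₀ _ K0.ne']; exact min_le_left _ _
  have κ2 : K * κ ≤ η' := by rw [hκ, mul_div_cancel₀ _ K0.ne']; exact min_le_right _ _
  obtain ⟨R', R'0, hR'⟩ : ∃ R' : ℝ, 0 < R' ∧ om R' ≤ κ := by
    have h := Metric.continuousOn_iff.1 hom 0 (by simp) κ κ0
    obtain ⟨d, d0, hd⟩ := h
    refine ⟨d / 2, by positivity, ?_⟩
    have := hd (d / 2) (by simp; positivity) (by rw [dist_eq, sub_zero, abs_of_pos (by positivity)]; linarith)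
    rw [dist_eq, hom0, sub_zero] at this
    exact (le_abs_self _).trans this.le
  obtain ⟨R, hR⟩ : ∃ R : ℝ, R = R' / ((n+1) * 9) := ⟨_, rfl⟩
  have R0 : 0 < R := by rw [hR]; positivity
  have hRR : (n+1) * (9 * R) = R' := by rw [hR]; field_simp
  obtain ⟨C5, c5, hC5, hc5, Hb⟩ := Hb R R0
  refine ⟨C6 * (4 / n1 * (C2 * ε * B ^ q + n1 / 2 + K2 * c * C5 * c5 ^ (1 - q)) + 1), by positivity, fun a hm hE' hom' u hu s => ?_⟩
  have hosc : ∀ ρ, 0 < ρ → ρ ≤ 9 * R → ∀ z : En n, oscA a ((n+1) * ρ) z.1 z.2 ≤ κ := fun ρ h1 h2 z =>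
    (osc_sharp hδ hE' (by positivity) (by rw [← hRR]; gcongr) z).trans ((hom' R' R'0.le).trans hR')
  have bg := gg_bdd hu
  have bv := VV_bdd hu
  have bF := (mp_bdd hδ hm hE' hu).pow 2
  have bU := hu.bdd.pow 2
  have q0 : 0 < q := by linarith
  have F0 : ∀ y, 0 ≤ mp a u y ^ 2 := fun y => sq_nonneg _
  have U0 : ∀ y, 0 ≤ u y ^ 2 := fun y => sq_nonneg _
  have ig := pw_int q0 bg (gg_nonneg u) hu fun z hz => off_gg hz
  have iv := pw_int q0 bv (VV_nonneg u) hu fun z hz => off_VV hz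
  have iF := pw_int q0 bF F0 hu fun z hz => by rw [off_mp a hz]; simp
  have iU := pw_int q0 bU U0 hu fun z hz => by rw [off0 hz]; simp
  have key := layered (s := s) hq bg bv bF bU (gg_nonneg u) (VV_nonneg u) F0 U0 ig iv iF iU (N0 := N0) (E := C2 * ε) (B := B) (K := K) (K2 := K2) (c := c)
    (C4 := C4) (C5 := C5) (c5 := c5) (by linarith) E0 B0 K0 K20 c0 hC4 hC5 hc5 (fun l hl => by
      have Kl : 0 ≤ K * l := by positivity
      have := level hδ hm hE' hu (L := K * l) (s := s) hl hB R0 hN0 E0 hC4 hC5 (c5 := c5) K20.le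
        (fun z hz r r0 hr => Hg a hm hE' u hu s z hz r r0 κ (K * l) l hl Kl (hosc _ (by positivity) (by linarith) (z.1 - (3 * (3 * r)) ^ 2, z.2)) (by nlinarith))
        (fun z hz => Hb a hm hE' u hu s z κ (K * l) l hl Kl (hosc _ (by positivity) (by linarith) (z.1 - (2 * R) ^ 2, z.2)) (by nlinarith))
      rw [hc]
      exact this)
  have hV : PW s q (VV u) ≤ C6 * (PW s q (gg u) + PW s q (fun y => mp a u y ^ 2)) := by
    unfold PW
    rw [← integral_add ig.integrableOn iF.integrableOn, ← integral_const_mul]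
    refine integral_mono iv.integrableOn ((ig.add iF).const_mul C6).integrableOn fun y => ?_
    calc VV u y ^ q ≤ (Cv * (gg u y + mp a u y ^ 2)) ^ q := rpow_le_rpow (VV_nonneg u y) (Hv a hE' u hu y) q0.le
      _ = Cv ^ q * (gg u y + mp a u y ^ 2) ^ q := mul_rpow hCv (add_nonneg (gg_nonneg u y) (F0 y))
      _ ≤ Cv ^ q * (2 ^ q * (gg u y ^ q + (mp a u y ^ 2) ^ q)) := by
        gcongr
        exact two_rpow q0.le (gg_nonneg u y) (F0 y)
      _ = _ := by rw [hC6]; ring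
  rw [← hn1] at key
  exact absorb n10 (PW_nonneg (gg_nonneg u)) (PW_nonneg F0) (PW_nonneg U0) C60 E0 (by positivity) B0 (by positivity) (by positivity) K20.le c0 hC4 hC5
    (by positivity) key hE hV hK2 hK
end est
section fin
lemma diff2_le (hu : CT u) (p : ℝ) (hp : 1 ≤ p) (y : En n) (hy : 0 ≤ y.1) (s r R : ℝ) (hR : r + ‖y‖ ≤ R) :
    II s r (fun z => |u (z + y) - u z - dd y u z| ^ p) ≤ II s R (fun z => |dd y (dd y u) z| ^ p) := by
  have : IsProbabilityMeasure (volume.restrict (Ioc (0:ℝ) 1)) := ⟨by simp⟩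
  obtain ⟨m, M, hM⟩ := (hu.dd y).bdd
  have := mink (volume.restrict (Ioc (0:ℝ) 1)) p hp (fun θ z => dd y u (z + θ • y) - dd y u z)
    ((m.comp (by fun_prop)).sub (m.comp (by fun_prop))) (M + M) (fun θ z => (abs_sub _ _).trans (add_le_add (hM _) (hM _))) s r (II s R (fun z => |dd y (dd y u) z| ^ p)) (by
      refine (ae_restrict_mem measurableSet_Ioc).mono fun θ hθ => ?_
      refine (diff_le (hu.dd y) p hp (θ • y) (by simpa using mul_nonneg hθ.1.le hy) s r R ?_).trans ?_
      · rw [norm_smul, Real.norm_of_nonneg hθ.1.le]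
        have := mlr hθ.2 (norm_nonneg y)
        linarith
      · refine II_mono le_rfl (((hu.dd y).dd _).bdd.rpow p hp) (((hu.dd y).dd _).bdd.rpow p hp) (fun z => by positivity) fun z => ?_
        rw [dd_smul, abs_mul]
        refine rpow_le_rpow (by positivity) ?_ (by linarith)
        rw [abs_of_nonneg hθ.1.le]
        exact mul_le_of_le_one_left (abs_nonneg _) hθ.2)
  refine le_trans (le_of_eq ?_) this
  congr 1
  funext z
  congr 2
  rw [diff_eq hu, intervalIntegral.integral_of_le zero_le_one, integral_sub]
  · simp
  · exact ((hu.dd y).cont.comp (by fun_prop)).integrableOn_Ioc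
  · exact integrable_const _
lemma two_abs (hp : 1 ≤ p) (x y : ℝ) : |x + y| ^ p ≤ 2 ^ p * (|x| ^ p + |y| ^ p) :=
  (rpow_le_rpow (abs_nonneg _) (abs_add_le x y) (by linarith)).trans (two_rpow (by linarith) (abs_nonneg _) (abs_nonneg _))
lemma two_abs' (hp : 1 ≤ p) (x y : ℝ) : |x - y| ^ p ≤ 2 ^ p * (|x| ^ p + |y| ^ p) := by
  have := two_abs hp x (-y)
  rwa [abs_neg, ← sub_eq_add_neg] at this
noncomputable def LQ (s p : ℝ) (f : Fu n) : ℝ := ∫ y in Hs n s, |f y| ^ p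
lemma LQ_nonneg : 0 ≤ LQ s p f := integral_nonneg fun y => by positivity
lemma pn_int (hp : 1 ≤ p) (hf : Bdd f) (hu : CT u) (h0 : ∀ z, z ∉ tsupport u → f z = 0) : Integrable fun y => |f y| ^ p := by
  refine Bdd.integ' (S := tsupport u) (hf.rpow p hp) hu.2.measure_lt_top.ne fun z hz' => by rw [h0 z hz', abs_zero, zero_rpow (by linarith)]
lemma II_pn (hi : Integrable f) (h0 : ∀ y, 0 ≤ f y) : II s r f ≤ ∫ y in Hs n s, f y :=
  setIntegral_mono_set hi.integrableOn (evf h0) (LE.le.eventuallyLE inter_subset_left)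
lemma pn_II (hp : 1 ≤ p) (h0 : ∀ z, z ∉ tsupport u → f z = 0) (hr : tsupport u ⊆ ball 0 r) :
    LQ s p f = II s r (fun y => |f y| ^ p) := by
  refine setIntegral_eq_of_subset_of_forall_sdiff_eq_zero (Hs_meas s) inter_subset_left fun z hz => ?_
  rw [h0 z fun h => hz.2 ⟨hz.1, hr h⟩, abs_zero, zero_rpow (by linarith)]
lemma sup_r (hu : CT u) : ∃ r, tsupport u ⊆ ball 0 r := by
  obtain ⟨r, hr⟩ := hu.2.isBounded.subset_ball (0 : En n)
  exact ⟨r, hr⟩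
lemma LQ_cmul (c : ℝ) (f : Fu n) : LQ s p (fun y => c * f y) = |c| ^ p * LQ s p f := by
  unfold LQ
  rw [← integral_const_mul]
  refine integral_congr_ae (evf fun y => ?_)
  simp only [abs_mul]
  exact mul_rpow (abs_nonneg _) (abs_nonneg _)
lemma shift_pn (hp : 1 ≤ p) (hu : CT u) (v : En n) :
    (Integrable fun z => |u (z + v)| ^ p) ∧ ∫ z in Hs n s, |u (z + v)| ^ p = LQ (s + v.1) p u := by
  refine ⟨(pn_int hp hu.bdd hu fun z hz => off0 hz).comp_add_right v, ?_⟩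
  rw [shift_int _ (Hs_meas s) (fun z => |u z| ^ p), LQ]
  congr 2
  ext z
  simp [Hs, lt_sub_iff_add_lt]
lemma interp (hp : 1 ≤ p) (hu : CT u) (e : En n) (he : e.1 = 0) (s : ℝ) {h : ℝ} (hh : 0 < h) :
    LQ s p (dd e u) ≤ 2 ^ p * (2 ^ p * (2 * ((h ^ p)⁻¹ * LQ s p u)) + h ^ p * LQ s p (dd e (dd e u))) := by
  obtain ⟨r, hr⟩ := sup_r hu
  obtain ⟨v, hv⟩ : ∃ v : En n, v = h • e := ⟨_, rfl⟩
  have v1 : v.1 = 0 := by simp [hv, he]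
  have d1 : dd v u = fun z => h * dd e u z := by rw [hv, dd_smul]
  have d2 : dd v (dd v u) = fun z => h ^ 2 * dd e (dd e u) z := by
    funext z
    rw [hv, dd_smul h e u, dd_smul, dd_cmul h e (hu.dd e)]; ring
  have iu := pn_int hp hu.bdd hu fun z hz => off0 hz
  have b0 := hu.bdd
  have b1 := hu.bdd.shift v
  have b2 := (hu.dd v).bdd
  have b3 := ((hu.dd v).dd v).bdd
  have r1 := b1.rpow p hp
  have r0 := b0.rpow p hp
  have r4 := ((b1.sub b0).sub b2).rpow p hp
  have k1 : LQ s p (dd v u) ≤ 2 ^ p * (2 ^ p * (LQ s p u + LQ s p u) + LQ s p (dd v (dd v u))) := by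
    rw [pn_II hp (fun z hz => off0 (off_dd v hz)) hr]
    calc _ ≤ II s r (fun z => 2 ^ p * (2 ^ p * (|u (z + v)| ^ p + |u z| ^ p) + |u (z + v) - u z - dd v u z| ^ p)) := by
          refine II_mono le_rfl (b2.rpow p hp) ((Bdd.const _).mul (((Bdd.const _).mul (r1.add r0)).add r4)) (fun z => by positivity) fun z => ?_
          have h1 := two_abs' hp (u (z + v) - u z) (u (z + v) - u z - dd v u z)
          rw [sub_sub_cancel] at h1
          refine h1.trans ?_
          gcongr
          exact two_abs' hp _ _
      _ = 2 ^ p * (2 ^ p * (II s r (fun z => |u (z + v)| ^ p) + II s r (fun z => |u z| ^ p)) + II s r (fun z => |u (z + v) - u z - dd v u z| ^ p)) := by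
          rw [II_cmul, II_add ((Bdd.const _).mul (r1.add r0)) r4, II_cmul, II_add r1 r0]
      _ ≤ _ := by
          have s1 := shift_pn (s := s) hp hu v
          rw [v1, add_zero] at s1
          gcongr
          · exact (II_pn s1.1 fun y => by positivity).trans s1.2.le
          · exact II_pn iu fun y => by positivity
          · exact (diff2_le hu p hp v v1.ge s r _ le_rfl).trans (II_pn (pn_int hp b3 hu fun z hz => off0 (off_dd _ (off_dd _ hz))) fun y => by positivity)
  rw [d2, d1, LQ_cmul, LQ_cmul, abs_of_pos hh, abs_of_pos (by positivity), pow_two, mul_rpow hh.le hh.le] at k1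
  have hp0 : 0 < h ^ p := by positivity
  refine le_of_mul_le_mul_left (k1.trans (le_of_eq ?_)) hp0
  field_simp
  ring
lemma tstep (hp : 1 ≤ p) (hu : CT u) (s : ℝ) {h : ℝ} (hh : 0 < h) :
    LQ s p u ≤ 2 ^ p * (LQ (s + h) p u + h ^ p * LQ s p (dd et u)) := by
  obtain ⟨r, hr⟩ := sup_r hu
  obtain ⟨v, hv⟩ : ∃ v : En n, v = h • et := ⟨_, rfl⟩
  have v1 : v.1 = h := by simp [hv, et]
  have d1 : dd v u = fun z => h * dd et u z := by rw [hv, dd_smul]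
  have b0 := hu.bdd
  have b1 := hu.bdd.shift v
  have b2 := (hu.dd v).bdd
  have r1 := b1.rpow p hp
  have r4 := (b1.sub b0).rpow p hp
  have k1 : LQ s p u ≤ 2 ^ p * (LQ (s + h) p u + LQ s p (dd v u)) := by
    rw [pn_II hp (fun z hz => off0 hz) hr]
    calc _ ≤ II s r (fun z => 2 ^ p * (|u (z + v)| ^ p + |u (z + v) - u z| ^ p)) := by
          refine II_mono le_rfl (b0.rpow p hp) ((Bdd.const _).mul (r1.add r4)) (fun z => by positivity) fun z => ?_
          have h1 := two_abs' hp (u (z + v)) (u (z + v) - u z)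
          rwa [sub_sub_cancel] at h1
      _ = 2 ^ p * (II s r (fun z => |u (z + v)| ^ p) + II s r (fun z => |u (z + v) - u z| ^ p)) := by
          rw [II_cmul, II_add r1 r4]
      _ ≤ _ := by
          have s1 := shift_pn (s := s) hp hu v
          rw [v1] at s1
          gcongr
          · exact (II_pn s1.1 fun y => by positivity).trans s1.2.le
          · exact (diff_le hu p hp v (by rw [v1]; exact hh.le) s r _ le_rfl).trans (II_pn (pn_int hp b2 hu fun z hz => off0 (off_dd _ hz)) fun y => by positivity)
  rwa [d1, LQ_cmul, abs_of_pos hh] at k1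
end fin
section fin2
noncomputable def LL (a : Fm n) (b : En n → Ix n → ℝ) (c u : Fu n) : En n → ℝ :=
  fun z => mp a u z + (∑ j, b z j * dx j u z) + c z * u z
lemma sq_rpow (p x : ℝ) : (x ^ 2) ^ (p / 2) = |x| ^ p := by
  rw [← sq_abs, ← Real.rpow_natCast, ← rpow_mul (abs_nonneg x)]; congr 1; push_cast; ring
lemma ex_h (hp : 0 < p) {X e : ℝ} (hX : 0 ≤ X) (he : 0 < e) : ∃ h : ℝ, 0 < h ∧ h ^ p * X ≤ e := by
  refine ⟨(e / (X + 1)) ^ (1 / p), by positivity, ?_⟩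
  rw [← rpow_mul (by positivity), one_div_mul_cancel hp.ne', Real.rpow_one, div_mul_eq_mul_div, div_le_iff₀ (by positivity)]
  nlinarith
lemma low_pt {K : ℝ} (hp : 1 ≤ p) (a : Fm n) (b : En n → Ix n → ℝ) (c u : Fu n)
    (hb : ∀ q j, |b q j| ≤ K) (hc : ∀ q, |c q| ≤ K) (z) : |mp a u z| ^ p ≤ 2 ^ p * (|LL a b c u z| ^ p + 2 ^ p * (((n:ℝ)+1) ^ (p - 1) * (K ^ p * ∑ j, |dx j u z| ^ p) + K ^ p * |u z| ^ p)) := by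
  have p0 : 0 ≤ p := by linarith
  have K0 : 0 ≤ K := (abs_nonneg _).trans (hc z)
  have e : mp a u z = LL a b c u z - ((∑ j, b z j * dx j u z) + c z * u z) := by unfold LL; ring
  rw [e]
  refine (two_abs' hp _ _).trans ?_
  gcongr
  refine (two_abs hp _ _).trans ?_
  gcongr
  · have h1 : |∑ j, b z j * dx j u z| ≤ ∑ j, |K * dx j u z| := (Finset.abs_sum_le_sum_abs _ _).trans (sum_le_sum fun j _ => by
      rw [abs_mul, abs_mul, abs_of_nonneg K0]
      gcongr
      exact hb z j)
    refine (rpow_le_rpow (abs_nonneg _) h1 p0).trans ((Real.rpow_sum_le_const_mul_sum_rpow _ _ hp).trans (le_of_eq ?_))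
    simp only [Finset.card_univ, Fintype.card_fin, Nat.cast_add, Nat.cast_one]
    congr 1
    rw [mul_sum]
    refine sum_congr rfl fun j _ => ?_
    rw [abs_mul, abs_of_nonneg K0, mul_rpow K0 (abs_nonneg _)]
  · rw [← mul_rpow K0 (abs_nonneg _), abs_mul]
    refine rpow_le_rpow (by positivity) ?_ p0
    gcongr
    exact hc z
lemma LQ_le_PW (hp : 1 ≤ p) (hu : CT u) (hf : Bdd f) (h0 : ∀ z ∉ tsupport u, f z = 0) (h : ∀ z, f z ^ 2 ≤ VV u z) : LQ s p f ≤ PW s (p / 2) (VV u) := by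
  have p0 : 0 < p / 2 := by linarith
  refine integral_mono (pn_int hp hf hu h0).integrableOn (pw_int p0 (VV_bdd hu) (VV_nonneg u) hu fun z hz => off_VV hz).integrableOn fun z => ?_
  simp only
  rw [← sq_rpow]
  exact rpow_le_rpow (sq_nonneg _) (h z) p0.le
lemma VV_t (u : Fu n) (z) : dd et u z ^ 2 ≤ VV u z := by unfold VV; linarith [D2_nonneg u z]
lemma VV_x (u : Fu n) (j z) : dx j (dx j u) z ^ 2 ≤ VV u z := by
  have h1 : dx j (dx j u) z ^ 2 ≤ ∑ k, dx j (dx k u) z ^ 2 :=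
    single_le_sum (f := fun k => dx j (dx k u) z ^ 2) (fun k _ => sq_nonneg _) (mem_univ j)
  have h2 : ∑ k, dx j (dx k u) z ^ 2 ≤ D2 u z :=
    single_le_sum (f := fun j => ∑ k, dx j (dx k u) z ^ 2) (fun k _ => sum_nonneg fun _ _ => sq_nonneg _) (mem_univ j)
  unfold VV; linarith [sq_nonneg (dd et u z)]
lemma LL_bdd (hδ : 0 < δ) {K : ℝ} (hm : ∀ j k, Measurable fun q => a q j k) (hE : ∀ y, Ell δ (a y))
    {b : En n → Ix n → ℝ} {c : Fu n} (mb : ∀ j, Measurable fun q => b q j) (mc : Measurable c)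
    (hb : ∀ q j, |b q j| ≤ K) (hc : ∀ q, |c q| ≤ K) (hu : CT u) : Bdd (LL a b c u) := by
  have h1 := mp_bdd hδ hm hE hu
  have h2 : ∀ j, Bdd fun q => b q j := fun j => ⟨mb j, K, fun z => hb z j⟩
  have h3 : Bdd c := ⟨mc, K, hc⟩
  have h4 := fun j => (hu.dd (ex j)).bdd
  have h5 := hu.bdd
  unfold LL
  fun_prop
lemma off_LL (a : Fm n) (b : En n → Ix n → ℝ) (c : Fu n) (hz : z ∉ tsupport u) : LL a b c u z = 0 := by
  simp [LL, off_mp a hz, off0 hz, off0 (off_dd _ hz)]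
lemma low_int (hδ : 0 < δ) {K : ℝ} (hp : 1 ≤ p) (hm : ∀ j k, Measurable fun q => a q j k) (hE : ∀ y, Ell δ (a y))
    {b : En n → Ix n → ℝ} {c : Fu n} (mb : ∀ j, Measurable fun q => b q j) (mc : Measurable c)
    (hb : ∀ q j, |b q j| ≤ K) (hc : ∀ q, |c q| ≤ K) (hu : CT u) (s : ℝ) :
    LQ s p (mp a u) ≤ 2 ^ p * (LQ s p (LL a b c u) + 2 ^ p * (((n:ℝ)+1) ^ (p - 1) * (K ^ p * ∑ j, LQ s p (dx j u)) + K ^ p * LQ s p u)) := by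
  have i1 := (pn_int hp (LL_bdd hδ hm hE mb mc hb hc hu) hu fun z hz => off_LL a b c hz).integrableOn (s := Hs n s)
  have i2 := (pn_int hp (mp_bdd hδ hm hE hu) hu fun z hz => off_mp a hz).integrableOn (s := Hs n s)
  have i3 := fun j => (pn_int hp (hu.dd (ex j)).bdd hu fun z hz => off0 (off_dd _ hz)).integrableOn (s := Hs n s)
  have i4 := (pn_int hp hu.bdd hu fun z hz => off0 hz).integrableOn (s := Hs n s)
  have i5 : IntegrableOn (fun z => ∑ j, |dx j u z| ^ p) (Hs n s) := integrable_finsetSum _ fun j _ => i3 j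
  have i6 : IntegrableOn (fun z => ((n:ℝ)+1) ^ (p - 1) * (K ^ p * ∑ j, |dx j u z| ^ p)) (Hs n s) := (i5.const_mul (K ^ p)).const_mul (((n:ℝ)+1) ^ (p - 1))
  have i7 : IntegrableOn (fun z => K ^ p * |u z| ^ p) (Hs n s) := i4.const_mul _
  have i8 : IntegrableOn (fun z => 2 ^ p * (((n:ℝ)+1) ^ (p - 1) * (K ^ p * ∑ j, |dx j u z| ^ p) + K ^ p * |u z| ^ p)) (Hs n s) := (i6.add i7).const_mul _
  have i9 : IntegrableOn (fun z => 2 ^ p * (|LL a b c u z| ^ p + 2 ^ p * (((n:ℝ)+1) ^ (p - 1) * (K ^ p * ∑ j, |dx j u z| ^ p) + K ^ p * |u z| ^ p))) (Hs n s) := (i1.add i8).const_mul _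
  refine (integral_mono i2 i9 (low_pt hp a b c u hb hc)).trans (le_of_eq ?_)
  unfold LQ
  rw [integral_const_mul, integral_add i1 i8, integral_const_mul, integral_add i6 i7, integral_const_mul, integral_const_mul, integral_const_mul, integral_finsetSum _ fun j _ => i3 j]
lemma alg1 {V C P L D X U D' Y H m : ℝ} (hC : 0 ≤ C) (hP : 0 ≤ P) (hD : 0 ≤ D) (hD' : 0 ≤ D') (hL : 0 ≤ L) (hU : 0 ≤ U) (hY : 0 ≤ Y) (hm : 0 ≤ m)
    (h1 : V ≤ C * (P * (L + P * (D * X + D' * U)) + U)) (hX : X ≤ m * (P * (Y * U + H * V))) (hH : H * (C * P * P * D * m * P) ≤ 1 / 2) (hV : 0 ≤ V) :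
    V ≤ 2 * (C * P + C * P * P * D * m * P * Y + C * P * P * D' + C) * (L + U) := by
  have h2 : C * P * P * D * X ≤ C * P * P * D * (m * (P * (Y * U + H * V))) := by gcongr
  have h3 : H * (C * P * P * D * m * P) * V ≤ 1 / 2 * V := by gcongr
  have h4 : 0 ≤ (C * P * P * D * m * P * Y + C * P * P * D' + C) * L := by positivity
  have h5 : 0 ≤ C * P * U := by positivity
  linarith
lemma full (n : ℕ) (δ : ℝ) (hδ : 0 < δ) (hδ1 : δ < 1) (hn : 1 ≤ n) (p K : ℝ) (hp : 2 < p) (hK : 0 < K)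
    (om : ℝ → ℝ) (hom : ContinuousOn om (Ici 0)) (hom0 : om 0 = 0) : ∃ C, 0 ≤ C ∧ ∀ (a : Fm n) (b : En n → Ix n → ℝ) (c : Fu n),
    (∀ j k, Measurable fun q => a q j k) → (∀ j, Measurable fun q => b q j) → Measurable c → (∀ q j, |b q j| ≤ K) → (∀ q, |c q| ≤ K) →
    (∀ y, Ell δ (a y)) → (∀ R, 0 ≤ R → aSharp a R ≤ om R) → ∀ u, CT u → ∀ s,
    PW s (p / 2) (VV u) ≤ C * (LQ s p (LL a b c u) + LQ s p u) := by
  obtain ⟨C, hC, H⟩ := main_est n δ hδ hδ1 hn (p / 2) (by linarith) om hom hom0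
  obtain ⟨D, hD⟩ : ∃ D : ℝ, D = ((n:ℝ)+1) ^ (p - 1) * K ^ p := ⟨_, rfl⟩
  have D0 : 0 ≤ D := by rw [hD]; positivity
  have hp1 : 1 ≤ p := by linarith
  obtain ⟨h, h0, hh⟩ := ex_h (p := p) (by linarith) (X := C * 2 ^ p * 2 ^ p * D * (n+1) * 2 ^ p) (by positivity) (show (0:ℝ) < 1 / 2 by norm_num)
  refine ⟨2 * (C * 2 ^ p + C * 2 ^ p * 2 ^ p * D * (n+1) * 2 ^ p * (2 ^ p * (2 * (h ^ p)⁻¹)) + C * 2 ^ p * 2 ^ p * K ^ p + C), by positivity, fun a b c ma mb mc hb hc hE ho u hu s => ?_⟩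
  have k1 := H a ma hE ho u hu s
  simp only [PW, sq_rpow] at k1
  change PW s (p / 2) (VV u) ≤ C * (LQ s p (mp a u) + LQ s p u) at k1
  have k2 := low_int hδ hp1 ma hE mb mc hb hc hu s
  have U0 : 0 ≤ LQ s p u := LQ_nonneg
  have L0 : 0 ≤ LQ s p (LL a b c u) := LQ_nonneg
  have V0 : 0 ≤ PW s (p / 2) (VV u) := PW_nonneg (VV_nonneg u)
  have k3 : ∑ j, LQ s p (dx j u) ≤ (n + 1) * (2 ^ p * (2 ^ p * (2 * (h ^ p)⁻¹) * LQ s p u + h ^ p * PW s (p / 2) (VV u))) := by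
    have : ∀ j ∈ Finset.univ, LQ s p (dx j u) ≤ 2 ^ p * (2 ^ p * (2 * (h ^ p)⁻¹) * LQ s p u + h ^ p * PW s (p / 2) (VV u)) := fun j _ => by
      refine (interp hp1 hu (ex j) rfl s h0).trans ?_
      have := LQ_le_PW (s := s) hp1 hu ((hu.dd (ex j)).dd (ex j)).bdd (fun z hz => off0 (off_dd _ (off_dd _ hz))) (VV_x u j)
      rw [mul_assoc (2 ^ p) (2 * (h ^ p)⁻¹), mul_assoc 2 (h ^ p)⁻¹]
      gcongr
    refine (sum_le_sum this).trans (le_of_eq ?_)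
    simp
  refine alg1 hC (by positivity) D0 (by positivity) L0 U0 (by positivity) (by positivity) (k1.trans ?_) k3 hh V0
  gcongr
  refine k2.trans (le_of_eq ?_)
  rw [hD]; ring
lemma iter {U : ℝ → ℝ} {M L h T : ℝ} (hM : 1 ≤ M) (hL : 0 ≤ L) (hT : U T ≤ 0) (hs : ∀ s, 0 ≤ s → U s ≤ M * U (s + h) + L) :
    ∀ k : ℕ, (∀ i : ℕ, i ≤ k → 0 ≤ T - i * h) → U (T - k * h) ≤ k * M ^ k * L := by
  intro k
  induction k with
  | zero => intro _; simpa using hT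
  | succ k ih =>
    intro hk
    have h1 := ih fun i hi => hk i (by omega)
    have h2 := hs _ (hk (k+1) le_rfl)
    rw [show T - ((k + 1 : ℕ) : ℝ) * h + h = T - k * h by push_cast; ring] at h2
    have h3 : 1 ≤ M ^ (k+1) := one_le_pow₀ hM
    have h4 : M * U (T - k * h) ≤ M * (k * M ^ k * L) := by gcongr
    push_cast at h2 ⊢
    have : L ≤ M ^ (k+1) * L := le_mul_of_one_le_left hL h3
    calc _ ≤ M * (k * M ^ k * L) + M ^ (k+1) * L := by linarith
      _ = _ := by rw [pow_succ]; ring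
end fin2
section fin3
lemma LQ_anti (hs : 0 ≤ s) (hi : Integrable fun y => |f y| ^ p) : LQ s p f ≤ LQ 0 p f :=
  setIntegral_mono_set hi.integrableOn (evf fun y => by positivity)
    (LE.le.eventuallyLE fun z (hz : s < z.1) => show 0 < z.1 from hs.trans_lt hz)
lemma fin_est (n : ℕ) (δ : ℝ) (hδ : 0 < δ) (hδ1 : δ < 1) (hn : 1 ≤ n) (p K T : ℝ) (hp : 2 < p) (hK : 0 < K) (hT : 0 < T)
    (om : ℝ → ℝ) (hom : ContinuousOn om (Ici 0)) (hom0 : om 0 = 0) : ∃ C, 0 ≤ C ∧ ∀ (a : Fm n) (b : En n → Ix n → ℝ) (c : Fu n),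
    (∀ j k, Measurable fun q => a q j k) → (∀ j, Measurable fun q => b q j) → Measurable c → (∀ q j, |b q j| ≤ K) → (∀ q, |c q| ≤ K) →
    (∀ y, Ell δ (a y)) → (∀ R, 0 ≤ R → aSharp a R ≤ om R) → ∀ u, CT u → (∀ q : En n, T ≤ q.1 → u q = 0) →
    LQ 0 p u ≤ C * LQ 0 p (LL a b c u) ∧ PW 0 (p / 2) (VV u) ≤ C * LQ 0 p (LL a b c u) ∧ ∀ j, LQ 0 p (dx j u) ≤ C * LQ 0 p (LL a b c u) := by
  obtain ⟨C, hC, H⟩ := full n δ hδ hδ1 hn p K hp hK om hom hom0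
  have hp1 : 1 ≤ p := by linarith
  obtain ⟨h0, h00, hh0⟩ := ex_h (p := p) (by linarith) (X := 2 ^ p * C) (by positivity) (show (0:ℝ) < 1 / 2 by norm_num)
  obtain ⟨m, hm⟩ := exists_nat_gt (T / h0)
  have m0 : (0:ℝ) < m := lt_trans (by positivity) hm
  obtain ⟨h, hh⟩ : ∃ h, h = T / m := ⟨_, rfl⟩
  have hpos : 0 < h := by rw [hh]; positivity
  have hle : h ≤ h0 := by
    rw [hh, div_le_iff₀ m0]
    rw [div_lt_iff₀ h00] at hm
    linarith
  have hmh : m * h = T := by rw [hh]; field_simp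
  have hhp : h ^ p * (2 ^ p * C) ≤ 1 / 2 := le_trans (by gcongr) hh0
  have M1 : (1:ℝ) ≤ 2 * 2 ^ p := by
    have : (1:ℝ) ≤ 2 ^ p := Real.one_le_rpow (by norm_num) (by linarith)
    linarith
  obtain ⟨A, hA⟩ : ∃ A : ℝ, A = m * (2 * 2 ^ p) ^ m := ⟨_, rfl⟩
  have A0 : 0 ≤ A := by rw [hA]; positivity
  obtain ⟨Bb, hB⟩ : ∃ B : ℝ, B = C * (1 + A) := ⟨_, rfl⟩
  have B0 : 0 ≤ Bb := by rw [hB]; positivity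
  refine ⟨A + Bb + 2 ^ p * (2 ^ p * (2 * A) + Bb), by positivity, fun a b c ma mb mc hb hc hE ho u hu hz => ?_⟩
  have H := H a b c ma mb mc hb hc hE ho u hu
  have iL := pn_int hp1 (LL_bdd hδ ma hE mb mc hb hc hu) hu fun z hz => off_LL a b c hz
  have L0 : 0 ≤ LQ 0 p (LL a b c u) := LQ_nonneg
  have UT : LQ T p u ≤ 0 := by
    refine le_of_eq (setIntegral_eq_zero_of_forall_eq_zero fun z (hz' : T < z.1) => ?_)
    rw [hz z hz'.le, abs_zero, zero_rpow (by linarith)]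
  have step : ∀ s, 0 ≤ s → LQ s p u ≤ 2 * 2 ^ p * LQ (s + h) p u + LQ 0 p (LL a b c u) := by
    intro s hs
    have t1 := tstep hp1 hu s hpos
    have t2 := LQ_le_PW (s := s) hp1 hu (hu.dd et).bdd (fun z hz => off0 (off_dd _ hz)) (VV_t u)
    have t3 := H s
    have t4 := LQ_anti hs iL
    have U0 : 0 ≤ LQ s p u := LQ_nonneg
    have L1 : 0 ≤ LQ s p (LL a b c u) := LQ_nonneg
    have t5 : 2 ^ p * (h ^ p * LQ s p (dd et u)) ≤ 1 / 2 * (LQ s p (LL a b c u) + LQ s p u) := by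
      calc _ ≤ 2 ^ p * (h ^ p * (C * (LQ s p (LL a b c u) + LQ s p u))) := by
            gcongr
            exact t2.trans t3
        _ = h ^ p * (2 ^ p * C) * (LQ s p (LL a b c u) + LQ s p u) := by ring
        _ ≤ _ := by gcongr
    linarith
  have k1 : LQ 0 p u ≤ A * LQ 0 p (LL a b c u) := by
    have := iter (U := fun s => LQ s p u) M1 L0 UT step m (fun i hi => by
      rw [← hmh, ← sub_mul]
      have : (i:ℝ) ≤ m := by exact_mod_cast hi
      exact mul_nonneg (by linarith) hpos.le)
    rw [hmh, sub_self] at this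
    rw [hA]; exact this
  have k2 : PW 0 (p / 2) (VV u) ≤ Bb * LQ 0 p (LL a b c u) := by
    refine (H 0).trans ?_
    rw [hB, mul_assoc]
    gcongr
    linarith
  have P0 : (0:ℝ) ≤ 2 ^ p := by positivity
  obtain ⟨X, hX⟩ : ∃ X, X = LQ 0 p (LL a b c u) := ⟨_, rfl⟩
  rw [← hX] at k1 k2 L0 ⊢
  have e1 : 0 ≤ A * X := by positivity
  have e2 : 0 ≤ Bb * X := by positivity
  have e3 : 0 ≤ 2 ^ p * (2 ^ p * (2 * (A * X)) + Bb * X) := by positivity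
  refine ⟨by linarith, by linarith, fun j => ?_⟩
  have k3 := interp hp1 hu (ex j) rfl 0 one_pos
  have k4 := (LQ_le_PW (s := 0) hp1 hu ((hu.dd (ex j)).dd (ex j)).bdd (fun z hz => off0 (off_dd _ (off_dd _ hz))) (VV_x u j)).trans k2
  rw [Real.one_rpow, inv_one, one_mul, one_mul] at k3
  have k5 : LQ 0 p (dx j u) ≤ 2 ^ p * (2 ^ p * (2 * (A * X)) + Bb * X) := k3.trans (by gcongr)
  linarith
lemma Om_sub (T : ℝ) : OmegaT (n+1) T ⊆ Hs n 0 := fun z hz => hz.1.1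
lemma nrm_le {T : ℝ} (hp : 0 < p) (hi : Integrable fun y => |f y| ^ p) {A X : ℝ} (hA : 0 ≤ A) (hX : 0 ≤ X) (h : LQ 0 p f ≤ A * X) :
    LpNormOn p (OmegaT (n+1) T) f ≤ A ^ (1 / p) * X ^ (1 / p) := by
  unfold LpNormOn
  rw [← mul_rpow hA hX]
  refine rpow_le_rpow (integral_nonneg fun y => by positivity) (le_trans ?_ h) (by positivity)
  exact setIntegral_mono_set hi.integrableOn (evf fun y => by positivity) (LE.le.eventuallyLE (Om_sub T))
lemma nrm_eq {T : ℝ} (hp : 1 ≤ p) (h0 : ∀ z ∉ tsupport u, f z = 0) (hz : ∀ q : En n, T ≤ q.1 → u q = 0) :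
    LQ 0 p f = ∫ q in OmegaT (n+1) T, |f q| ^ p := by
  refine setIntegral_eq_of_subset_of_ae_sdiff_eq_zero (Hs_meas 0).nullMeasurableSet (Om_sub T) ?_
  have nul : volume {z : En n | z.1 = T} = 0 := by
    have : {z : En n | z.1 = T} = {T} ×ˢ Set.univ := by ext z; simp
    rw [this, volume_eq_prod, Measure.prod_prod]; simp
  have : ∀ᵐ z : En n, z.1 ≠ T := by rw [ae_iff]; simpa using nul
  filter_upwards [this] with z hzT hz'
  have hgt : T < z.1 := by
    by_contra hcon
    exact hz'.2 ⟨⟨hz'.1, lt_of_le_of_ne (not_lt.1 hcon) hzT⟩, trivial⟩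
  rw [h0 z, abs_zero, zero_rpow (by linarith)]
  rw [notMem_tsupport_iff_eventuallyEq]
  filter_upwards [(isOpen_lt continuous_const continuous_fst).mem_nhds hgt] with y hy
  exact hz y (le_of_lt hy)
lemma sqrt_rp {x : ℝ} (hx : 0 ≤ x) : |sqrt x| ^ p = x ^ (p / 2) := by
  rw [abs_of_nonneg (Real.sqrt_nonneg x), Real.sqrt_eq_rpow, ← rpow_mul hx]; congr 1; ring
end fin3

end

theorem stmt18 (n : ℕ) (hn : 1 ≤ n) (δ : ℝ) (hδ : δ ∈ Set.Ioo (0 : ℝ) 1)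
    (K : ℝ) (hK : 0 < K) (p : ℝ) (hp : 2 < p) (T : ℝ) (hT : 0 < T)
    (ω : ℝ → ℝ) (hω : ContinuousOn ω (Set.Ici 0)) (hω0 : ω 0 = 0) :
    ∃ N : ℝ, 0 < N ∧
      ∀ (a : ℝ × (Fin (n + 1) → ℝ) → Fin (n + 1) → Fin (n + 1) → ℝ)
        (b : ℝ × (Fin (n + 1) → ℝ) → Fin (n + 1) → ℝ)
        (c : ℝ × (Fin (n + 1) → ℝ) → ℝ),
        (∀ j k, Measurable fun q => a q j k) →
        (∀ j, Measurable fun q => b q j) → Measurable c →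
        (∀ q j k, a q j k = a q k j) →
        (∀ q j, |b q j| ≤ K) → (∀ q, |c q| ≤ K) →
        (∀ (q : ℝ × (Fin (n + 1) → ℝ)) (θ : Fin (n + 1) → ℝ),
          δ * ∑ j, (θ j) ^ 2 ≤ ∑ j, ∑ k, a q j k * θ j * θ k ∧
          ∑ j, ∑ k, a q j k * θ j * θ k ≤ δ⁻¹ * ∑ j, (θ j) ^ 2) →
        (∀ R : ℝ, 0 ≤ R → aSharp a R ≤ ω R) →
        ∀ u : ℝ × (Fin (n + 1) → ℝ) → ℝ, ContDiff ℝ (⊤ : ℕ∞) u → HasCompactSupport u →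
          (∀ q : ℝ × (Fin (n + 1) → ℝ), T ≤ q.1 → u q = 0) →
          LpNormOn p (OmegaT (n + 1) T) u
              + LpNormOn p (OmegaT (n + 1) T) (pdt u)
              + LpNormOn p (OmegaT (n + 1) T)
                  (fun q => Real.sqrt (∑ j, (pdx j u q) ^ 2))
              + LpNormOn p (OmegaT (n + 1) T)
                  (fun q => Real.sqrt (∑ j, ∑ k, (pdxx j k u q) ^ 2))
            ≤ N * LpNormOn p (OmegaT (n + 1) T) (fun q =>
                pdt u q + (∑ j, ∑ k, a q j k * pdxx j k u q)
                  + (∑ j, b q j * pdx j u q) + c q * u q) := by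

  obtain ⟨C, hC, H⟩ := fin_est n δ hδ.1 hδ.2 hn p K T hp hK hT ω hω hω0
  have hp1 : 1 ≤ p := by linarith
  have p0 : 0 < p := by linarith
  obtain ⟨A2, hA2⟩ : ∃ A : ℝ, A = ((n:ℝ)+1) ^ (p / 2 - 1) * ((n+1) * C) := ⟨_, rfl⟩
  have A20 : 0 ≤ A2 := by rw [hA2]; positivity
  refine ⟨C ^ (1 / p) + C ^ (1 / p) + A2 ^ (1 / p) + C ^ (1 / p) + 1, by positivity, fun a b c ma mb mc hs hb hc hE ho u hu hcu hz => ?_⟩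
  have hu : CT u := ⟨hu, hcu⟩
  have hE' : ∀ y, Ell δ (a y) := fun y => ⟨hs y, fun θ => (hE y θ).1, fun θ => (hE y θ).2⟩
  obtain ⟨k1, k2, k3⟩ := H a b c ma mb mc hb hc hE' ho u hu hz
  have eR : LpNormOn p (OmegaT (n + 1) T) (fun q => pdt u q + (∑ j, ∑ k, a q j k * pdxx j k u q) + (∑ j, b q j * pdx j u q) + c q * u q) =
      (LQ 0 p (LL a b c u)) ^ (1 / p) := by
    rw [nrm_eq hp1 (fun z hz => off_LL a b c hz) hz]; rfl
  rw [eR]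
  obtain ⟨X, hX⟩ : ∃ X, X = LQ 0 p (LL a b c u) := ⟨_, rfl⟩
  rw [← hX] at k1 k2 ⊢
  simp only [← hX] at k3
  have X0 : 0 ≤ X := by rw [hX]; exact LQ_nonneg
  have iV := pw_int (q := p / 2) (by linarith) (VV_bdd hu) (VV_nonneg u) hu fun z hz => off_VV hz
  have n1 := nrm_le (T := T) p0 (pn_int hp1 hu.bdd hu fun z hz => off0 hz) hC X0 k1
  have n2 : LpNormOn p (OmegaT (n + 1) T) (pdt u) ≤ C ^ (1 / p) * X ^ (1 / p) :=
    nrm_le (f := dd et u) p0 (pn_int hp1 (hu.dd et).bdd hu fun z hz => off0 (off_dd _ hz)) hC X0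
      ((LQ_le_PW hp1 hu (hu.dd et).bdd (fun z hz => off0 (off_dd _ hz)) (VV_t u)).trans k2)
  have bS2 : Bdd fun z => Real.sqrt (D2 u z) := by
    obtain ⟨m, M, hM⟩ := D2_bdd hu
    exact ⟨m.sqrt, Real.sqrt M, fun z => by rw [abs_of_nonneg (Real.sqrt_nonneg _)]; exact Real.sqrt_le_sqrt ((le_abs_self _).trans (hM z))⟩
  have oS2 : ∀ z ∉ tsupport u, Real.sqrt (D2 u z) = 0 := fun z hz => by simp [D2, off0 (off_dd _ (off_dd _ hz))]
  have n4 : LpNormOn p (OmegaT (n + 1) T) (fun q => Real.sqrt (∑ j, ∑ k, (pdxx j k u q) ^ 2)) ≤ C ^ (1 / p) * X ^ (1 / p) :=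
    nrm_le (f := fun z => Real.sqrt (D2 u z)) p0 (pn_int hp1 bS2 hu oS2) hC X0
      ((LQ_le_PW hp1 hu bS2 oS2 (fun z => by
        rw [Real.sq_sqrt (D2_nonneg u z)]; unfold VV; linarith [sq_nonneg (dd et u z)])).trans k2)
  have bS1 : Bdd fun z => Real.sqrt (D1 u z) := by
    obtain ⟨m, M, hM⟩ := D1_bdd hu
    exact ⟨m.sqrt, Real.sqrt M, fun z => by rw [abs_of_nonneg (Real.sqrt_nonneg _)]; exact Real.sqrt_le_sqrt ((le_abs_self _).trans (hM z))⟩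
  have oS1 : ∀ z ∉ tsupport u, Real.sqrt (D1 u z) = 0 := fun z hz => by simp [D1, off0 (off_dd _ hz)]
  have i3 := fun j => pn_int hp1 (hu.dd (ex j)).bdd hu fun z hz => off0 (off_dd _ hz)
  have n3 : LpNormOn p (OmegaT (n + 1) T) (fun q => Real.sqrt (∑ j, (pdx j u q) ^ 2)) ≤ A2 ^ (1 / p) * X ^ (1 / p) := by
    refine nrm_le (f := fun z => Real.sqrt (D1 u z)) p0 (pn_int hp1 bS1 hu oS1) A20 X0 ?_
    calc LQ 0 p (fun z => Real.sqrt (D1 u z)) ≤ ∫ z in Hs n 0, ((n:ℝ)+1) ^ (p / 2 - 1) * ∑ j, |dd (ex j) u z| ^ p := by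
          refine integral_mono (pn_int hp1 bS1 hu oS1).integrableOn ((integrable_finsetSum _ fun j _ => i3 j).const_mul _).integrableOn fun z => ?_
          simp only
          rw [sqrt_rp (D1_nonneg u z)]
          have := Real.rpow_sum_le_const_mul_sum_rpow Finset.univ (fun j => dd (ex j) u z ^ 2) (show 1 ≤ p / 2 by linarith)
          simp only [abs_pow, sq_abs, sq_rpow, Finset.card_univ, Fintype.card_fin, Nat.cast_add, Nat.cast_one] at this
          exact this
      _ = ((n:ℝ)+1) ^ (p / 2 - 1) * ∑ j, LQ 0 p (dd (ex j) u) := by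
          rw [integral_const_mul, integral_finsetSum _ fun j _ => (i3 j).integrableOn]; rfl
      _ ≤ ((n:ℝ)+1) ^ (p / 2 - 1) * ∑ j : Fin (n+1), C * X := by
          gcongr with j
          exact k3 j
      _ = _ := by rw [hA2]; simp; ring
  have : 0 ≤ X ^ (1 / p) := by positivity
  linarith
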